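/- Let B = B₁(0) ⊂ ℝ^d and let A₀ be a constant symmetric d×d matrix satisfying λ|ξ|² ≤ A₀ξ·ξ ≤ Λ|ξ|² for all ξ ∈ ℝ^d. For f ∈ L^p(B) with p > 1, let u ∈ W^{2,p}(B) ∩ W^{1,p}₀(B) be the unique solution of the Dirichlet problem tr(A₀ D²u) = f in B, u = 0 on ∂B. Then for every t > 0, |{x ∈ B : |D²u(x)| > t}| ≤ (C/t) ∫_B |f|, where C = C(d, λ, Λ). -/

import Mathlib

open MeasureTheory Metric Filter
open scoped RealInnerProductSpace ENNReal Topology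

noncomputable section

/-- Euclidean space `ℝ^d`. -/
abbrev Euc (d : ℕ) := EuclideanSpace ℝ (Fin d)

/-- The mean oscillation function `ω_f(r) = sup_{x ∈ Ω} ⨍_{Ω ∩ B_r(x)} |f - (f)_{Ω ∩ B_r(x)}|`. -/
noncomputable def meanOsc {d : ℕ} {F : Type*} [NormedAddCommGroup F] [NormedSpace ℝ F]
    (Ω : Set (Euc d)) (f : Euc d → F) (r : ℝ) : ℝ :=
  ⨆ x : Ω, ⨍ y in Ω ∩ ball (x : Euc d) r, ‖f y - ⨍ z in Ω ∩ ball (x : Euc d) r, f z‖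

/-- `f` has Dini mean oscillation on `Ω`: `∫₀¹ ω_f(r)/r dr < ∞`. -/
def HasDMO {d : ℕ} {F : Type*} [NormedAddCommGroup F] [NormedSpace ℝ F]
    (Ω : Set (Euc d)) (f : Euc d → F) : Prop :=
  IntegrableOn (fun r => meanOsc Ω f r / r) (Set.Ioc (0 : ℝ) 1)

/-- A modulus of continuity: nonnegative, nondecreasing on `(0,∞)`, tending to `0` at `0⁺`. -/
def IsModulus (ρ : ℝ → ℝ) : Prop :=
  (∀ t, 0 ≤ ρ t) ∧ MonotoneOn ρ (Set.Ioi 0) ∧ Tendsto ρ (𝓝[>] 0) (𝓝 0)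

/-- The sup norm `‖g‖_{L^∞(s)}` (for continuous `g`). -/
noncomputable def supNorm {d : ℕ} {F : Type*} [NormedAddCommGroup F]
    (g : Euc d → F) (s : Set (Euc d)) : ℝ :=
  ⨆ x : s, ‖g (x : Euc d)‖

/-- `sup_{x ∈ Ω} ∫_{Ω ∩ B_r(x)} g`. -/
noncomputable def supInt {d : ℕ} (Ω : Set (Euc d)) (g : Euc d → ℝ) (r : ℝ) : ℝ :=
  ⨆ x : Ω, ∫ y in Ω ∩ ball (x : Euc d) r, g y

/-- The Hessian `D²u(x)` of `u` at `x`, as a continuous bilinear form. -/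
noncomputable def hess {d : ℕ} (u : Euc d → ℝ) (x : Euc d) :
    Euc d →L[ℝ] Euc d →L[ℝ] ℝ :=
  fderiv ℝ (fun y => fderiv ℝ u y) x

/-- The Dini sum `ω̃(t) = Σ_{i≥1} κ^{iβ} (ω(κ^{-i}t) if κ^{-i}t ≤ 1, else ω(1))`. -/
noncomputable def diniSum (ω : ℝ → ℝ) (κ β : ℝ) (t : ℝ) : ℝ :=
  ∑' i : ℕ, (κ ^ β) ^ (i + 1) *
    (if t / κ ^ (i + 1) ≤ 1 then ω (t / κ ^ (i + 1)) else ω 1)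

/-- The norm `|𝒮| = sup_{|ξ|=1} |𝒮(ξ,ξ,ξ)|` of a (0,3)-tensor. -/
noncomputable def tnorm {d : ℕ} (S : Euc d →L[ℝ] Euc d →L[ℝ] Euc d →L[ℝ] ℝ) : ℝ :=
  ⨆ ξ : sphere (0 : Euc d) 1, |S ξ.1 ξ.1 ξ.1|

/-- A fully symmetric (0,3)-tensor. -/
def Sym3 {d : ℕ} (S : Euc d →L[ℝ] Euc d →L[ℝ] Euc d →L[ℝ] ℝ) : Prop :=
  ∀ x y z : Euc d, S x y z = S y x z ∧ S x y z = S x z y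

/-- `u` is a weak solution of `div(A Du) + b·Du + c u = f` in `Ω`. -/
def IsWeakSolDiv {d : ℕ} (Ω : Set (Euc d)) (A : Euc d → Euc d →L[ℝ] Euc d)
    (b : Euc d → Euc d) (c f u : Euc d → ℝ) : Prop :=
  ∀ φ : Euc d → ℝ, ContDiff ℝ (⊤ : ℕ∞) φ → HasCompactSupport φ → tsupport φ ⊆ Ω →
    ∫ x in Ω, (⟪b x, gradient u x⟫ + c x * u x - f x) * φ x
      = ∫ x in Ω, ⟪A x (gradient u x), gradient φ x⟫

/-- Hölder continuity with exponent `α` on `s`. -/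
def HolderOnE {d : ℕ} {F : Type*} [NormedAddCommGroup F]
    (g : Euc d → F) (α : ℝ) (s : Set (Euc d)) : Prop :=
  ∃ M : ℝ, ∀ x ∈ s, ∀ y ∈ s, ‖g x - g y‖ ≤ M * ‖x - y‖ ^ α

/-- `v` is the weak gradient of `u` on `s`. -/
def IsWeakGrad {d : ℕ} (s : Set (Euc d)) (u : Euc d → ℝ) (v : Euc d → Euc d) : Prop :=
  ∀ φ : Euc d → ℝ, ContDiff ℝ (⊤ : ℕ∞) φ → HasCompactSupport φ → tsupport φ ⊆ s →
    ∫ x in s, u x • gradient φ x = - ∫ x in s, φ x • v x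

/-- `u ∈ W^{1,p}₀(s)`, with weak gradient `v`: `u, v ∈ L^p`, `v` is the weak gradient of `u`,
and `u` is approximable by smooth compactly supported functions in the `W^{1,p}` norm. -/
def MemW1p0 {d : ℕ} (p : ℝ) (s : Set (Euc d)) (u : Euc d → ℝ) (v : Euc d → Euc d) : Prop :=
  IsWeakGrad s u v ∧
  MemLp u (ENNReal.ofReal p) (volume.restrict s) ∧
  MemLp v (ENNReal.ofReal p) (volume.restrict s) ∧
  ∀ ε : ℝ, 0 < ε → ∃ φ : Euc d → ℝ, ContDiff ℝ (⊤ : ℕ∞) φ ∧ HasCompactSupport φ ∧ tsupport φ ⊆ s ∧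
    eLpNorm (fun x => u x - φ x) (ENNReal.ofReal p) (volume.restrict s) < ENNReal.ofReal ε ∧
    eLpNorm (fun x => v x - gradient φ x) (ENNReal.ofReal p) (volume.restrict s) < ENNReal.ofReal ε

/-- The quantity `φ(r) = (1/r) inf_{l ∈ 𝔄} (⨍_{B_r} |Du - l|^{1/2})²`, the infimum being over
affine maps `l(x) = Sx + p` with `S` symmetric. -/
noncomputable def phiFun {d : ℕ} (u : Euc d → ℝ) (r : ℝ) : ℝ :=
  (1 / r) * ⨅ S : {S : Euc d →L[ℝ] Euc d // ∀ ξ η, ⟪S ξ, η⟫ = ⟪ξ, S η⟫}, ⨅ p : Euc d,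
    (⨍ x in ball (0 : Euc d) r, Real.sqrt ‖gradient u x - S.1 x - p‖) ^ 2

end

open scoped ContDiff

section calculus
variable {d : ℕ}

/-- Directional derivative. -/
noncomputable def DD (v : Euc d) (u : Euc d → ℝ) : Euc d → ℝ := fun x => fderiv ℝ u x v

/-- `1 - |x|²`. -/
noncomputable def rho (x : Euc d) : ℝ := 1 - ‖x‖ ^ 2

lemma rho_contDiff {n : WithTop ℕ∞} : ContDiff ℝ n (rho : Euc d → ℝ) := by
  unfold rho; exact contDiff_const.sub (contDiff_norm_sq ℝ)

lemma DD_contDiff {n m : WithTop ℕ∞} {u : Euc d → ℝ} (hu : ContDiff ℝ n u) (h : m + 1 ≤ n)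
    (v : Euc d) : ContDiff ℝ m (DD v u) := by
  unfold DD
  exact (hu.fderiv_right h).clm_apply contDiff_const

lemma DD_smooth {u : Euc d → ℝ} (hu : ContDiff ℝ ∞ u) (v : Euc d) : ContDiff ℝ ∞ (DD v u) :=
  DD_contDiff hu (by simp) v

lemma DD_mul {u w : Euc d → ℝ} {x : Euc d} (hu : DifferentiableAt ℝ u x)
    (hw : DifferentiableAt ℝ w x) (v : Euc d) :
    DD v (fun x => u x * w x) x = u x * DD v w x + DD v u x * w x := by
  unfold DD
  rw [fderiv_fun_mul hu hw]; simp; ring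

lemma DD_add {u w : Euc d → ℝ} {x : Euc d} (hu : DifferentiableAt ℝ u x)
    (hw : DifferentiableAt ℝ w x) (v : Euc d) :
    DD v (fun x => u x + w x) x = DD v u x + DD v w x := by
  unfold DD
  rw [fderiv_fun_add hu hw]; simp

lemma DD_sub {u w : Euc d → ℝ} {x : Euc d} (hu : DifferentiableAt ℝ u x)
    (hw : DifferentiableAt ℝ w x) (v : Euc d) :
    DD v (fun x => u x - w x) x = DD v u x - DD v w x := by
  unfold DD
  rw [fderiv_fun_sub hu hw]; simp

lemma DD_const_mul {u : Euc d → ℝ} {x : Euc d} (hu : DifferentiableAt ℝ u x)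
    (c : ℝ) (v : Euc d) :
    DD v (fun x => c * u x) x = c * DD v u x := by
  unfold DD
  rw [fderiv_const_mul hu]; simp

lemma DD_sum {ι : Type*} (s : Finset ι) {u : ι → Euc d → ℝ} {x : Euc d}
    (hu : ∀ i ∈ s, DifferentiableAt ℝ (u i) x) (v : Euc d) :
    DD v (fun x => ∑ i ∈ s, u i x) x = ∑ i ∈ s, DD v (u i) x := by
  unfold DD
  rw [fderiv_fun_sum hu]; simp

lemma DD_rho (v x : Euc d) : DD v rho x = -2 * ⟪v, x⟫ := by
  unfold DD rho
  have h : HasFDerivAt (fun x : Euc d => 1 - ‖x‖ ^ 2) (0 - 2 • (innerSL ℝ x)) x :=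
    (hasFDerivAt_const (1 : ℝ) x).sub (hasStrictFDerivAt_norm_sq x).hasFDerivAt
  rw [h.fderiv]
  simp [real_inner_comm]

lemma DD_inner (v w x : Euc d) : DD v (fun x => ⟪w, x⟫) x = ⟪w, v⟫ := by
  unfold DD
  have h : HasFDerivAt (fun x : Euc d => ⟪w, x⟫) (innerSL ℝ w) x :=
    (innerSL ℝ w).hasFDerivAt
  rw [h.fderiv]
  simp

lemma DD_comm {u : Euc d → ℝ} (hu : ContDiff ℝ 2 u) (v w x : Euc d) :
    DD v (DD w u) x = DD w (DD v u) x := by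
  have hs : IsSymmSndFDerivAt ℝ u x :=
    hu.contDiffAt.isSymmSndFDerivAt (by simp)
  have hd : DifferentiableAt ℝ (fderiv ℝ u) x :=
    (hu.fderiv_right (m := 1) (by norm_num)).differentiable (by simp) x
  have key : ∀ v w : Euc d, DD v (DD w u) x = fderiv ℝ (fderiv ℝ u) x v w := by
    intro v w
    unfold DD
    rw [fderiv_clm_apply hd (differentiableAt_const w)]
    simp
  rw [key, key, hs.eq]

lemma rho_eq_zero {x : Euc d} (hx : x ∈ sphere (0 : Euc d) 1) : rho x = 0 := by
  simp at hx; simp [rho, hx]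

lemma rho_pos {x : Euc d} (hx : x ∈ ball (0 : Euc d) 1) : 0 < rho x := by
  simp at hx; unfold rho; nlinarith [norm_nonneg x]

lemma rho_le_one (x : Euc d) : rho x ≤ 1 := by
  unfold rho; nlinarith [norm_nonneg x]

lemma lip_closedBall {W : Euc d → ℝ} (hW : ContDiff ℝ 1 W) :
    ∃ K : NNReal, LipschitzOnWith K W (closedBall (0 : Euc d) 1) := by
  obtain ⟨C, hC⟩ := (isCompact_closedBall (0 : Euc d) 1).exists_bound_of_continuousOn
    (hW.continuous_fderiv (by simp)).continuousOn
  refine ⟨C.toNNReal, (convex_closedBall (0 : Euc d) 1).lipschitzOnWith_of_nnnorm_fderiv_le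
    (fun x _ => hW.differentiable (by simp) x) (fun x hx => ?_)⟩
  rw [← NNReal.coe_le_coe]
  simp only [coe_nnnorm]
  exact (hC x hx).trans (Real.le_coe_toNNReal C)

/-- extension by zero is Lipschitz -/
lemma lip_ext {W : Euc d → ℝ} (hW : ContDiff ℝ 1 W)
    (h0 : ∀ x ∈ sphere (0 : Euc d) 1, W x = 0) :
    ∃ K : NNReal, LipschitzWith K ((closedBall (0 : Euc d) 1).indicator W) := by
  obtain ⟨K, hK⟩ := lip_closedBall hW
  refine ⟨K, ?_⟩
  have aux : ∀ x ∈ closedBall (0 : Euc d) 1, ∀ y, y ∉ closedBall (0 : Euc d) 1 →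
      dist (W x) 0 ≤ K * dist x y := by
    intro x hx y hy
    have hx' : ‖x‖ ≤ 1 := by simpa using hx
    have hy' : 1 < ‖y‖ := by simpa using hy
    have hc : ContinuousOn (fun t : ℝ => ‖AffineMap.lineMap x y t‖) (Set.Icc 0 1) := by
      apply Continuous.continuousOn
      exact (AffineMap.lineMap_continuous (R := ℝ) (p := x) (q := y)).norm
    have := intermediate_value_Icc (zero_le_one (α := ℝ)) hc
    obtain ⟨t, ht, hte⟩ := this (show (1 : ℝ) ∈ _ by simp; exact ⟨hx', hy'.le⟩)
    set z : Euc d := AffineMap.lineMap x y t with hz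
    have hzs : z ∈ sphere (0 : Euc d) 1 := by simpa using hte
    calc dist (W x) 0 = dist (W x) (W z) := by rw [h0 z hzs]
      _ ≤ K * dist x z := hK.dist_le_mul x hx z (sphere_subset_closedBall hzs)
      _ ≤ K * dist x y := by
        gcongr
        rw [hz, dist_left_lineMap]
        have : ‖t‖ ≤ 1 := by rw [Real.norm_of_nonneg ht.1]; exact ht.2
        nlinarith [dist_nonneg (x := x) (y := y)]
  refine LipschitzWith.of_dist_le_mul fun x y => ?_
  by_cases hx : x ∈ closedBall (0 : Euc d) 1 <;> by_cases hy : y ∈ closedBall (0 : Euc d) 1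
  · simp only [Set.indicator_of_mem hx, Set.indicator_of_mem hy]
    exact hK.dist_le_mul x hx y hy
  · simp only [Set.indicator_of_mem hx, Set.indicator_of_notMem hy]
    exact aux x hx y hy
  · simp only [Set.indicator_of_mem hy, Set.indicator_of_notMem hx]
    rw [dist_comm, dist_comm x y]
    exact aux y hy x hx
  · simp only [Set.indicator_of_notMem hy, Set.indicator_of_notMem hx]
    simp; positivity

lemma int_DD_eq_zero {W : Euc d → ℝ} (hW : ContDiff ℝ 1 W)
    (h0 : ∀ x ∈ sphere (0 : Euc d) 1, W x = 0) (v : Euc d) :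
    ∫ x in ball (0 : Euc d) 1, DD v W x = 0 := by
  obtain ⟨K, hK⟩ := lip_ext hW h0
  have hcs : HasCompactSupport ((closedBall (0 : Euc d) 1).indicator W) := by
    refine HasCompactSupport.intro (isCompact_closedBall (0 : Euc d) 1) fun x hx => ?_
    simp [Set.indicator_of_notMem hx]
  have h1 := LipschitzWith.integral_lineDeriv_mul_eq (μ := volume)
    (LipschitzWith.const (1 : ℝ) : LipschitzWith 0 (fun _ : Euc d => (1 : ℝ))) hK hcs (-v)
  have hl : ∀ x v : Euc d, lineDeriv ℝ (fun _ : Euc d => (1 : ℝ)) x v = 0 := by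
    intro x v; simp [lineDeriv]
  simp only [hl, zero_mul, integral_zero, mul_one, neg_neg] at h1
  rw [h1, ← integral_indicator measurableSet_ball]
  apply integral_congr_ae
  have hsph : ∀ᵐ x : Euc d, x ∉ sphere (0 : Euc d) 1 := by
    rw [ae_iff]; simp only [not_not]
    exact Measure.addHaar_sphere_of_ne_zero volume 0 one_ne_zero
  filter_upwards [hsph] with x hx
  by_cases hb : x ∈ ball (0 : Euc d) 1
  · rw [Set.indicator_of_mem hb]
    have he : (closedBall (0 : Euc d) 1).indicator W =ᶠ[𝓝 x] W := by
      filter_upwards [isOpen_ball.mem_nhds hb] with y hy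
      rw [Set.indicator_of_mem (ball_subset_closedBall hy)]
    rw [he.lineDeriv_eq, ((hW.differentiable (by simp)) x).lineDeriv_eq_fderiv]
    rfl
  · rw [Set.indicator_of_notMem hb]
    have hxc : x ∈ (closedBall (0 : Euc d) 1)ᶜ := by
      simp at hx hb ⊢
      exact lt_of_le_of_ne hb (Ne.symm hx)
    have he : (closedBall (0 : Euc d) 1).indicator W =ᶠ[𝓝 x] fun _ => 0 := by
      filter_upwards [isClosed_closedBall.isOpen_compl.mem_nhds hxc] with y hy
      rw [Set.indicator_of_notMem hy]
    rw [he.lineDeriv_eq]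
    simp [lineDeriv]

lemma ball_int {f : Euc d → ℝ} (hf : Continuous f) :
    IntegrableOn f (ball (0 : Euc d) 1) :=
  (hf.continuousOn.integrableOn_compact (isCompact_closedBall 0 1)).mono_set ball_subset_closedBall

lemma ibp {f g : Euc d → ℝ} (hf : ContDiff ℝ 1 f) (hg : ContDiff ℝ 1 g)
    (h0 : ∀ x ∈ sphere (0 : Euc d) 1, f x * g x = 0) (v : Euc d) :
    ∫ x in ball (0 : Euc d) 1, f x * DD v g x = - ∫ x in ball (0 : Euc d) 1, DD v f x * g x := by
  have h := int_DD_eq_zero (hf.mul hg) h0 v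
  have e : ∀ x, DD v (fun x => f x * g x) x = f x * DD v g x + DD v f x * g x := fun x =>
    DD_mul (hf.differentiable (by simp) x) (hg.differentiable (by simp) x) v
  simp only [e] at h
  have c1 : Continuous (DD v f) := (DD_contDiff (m := 0) hf (by simp) v).continuous
  have c2 : Continuous (DD v g) := (DD_contDiff (m := 0) hg (by simp) v).continuous
  rw [integral_add (f := fun x => f x * DD v g x) (g := fun x => DD v f x * g x)
    (ball_int (hf.continuous.mul c2)) (ball_int (c1.mul hg.continuous))] at h
  linarith

/-- lower bound by boundary values -/
lemma lower_of_sphere {g : Euc d → ℝ} (hg : ContDiff ℝ 1 g)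
    (h0 : ∀ x ∈ sphere (0 : Euc d) 1, 0 ≤ g x) :
    ∃ C : ℝ, 0 ≤ C ∧ ∀ x ∈ ball (0 : Euc d) 1, -(C * rho x) ≤ g x := by
  obtain ⟨K, hK⟩ := lip_closedBall hg
  refine ⟨K + |g 0|, by positivity, fun x hx => ?_⟩
  have hr := rho_pos hx
  by_cases hx0 : x = 0
  · subst hx0
    have : rho (0 : Euc d) = 1 := by simp [rho]
    rw [this]
    have := neg_abs_le (g 0)
    have := K.2
    simp at *
    linarith
  · have hn : 0 < ‖x‖ := norm_pos_iff.2 hx0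
    have hn1 : ‖x‖ < 1 := by simpa using hx
    set z : Euc d := ‖x‖⁻¹ • x with hz
    have hzs : z ∈ sphere (0 : Euc d) 1 := by
      simp [hz, norm_smul, hn.ne']
    have h1 := hK.dist_le_mul x (ball_subset_closedBall hx) z (sphere_subset_closedBall hzs)
    have h2 : dist x z = 1 - ‖x‖ := by
      have : x - z = -((‖x‖⁻¹ - 1) • x) := by rw [hz]; module
      rw [dist_eq_norm, this, norm_neg, norm_smul, Real.norm_of_nonneg]
      · field_simp
      · have := (one_le_inv₀ hn).2 hn1.le
        linarith
    rw [h2, Real.dist_eq] at h1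
    have h3 := h0 z hzs
    have h4 := neg_le_of_abs_le h1
    have h5 : 1 - ‖x‖ ≤ rho x := by unfold rho; nlinarith
    have h6 : (K : ℝ) * (1 - ‖x‖) ≤ K * rho x := by gcongr
    have h7 : 0 ≤ |g 0| * rho x := by positivity
    linarith

lemma bdd_of_sphere {g : Euc d → ℝ} (hg : ContDiff ℝ 1 g)
    (h0 : ∀ x ∈ sphere (0 : Euc d) 1, g x = 0) :
    ∃ C : ℝ, 0 ≤ C ∧ ∀ x ∈ ball (0 : Euc d) 1, |g x| ≤ C * rho x := by
  obtain ⟨C, hC, h1⟩ := lower_of_sphere hg (fun x hx => (h0 x hx).ge)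
  obtain ⟨C', hC', h2⟩ := lower_of_sphere hg.neg (fun x hx => by simp [h0 x hx])
  refine ⟨C + C', by positivity, fun x hx => ?_⟩
  have := rho_pos hx
  have := h1 x hx
  have := h2 x hx
  simp at this
  rw [abs_le]
  constructor <;> nlinarith

lemma div_nonneg_aux (e : OrthonormalBasis (Fin d) ℝ (Euc d)) {F : Fin d → Euc d → ℝ}
    (hF : ∀ k, ContDiff ℝ 1 (F k))
    (h0 : ∀ x ∈ sphere (0 : Euc d) 1, 0 ≤ ∑ k, ⟪e k, x⟫ * F k x) :
    0 ≤ ∫ x in ball (0 : Euc d) 1, ∑ k, DD (e k) (F k) x := by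
  have hgs : ContDiff ℝ 1 (fun x => ∑ k, ⟪e k, x⟫ * F k x) :=
    ContDiff.sum fun k _ => (contDiff_const.inner ℝ contDiff_id).mul (hF k)
  obtain ⟨C, hC, hl⟩ := lower_of_sphere hgs h0
  have cDF : ∀ k, Continuous (DD (e k) (F k)) := fun k =>
    (DD_contDiff (m := 0) (hF k) (by simp) _).continuous
  have cdiv : Continuous fun x => ∑ k, DD (e k) (F k) x := continuous_finsetSum _ fun k _ => cDF k
  have crho : Continuous (rho : Euc d → ℝ) := (rho_contDiff (n := 0)).continuous
  let κ : ℕ → Euc d → ℝ := fun n x => 1 - Real.exp (-(n * rho x))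
  have hκ : ∀ n, ContDiff ℝ 1 (κ n) := fun n =>
    contDiff_const.sub ((contDiff_const.mul rho_contDiff).neg.exp)
  have hDκ : ∀ n k x, DD (e k) (κ n) x = -2 * n * Real.exp (-(n * rho x)) * ⟪e k, x⟫ := by
    intro n k x
    have hr : HasFDerivAt (rho : Euc d → ℝ) (fderiv ℝ rho x) x :=
      ((rho_contDiff (n := 1)).differentiable (by simp) x).hasFDerivAt
    have h2 : HasFDerivAt (κ n) _ x := ((hr.const_mul (n : ℝ)).neg.exp).const_sub 1
    have h3 := DD_rho (e k) x
    unfold DD at h3 ⊢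
    rw [h2.fderiv]
    simp [h3]; ring
  have key : ∀ n : ℕ, -(2 * C * ∫ x in ball (0 : Euc d) 1, (n * rho x) * Real.exp (-(n * rho x)))
      ≤ ∫ x in ball (0 : Euc d) 1, κ n x * ∑ k, DD (e k) (F k) x := by
    intro n
    have e1 : ∫ x in ball (0 : Euc d) 1, κ n x * ∑ k, DD (e k) (F k) x
        = ∫ x in ball (0 : Euc d) 1, 2 * n * Real.exp (-(n * rho x)) * ∑ k, ⟪e k, x⟫ * F k x := by
      simp only [Finset.mul_sum]
      rw [integral_finsetSum (f := fun k x => κ n x * DD (e k) (F k) x) _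
          (fun k _ => ball_int ((hκ n).continuous.mul (cDF k))),
        integral_finsetSum _ (fun k _ => ball_int ?_)]
      · refine Finset.sum_congr rfl fun k _ => ?_
        rw [ibp (hκ n) (hF k) (fun x hx => by simp [κ, rho_eq_zero hx]), ← integral_neg]
        refine integral_congr_ae (Eventually.of_forall fun x => ?_)
        simp only [hDκ]; ring
      · have := (hF k).continuous
        fun_prop
    rw [e1, ← integral_const_mul, ← integral_neg]
    refine setIntegral_mono_on (ball_int (by fun_prop)) (ball_int (by have := hgs.continuous; fun_prop))
      measurableSet_ball fun x hx => ?_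
    have := hl x hx
    have h2 : 0 ≤ 2 * n * Real.exp (-(n * rho x)) := by positivity
    nlinarith
  have l1 : Tendsto (fun n : ℕ => ∫ x in ball (0 : Euc d) 1, (n * rho x) * Real.exp (-(n * rho x)))
      atTop (𝓝 (∫ x in ball (0 : Euc d) 1, (0 : ℝ))) := by
    refine tendsto_integral_of_dominated_convergence (fun _ => 1)
      (fun n => (Continuous.aestronglyMeasurable (by fun_prop))) (ball_int continuous_const)
      (fun n => ?_) ?_
    · refine (ae_restrict_mem measurableSet_ball).mono fun x hx => ?_
      have hp := rho_pos hx
      have h1 : 0 ≤ n * rho x := by positivity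
      rw [Real.norm_of_nonneg (by positivity), Real.exp_neg, ← div_eq_mul_inv,
        div_le_one (Real.exp_pos _)]
      linarith [Real.add_one_le_exp (n * rho x)]
    · refine (ae_restrict_mem measurableSet_ball).mono fun x hx => ?_
      have hp := rho_pos hx
      have := (Real.tendsto_pow_mul_exp_neg_atTop_nhds_zero 1).comp
        ((tendsto_natCast_atTop_atTop (R := ℝ)).atTop_mul_const hp)
      simpa [Function.comp_def] using this
  have l2 : Tendsto (fun n : ℕ => ∫ x in ball (0 : Euc d) 1, κ n x * ∑ k, DD (e k) (F k) x)
      atTop (𝓝 (∫ x in ball (0 : Euc d) 1, ∑ k, DD (e k) (F k) x)) := by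
    refine tendsto_integral_of_dominated_convergence (fun x => |∑ k, DD (e k) (F k) x|)
      (fun n => (Continuous.aestronglyMeasurable (by have := (hκ n).continuous; fun_prop)))
      (ball_int cdiv.abs)
      (fun n => ?_) ?_
    · refine (ae_restrict_mem measurableSet_ball).mono fun x hx => ?_
      have hp := rho_pos hx
      have h1 : 0 ≤ n * rho x := by positivity
      rw [Real.norm_eq_abs, abs_mul]
      have h3 : Real.exp (-(n * rho x)) ≤ 1 := by simpa using h1
      have h4 := Real.exp_pos (-(n * rho x))
      have : |κ n x| ≤ 1 := by rw [abs_le]; simp only [κ]; constructor <;> linarith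
      nlinarith [abs_nonneg (∑ k, DD (e k) (F k) x)]
    · refine (ae_restrict_mem measurableSet_ball).mono fun x hx => ?_
      have hp := rho_pos hx
      have := Real.tendsto_exp_neg_atTop_nhds_zero.comp
        ((tendsto_natCast_atTop_atTop (R := ℝ)).atTop_mul_const hp)
      have h2 := (this.const_sub 1).mul_const (∑ k, DD (e k) (F k) x)
      simpa [Function.comp_def, κ] using h2
  have l3 := (l1.const_mul (2 * C)).neg
  simp only [integral_zero, mul_zero, neg_zero] at l3
  exact le_of_tendsto_of_tendsto' l3 l2 key

end calculus


section mt
variable {d : ℕ}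

/-- the operator `∑ a_k ∂_k²` in the basis `e`. -/
noncomputable def Lop (e : OrthonormalBasis (Fin d) ℝ (Euc d)) (a : Fin d → ℝ)
    (u : Euc d → ℝ) : Euc d → ℝ := fun x => ∑ k, a k * DD (e k) (DD (e k) u) x

variable (e : OrthonormalBasis (Fin d) ℝ (Euc d)) (a : Fin d → ℝ)

lemma Lop_smooth {u : Euc d → ℝ} (hu : ContDiff ℝ ∞ u) : ContDiff ℝ ∞ (Lop e a u) :=
  ContDiff.sum fun _ _ => contDiff_const.mul (DD_smooth (DD_smooth hu _) _)

lemma sm_diff {u : Euc d → ℝ} (hu : ContDiff ℝ ∞ u) (x : Euc d) : DifferentiableAt ℝ u x :=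
  hu.differentiable (by simp) x

lemma sm_one {u : Euc d → ℝ} (hu : ContDiff ℝ ∞ u) : ContDiff ℝ 1 u := hu.of_le (by simp)

lemma sm_two {u : Euc d → ℝ} (hu : ContDiff ℝ ∞ u) : ContDiff ℝ 2 u :=
  hu.of_le (by simpa using (WithTop.coe_le_coe.2 (le_top : (2 : ℕ∞) ≤ ⊤)))

lemma inner_sm (v : Euc d) : ContDiff ℝ ∞ (fun x : Euc d => ⟪v, x⟫) :=
  contDiff_const.inner ℝ contDiff_id

lemma DD_rho_mul {q : Euc d → ℝ} (hq : ContDiff ℝ ∞ q) (v : Euc d) :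
    DD v (fun x => rho x * q x) = fun x => rho x * DD v q x + (-2) * (⟪v, x⟫ * q x) := by
  funext x
  rw [DD_mul (sm_diff rho_contDiff x) (sm_diff hq x), DD_rho]; ring

lemma DD2_rho_mul {q : Euc d → ℝ} (hq : ContDiff ℝ ∞ q) (v w x : Euc d) :
    DD w (DD v (fun x => rho x * q x)) x = rho x * DD w (DD v q) x
      - 2 * (⟪w, x⟫ * DD v q x + ⟪v, x⟫ * DD w q x + ⟪v, w⟫ * q x) := by
  rw [DD_rho_mul hq]
  have h1 : ContDiff ℝ ∞ (fun x => rho x * DD v q x) := rho_contDiff.mul (DD_smooth hq v)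
  have h2 : ContDiff ℝ ∞ (fun x => ⟪v, x⟫ * q x) := (inner_sm v).mul hq
  rw [DD_add (sm_diff h1 x) (sm_diff (contDiff_const.mul h2) x), DD_const_mul (sm_diff h2 x),
    DD_mul (sm_diff rho_contDiff x) (sm_diff (DD_smooth hq v) x), DD_rho,
    DD_mul (sm_diff (inner_sm v) x) (sm_diff hq x), DD_inner]
  ring

lemma mt_sphere (ha : ∀ k, 0 ≤ a k) {q : Euc d → ℝ} (hq : ContDiff ℝ ∞ q) (x : Euc d)
    (hx : x ∈ sphere (0 : Euc d) 1) :
    0 ≤ ∑ m, ⟪e m, x⟫ * (a m * (Lop e a (fun x => rho x * q x) x * DD (e m) (fun x => rho x * q x) x)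
      - ∑ l, a m * (a l * (DD (e m) (DD (e l) (fun x => rho x * q x)) x *
          DD (e l) (fun x => rho x * q x) x))) := by
  have hr := rho_eq_zero hx
  set X : Fin d → ℝ := fun k => ⟪e k, x⟫ with hX
  set Q : Fin d → ℝ := fun k => DD (e k) q x with hQ
  have h1 : ∀ m, DD (e m) (fun x => rho x * q x) x = -2 * (X m * q x) := by
    intro m; rw [DD_rho_mul hq]; simp [hr, hX]
  have h2 : ∀ m l, DD (e m) (DD (e l) (fun x => rho x * q x)) x
      = -2 * (X m * Q l + X l * Q m + (if m = l then 1 else 0) * q x) := by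
    intro m l; rw [DD2_rho_mul hq, hr]
    have : ⟪e l, e m⟫ = if m = l then (1 : ℝ) else 0 := by
      rw [orthonormal_iff_ite.1 e.orthonormal]; simp [eq_comm]
    simp [this, hX, hQ]
  have h3 : Lop e a (fun x => rho x * q x) x = -4 * (∑ k, a k * (X k * Q k)) - 2 * (∑ k, a k) * q x := by
    unfold Lop
    simp only [h2, if_true]
    rw [Finset.mul_sum, Finset.mul_sum, Finset.sum_mul, ← Finset.sum_sub_distrib]
    exact Finset.sum_congr rfl fun k _ => by ring
  simp only [h1, h2, h3]
  set S := ∑ k, a k * X k ^ 2 with hS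
  set P := ∑ k, a k * (X k * Q k) with hP
  set Tr := ∑ k, a k with hTr
  have h4 : ∀ m, (∑ l, a m * (a l * (-2 * (X m * Q l + X l * Q m + (if m = l then 1 else 0) * q x) *
          (-2 * (X l * q x))))) = 4 * q x * (a m * X m * P + a m * Q m * S + a m ^ 2 * X m * q x) := by
    intro m
    have : ∀ l, a m * (a l * (-2 * (X m * Q l + X l * Q m + (if m = l then 1 else 0) * q x) *
          (-2 * (X l * q x)))) = 4 * q x * (a m * X m * (a l * (X l * Q l)) + a m * Q m * (a l * X l ^ 2)
           + (if m = l then a l ^ 2 * X l * q x else 0)) := by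
      intro l; split_ifs with h
      · subst h; ring
      · ring
    simp only [this]
    rw [← Finset.mul_sum, Finset.sum_add_distrib, Finset.sum_add_distrib, ← Finset.mul_sum,
      ← Finset.mul_sum, Finset.sum_ite_eq]
    simp [hS, hP]
  simp only [h4]
  have h5 : ∑ m, X m * (a m * ((-4 * P - 2 * Tr * q x) * (-2 * (X m * q x))) -
      4 * q x * (a m * X m * P + a m * Q m * S + a m ^ 2 * X m * q x))
      = 4 * q x ^ 2 * ∑ m, (Tr - a m) * (a m * X m ^ 2) := by
    have : ∀ m, X m * (a m * ((-4 * P - 2 * Tr * q x) * (-2 * (X m * q x))) -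
      4 * q x * (a m * X m * P + a m * Q m * S + a m ^ 2 * X m * q x))
       = 4 * q x * P * (a m * X m ^ 2) - 4 * q x * S * (a m * (X m * Q m)) +
         4 * q x ^ 2 * ((Tr - a m) * (a m * X m ^ 2)) := by intro m; ring
    simp only [this]
    rw [Finset.sum_add_distrib, Finset.sum_sub_distrib, ← Finset.mul_sum, ← Finset.mul_sum,
      ← Finset.mul_sum, ← hS, ← hP]
    ring
  rw [h5]
  refine mul_nonneg (by positivity) (Finset.sum_nonneg fun m _ => mul_nonneg ?_
    (mul_nonneg (ha m) (sq_nonneg _)))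
  have := Finset.single_le_sum (fun k _ => ha k) (Finset.mem_univ m)
  linarith

/-- Miranda–Talenti -/
lemma mir_tal (ha : ∀ k, 0 ≤ a k) {q : Euc d → ℝ} (hq : ContDiff ℝ ∞ q) :
    ∫ x in ball (0 : Euc d) 1, ∑ m, ∑ l, a m * a l * (DD (e m) (DD (e l) (fun x => rho x * q x)) x) ^ 2
      ≤ ∫ x in ball (0 : Euc d) 1, (Lop e a (fun x => rho x * q x) x) ^ 2 := by
  set u : Euc d → ℝ := fun x => rho x * q x with hu
  have su : ContDiff ℝ ∞ u := rho_contDiff.mul hq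
  have sD : ∀ k, ContDiff ℝ ∞ (DD (e k) u) := fun k => DD_smooth su _
  have sDD : ∀ m k, ContDiff ℝ ∞ (DD (e m) (DD (e k) u)) := fun m k => DD_smooth (sD k) _
  have sL : ContDiff ℝ ∞ (Lop e a u) := Lop_smooth e a su
  let F : Fin d → Euc d → ℝ := fun m x => a m * (Lop e a u x * DD (e m) u x)
      - ∑ l, a m * (a l * (DD (e m) (DD (e l) u) x * DD (e l) u x))
  have sF : ∀ m, ContDiff ℝ ∞ (F m) := fun m =>
    (contDiff_const.mul (sL.mul (sD m))).sub (ContDiff.sum fun l _ =>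
      contDiff_const.mul (contDiff_const.mul ((sDD m l).mul (sD l))))
  have h := div_nonneg_aux e (fun k => sm_one (sF k)) (fun x hx => mt_sphere e a ha hq x hx)
  have hdiv : ∀ x, ∑ m, DD (e m) (F m) x = (Lop e a u x) ^ 2
      - ∑ m, ∑ l, a m * a l * (DD (e m) (DD (e l) u) x) ^ 2 := by
    intro x
    have e1 : ∀ m, DD (e m) (F m) x = a m * (Lop e a u x * DD (e m) (DD (e m) u) x
        + DD (e m) (Lop e a u) x * DD (e m) u x)
        - ∑ l, a m * (a l * (DD (e m) (DD (e l) u) x * DD (e m) (DD (e l) u) x +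
          DD (e m) (DD (e m) (DD (e l) u)) x * DD (e l) u x)) := by
      intro m
      have s1 := sL.mul (sD m)
      have s2 : ∀ l, ContDiff ℝ ∞ (fun x => DD (e m) (DD (e l) u) x * DD (e l) u x) :=
        fun l => (sDD m l).mul (sD l)
      have s3 : ∀ l, ContDiff ℝ ∞ (fun x => a l * (DD (e m) (DD (e l) u) x * DD (e l) u x)) :=
        fun l => contDiff_const.mul (s2 l)
      have s4 : ∀ l, ContDiff ℝ ∞ (fun x => a m * (a l * (DD (e m) (DD (e l) u) x * DD (e l) u x))) :=
        fun l => contDiff_const.mul (s3 l)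
      simp only [F]
      rw [DD_sub (sm_diff (contDiff_const.mul s1) x) (sm_diff (ContDiff.sum fun l _ => s4 l) x),
        DD_const_mul (sm_diff s1 x), DD_mul (sm_diff sL x) (sm_diff (sD m) x),
        DD_sum _ (fun l _ => sm_diff (s4 l) x)]
      congr 1
      refine Finset.sum_congr rfl fun l _ => ?_
      rw [DD_const_mul (sm_diff (s3 l) x), DD_const_mul (sm_diff (s2 l) x),
        DD_mul (sm_diff (sDD m l) x) (sm_diff (sD l) x)]
    have e2 : ∀ l, DD (e l) (Lop e a u) x = ∑ m, a m * DD (e m) (DD (e m) (DD (e l) u)) x := by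
      intro l
      unfold Lop
      rw [DD_sum _ (fun m _ => sm_diff (contDiff_const.mul (sDD m m)) x)]
      refine Finset.sum_congr rfl fun m _ => ?_
      rw [DD_const_mul (sm_diff (sDD m m) x), DD_comm (sm_two (sD m))]
      have : DD (e l) (DD (e m) u) = DD (e m) (DD (e l) u) := by
        funext y; exact DD_comm (sm_two su) _ _ _
      rw [this]
    simp only [e1]
    have e3 : ∑ m, ∑ l, a m * (a l * (DD (e m) (DD (e l) u) x * DD (e m) (DD (e l) u) x +
          DD (e m) (DD (e m) (DD (e l) u)) x * DD (e l) u x))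
        = ∑ m, ∑ l, a m * a l * (DD (e m) (DD (e l) u) x) ^ 2
          + ∑ l, a l * (DD (e l) (Lop e a u) x * DD (e l) u x) := by
      have : ∀ l, a l * (DD (e l) (Lop e a u) x * DD (e l) u x) = ∑ m, a m *
          (a l * (DD (e m) (DD (e m) (DD (e l) u)) x * DD (e l) u x)) := by
        intro l; rw [e2, Finset.sum_mul, Finset.mul_sum]
        exact Finset.sum_congr rfl fun m _ => by ring
      simp only [this]
      rw [Finset.sum_comm (f := fun l m => a m *
          (a l * (DD (e m) (DD (e m) (DD (e l) u)) x * DD (e l) u x))), ← Finset.sum_add_distrib]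
      refine Finset.sum_congr rfl fun m _ => ?_
      rw [← Finset.sum_add_distrib]
      exact Finset.sum_congr rfl fun l _ => by ring
    rw [Finset.sum_sub_distrib, e3]
    have e4 : ∑ m, a m * (Lop e a u x * DD (e m) (DD (e m) u) x + DD (e m) (Lop e a u) x * DD (e m) u x)
        = Lop e a u x ^ 2 + ∑ l, a l * (DD (e l) (Lop e a u) x * DD (e l) u x) := by
      have : Lop e a u x ^ 2 = ∑ m, a m * (Lop e a u x * DD (e m) (DD (e m) u) x) := by
        rw [sq]; conv_lhs => rw [show Lop e a u x = ∑ k, a k * DD (e k) (DD (e k) u) x from rfl]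
        rw [Finset.mul_sum]
        refine Finset.sum_congr rfl fun m _ => ?_
        rw [show Lop e a u x = ∑ k, a k * DD (e k) (DD (e k) u) x from rfl]; ring
      rw [this, ← Finset.sum_add_distrib]
      exact Finset.sum_congr rfl fun l _ => by ring
    rw [e4]; ring
  simp only [hdiv] at h
  have c1 : Continuous fun x => (Lop e a u x) ^ 2 := sL.continuous.pow 2
  have c2 : Continuous fun x => ∑ m, ∑ l, a m * a l * (DD (e m) (DD (e l) u) x) ^ 2 :=
    continuous_finsetSum _ fun m _ => continuous_finsetSum _ fun l _ =>
      continuous_const.mul ((sDD m l).continuous.pow 2)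
  rw [integral_sub (ball_int c1) (ball_int c2)] at h
  linarith

lemma mt_comp {lam : ℝ} (hlam : 0 < lam) (ha : ∀ k, lam ≤ a k) {q : Euc d → ℝ} (hq : ContDiff ℝ ∞ q)
    (j k : Fin d) :
    ∫ x in ball (0 : Euc d) 1, (DD (e j) (DD (e k) (fun x => rho x * q x)) x) ^ 2
      ≤ (lam⁻¹) ^ 2 * ∫ x in ball (0 : Euc d) 1, (Lop e a (fun x => rho x * q x) x) ^ 2 := by
  have ha0 : ∀ k, 0 ≤ a k := fun k => hlam.le.trans (ha k)
  have h := mir_tal e a ha0 hq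
  set u : Euc d → ℝ := fun x => rho x * q x with hu
  have su : ContDiff ℝ ∞ u := rho_contDiff.mul hq
  have sDD : ∀ m k, ContDiff ℝ ∞ (DD (e m) (DD (e k) u)) := fun m k => DD_smooth (DD_smooth su _) _
  have c2 : Continuous fun x => ∑ m, ∑ l, a m * a l * (DD (e m) (DD (e l) u) x) ^ 2 :=
    continuous_finsetSum _ fun m _ => continuous_finsetSum _ fun l _ =>
      continuous_const.mul ((sDD m l).continuous.pow 2)
  have h2 : lam ^ 2 * ∫ x in ball (0 : Euc d) 1, (DD (e j) (DD (e k) u) x) ^ 2 ≤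
      ∫ x in ball (0 : Euc d) 1, ∑ m, ∑ l, a m * a l * (DD (e m) (DD (e l) u) x) ^ 2 := by
    rw [← integral_const_mul]
    refine setIntegral_mono_on (ball_int (continuous_const.mul ((sDD j k).continuous.pow 2)))
      (ball_int c2) measurableSet_ball fun x _ => ?_
    have nn : ∀ m l, 0 ≤ a m * a l * (DD (e m) (DD (e l) u) x) ^ 2 := fun m l =>
      mul_nonneg (mul_nonneg (ha0 m) (ha0 l)) (sq_nonneg _)
    calc lam ^ 2 * (DD (e j) (DD (e k) u) x) ^ 2 ≤ a j * a k * (DD (e j) (DD (e k) u) x) ^ 2 := by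
          gcongr
          rw [sq]; exact mul_le_mul (ha j) (ha k) hlam.le (ha0 j)
      _ ≤ ∑ l, a j * a l * (DD (e j) (DD (e l) u) x) ^ 2 :=
          Finset.single_le_sum (f := fun l => a j * a l * (DD (e j) (DD (e l) u) x) ^ 2)
            (fun l _ => nn j l) (Finset.mem_univ k)
      _ ≤ _ := Finset.single_le_sum (f := fun m => ∑ l, a m * a l * (DD (e m) (DD (e l) u) x) ^ 2)
            (fun m _ => Finset.sum_nonneg fun l _ => nn m l) (Finset.mem_univ j)
  have h3 := h2.trans h
  rw [inv_pow, ← div_eq_inv_mul, le_div_iff₀ (by positivity)]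
  linarith

end mt


section maxp
variable {d : ℕ}

lemma snd_le_zero {v : Euc d → ℝ} (hv : ContDiff ℝ ∞ v) {x : Euc d} (hx : IsLocalMax v x) (w : Euc d) :
    DD w (DD w v) x ≤ 0 := by
  by_contra hcon
  push Not at hcon
  have hg : ∀ (u : Euc d → ℝ), ContDiff ℝ ∞ u → ∀ t : ℝ,
      HasDerivAt (fun t : ℝ => u (x + t • w)) (DD w u (x + t • w)) t := by
    intro u hu t
    have h1 : HasDerivAt (fun t : ℝ => x + t • w) w t := by
      simpa using ((hasDerivAt_id t).smul_const w).const_add x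
    exact (sm_diff hu (x + t • w)).hasFDerivAt.comp_hasDerivAt t h1
  have d1 : deriv (fun t : ℝ => v (x + t • w)) = fun t => DD w v (x + t • w) :=
    funext fun t => (hg v hv t).deriv
  have d2 : deriv (deriv (fun t : ℝ => v (x + t • w))) 0 = DD w (DD w v) x := by
    rw [d1, (hg _ (DD_smooth hv w) 0).deriv]; simp
  have hcont : ContinuousAt (fun t : ℝ => v (x + t • w)) 0 := (hg v hv 0).continuousAt
  have hlm : IsLocalMax (fun t : ℝ => v (x + t • w)) 0 := by
    have hc : Tendsto (fun t : ℝ => x + t • w) (𝓝 0) (𝓝 x) := by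
      have : Continuous (fun t : ℝ => x + t • w) := by fun_prop
      simpa using this.tendsto 0
    have := hc.eventually hx
    simpa [IsLocalMax, IsMaxFilter] using this
  have hmin := isLocalMin_of_deriv_deriv_pos (by rw [d2]; exact hcon) hlm.deriv_eq_zero hcont
  have heq : (fun t : ℝ => v (x + t • w)) =ᶠ[𝓝 0] fun _ => v (x + (0 : ℝ) • w) := by
    filter_upwards [hlm, hmin] with t h1 h2
    exact le_antisymm h1 h2
  have : deriv (deriv (fun t : ℝ => v (x + t • w))) 0 = 0 := by
    rw [heq.deriv.deriv_eq]; simp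
  rw [d2] at this
  linarith

variable (e : OrthonormalBasis (Fin d) ℝ (Euc d)) (a : Fin d → ℝ)

lemma max_principle (ha : ∀ k, 0 ≤ a k) {v : Euc d → ℝ} (hv : ContDiff ℝ ∞ v) (y : Euc d) (R : ℝ)
    (hL : ∀ x ∈ ball (0 : Euc d) 1 ∩ ball y R, 0 < Lop e a v x)
    (hb : ∀ x ∈ closedBall (0 : Euc d) 1 ∩ closedBall y R, (‖x‖ = 1 ∨ dist x y = R) → v x ≤ 0)
    (x : Euc d) (hx : x ∈ closedBall (0 : Euc d) 1 ∩ closedBall y R) : v x ≤ 0 := by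
  have hK : IsCompact (closedBall (0 : Euc d) 1 ∩ closedBall y R) :=
    (isCompact_closedBall _ _).inter_right isClosed_closedBall
  obtain ⟨z, hz, hmax⟩ := hK.exists_isMaxOn ⟨x, hx⟩ hv.continuous.continuousOn
  refine (hmax hx).trans ?_
  by_contra hcon
  have hz1 : z ∈ ball (0 : Euc d) 1 ∩ ball y R := by
    constructor
    · rcases (mem_closedBall_zero_iff.1 hz.1).lt_or_eq with h | h
      · simpa using h
      · exact absurd (hb z hz (Or.inl h)) hcon
    · rcases (mem_closedBall.1 hz.2).lt_or_eq with h | h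
      · simpa using h
      · exact absurd (hb z hz (Or.inr h)) hcon
  have hloc : IsLocalMax v z := by
    filter_upwards [(isOpen_ball.inter isOpen_ball).mem_nhds hz1] with w hw
    exact hmax ⟨ball_subset_closedBall hw.1, ball_subset_closedBall hw.2⟩
  have h1 := hL z hz1
  have h2 : Lop e a v z ≤ 0 := Finset.sum_nonpos fun k _ =>
    mul_nonpos_of_nonneg_of_nonpos (ha k) (snd_le_zero hv hloc _)
  linarith

lemma Lop_sub {u w : Euc d → ℝ} (hu : ContDiff ℝ ∞ u) (hw : ContDiff ℝ ∞ w) (x : Euc d) :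
    Lop e a (fun x => u x - w x) x = Lop e a u x - Lop e a w x := by
  unfold Lop
  rw [← Finset.sum_sub_distrib]
  refine Finset.sum_congr rfl fun k _ => ?_
  have : DD (e k) (fun x => u x - w x) = fun x => DD (e k) u x - DD (e k) w x :=
    funext fun y => DD_sub (sm_diff hu y) (sm_diff hw y) _
  rw [this, DD_sub (sm_diff (DD_smooth hu _) x) (sm_diff (DD_smooth hw _) x)]
  ring

lemma Lop_add {u w : Euc d → ℝ} (hu : ContDiff ℝ ∞ u) (hw : ContDiff ℝ ∞ w) (x : Euc d) :
    Lop e a (fun x => u x + w x) x = Lop e a u x + Lop e a w x := by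
  unfold Lop
  rw [← Finset.sum_add_distrib]
  refine Finset.sum_congr rfl fun k _ => ?_
  have : DD (e k) (fun x => u x + w x) = fun x => DD (e k) u x + DD (e k) w x :=
    funext fun y => DD_add (sm_diff hu y) (sm_diff hw y) _
  rw [this, DD_add (sm_diff (DD_smooth hu _) x) (sm_diff (DD_smooth hw _) x)]
  ring

lemma Lop_const_mul {u : Euc d → ℝ} (hu : ContDiff ℝ ∞ u) (c : ℝ) (x : Euc d) :
    Lop e a (fun x => c * u x) x = c * Lop e a u x := by
  unfold Lop
  rw [Finset.mul_sum]
  refine Finset.sum_congr rfl fun k _ => ?_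
  have : DD (e k) (fun x => c * u x) = fun x => c * DD (e k) u x :=
    funext fun y => DD_const_mul (sm_diff hu y) _ _
  rw [this, DD_const_mul (sm_diff (DD_smooth hu _) x)]
  ring

lemma DD_const (c : ℝ) (v x : Euc d) : DD v (fun _ : Euc d => c) x = 0 := by
  unfold DD; simp

lemma Lop_rho (x : Euc d) : Lop e a rho x = -2 * ∑ k, a k := by
  unfold Lop
  rw [Finset.mul_sum]
  refine Finset.sum_congr rfl fun k _ => ?_
  have : DD (e k) rho = fun x => -2 * ⟪e k, x⟫ := funext fun y => DD_rho _ y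
  rw [this, DD_const_mul (sm_diff (inner_sm _) x), DD_inner]
  simp [mul_comm]

lemma Lop_inner (w x : Euc d) : Lop e a (fun x => ⟪w, x⟫) x = 0 := by
  unfold Lop
  refine Finset.sum_eq_zero fun k _ => ?_
  have : DD (e k) (fun x => ⟪w, x⟫) = fun _ => ⟪w, e k⟫ := funext fun y => DD_inner _ _ y
  rw [this, DD_const, mul_zero]

lemma Lop_mul {u w : Euc d → ℝ} (hu : ContDiff ℝ ∞ u) (hw : ContDiff ℝ ∞ w) (x : Euc d) :
    Lop e a (fun x => u x * w x) x = u x * Lop e a w x + Lop e a u x * w x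
      + 2 * ∑ k, a k * (DD (e k) u x * DD (e k) w x) := by
  unfold Lop
  rw [Finset.mul_sum, Finset.mul_sum, Finset.sum_mul, ← Finset.sum_add_distrib,
    ← Finset.sum_add_distrib]
  refine Finset.sum_congr rfl fun k _ => ?_
  have : DD (e k) (fun x => u x * w x) = fun x => u x * DD (e k) w x + DD (e k) u x * w x :=
    funext fun y => DD_mul (sm_diff hu y) (sm_diff hw y) _
  rw [this, DD_add (sm_diff (hu.mul (DD_smooth hw _)) x) (sm_diff ((DD_smooth hu _).mul hw) x),
    DD_mul (sm_diff hu x) (sm_diff (DD_smooth hw _) x),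
    DD_mul (sm_diff (DD_smooth hu _) x) (sm_diff hw x)]
  ring

lemma sup_bound (hd : 0 < d) {lam : ℝ} (hlam : 0 < lam) (ha : ∀ k, lam ≤ a k)
    {v : Euc d → ℝ} (hv : ContDiff ℝ ∞ v)
    (h0 : ∀ x ∈ sphere (0 : Euc d) 1, v x = 0) {ε : ℝ} (hε : 0 < ε)
    (hL : ∀ x ∈ ball (0 : Euc d) 1, |Lop e a v x| ≤ ε) (x : Euc d) (hx : x ∈ closedBall (0 : Euc d) 1) :
    |v x| ≤ ε / lam := by
  have ha0 : ∀ k, 0 ≤ a k := fun k => hlam.le.trans (ha k)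
  have htr : lam ≤ ∑ k, a k :=
    (ha ⟨0, hd⟩).trans (Finset.single_le_sum (fun k _ => ha0 k) (Finset.mem_univ _))
  have key : ∀ w : Euc d → ℝ, ContDiff ℝ ∞ w → (∀ x ∈ sphere (0 : Euc d) 1, w x = 0) →
      (∀ x ∈ ball (0 : Euc d) 1, -ε ≤ Lop e a w x) → w x ≤ ε / lam := by
    intro w hw hw0 hwL
    have hs : ContDiff ℝ ∞ (fun x : Euc d => ε / lam * rho x) := contDiff_const.mul rho_contDiff
    have h := max_principle e a ha0 (hw.sub hs) (0 : Euc d) 1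
      (by
        intro z hz
        rw [Lop_sub e a hw hs, Lop_const_mul e a rho_contDiff, Lop_rho]
        have := hwL z hz.1
        have : ε ≤ ε / lam * ∑ k, a k := by
          rw [div_mul_eq_mul_div, le_div_iff₀ hlam]; gcongr
        linarith)
      (by
        intro z hz hz'
        have : z ∈ sphere (0 : Euc d) 1 := by simpa using hz'
        simp [hw0 z this, rho_eq_zero this])
      x ⟨hx, hx⟩
    have h3 : ε / lam * rho x ≤ ε / lam * 1 := by
      gcongr; exact rho_le_one x
    simp at h
    linarith
  rw [abs_le]
  constructor
  · have := key (fun x => (-1) * v x) (contDiff_const.mul hv) (fun x hx => by simp [h0 x hx])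
      (fun x hx => by rw [Lop_const_mul e a hv]; linarith [(abs_le.1 (hL x hx)).2])
    linarith
  · exact key v hv h0 (fun x hx => (abs_le.1 (hL x hx)).1)

lemma sum_inner_sq (x : Euc d) : ∑ k, ⟪e k, x⟫ ^ 2 = ‖x‖ ^ 2 := by
  have := e.sum_sq_norm_inner_right x
  simpa [Real.norm_eq_abs, sq_abs] using this

lemma barrier {lam Lam : ℝ} (hlam : 0 < lam) (ha : ∀ k, lam ≤ a k) (hA : ∀ k, a k ≤ Lam)
    {v : Euc d → ℝ} (hv : ContDiff ℝ ∞ v)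
    (h0 : ∀ x ∈ sphere (0 : Euc d) 1, v x = 0) {ε M R : ℝ} (hε : 0 < ε) (hR : 0 < R)
    (y : Euc d) (hy : y ∈ sphere (0 : Euc d) 1)
    (hL : ∀ x ∈ ball (0 : Euc d) 1 ∩ ball y R, |Lop e a v x| ≤ ε)
    (hM0 : 0 ≤ M)
    (hM : ∀ x ∈ closedBall (0 : Euc d) 1 ∩ closedBall y R, |v x| ≤ M)
    (x : Euc d) (hx : x ∈ closedBall (0 : Euc d) 1 ∩ closedBall y R) :
    |v x| ≤ (1 + 2 * ((d * Lam + 1) / lam)) * (M + ε * R ^ 2) * (dist x y / R) := by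
  have ha0 : ∀ k, 0 ≤ a k := fun k => hlam.le.trans (ha k)
  have hy1 : ‖y‖ = 1 := by simpa using hy
  set κ := (d * Lam + 1) / lam with hκ
  have htr : ∑ k, a k ≤ d * Lam := by
    have := Finset.sum_le_sum (fun k (_ : k ∈ Finset.univ) => hA k)
    simpa using this
  have htr0 : 0 ≤ ∑ k, a k := Finset.sum_nonneg fun k _ => ha0 k
  have hκ0 : 0 ≤ κ := by rw [hκ]; apply div_nonneg _ hlam.le; linarith
  set M' := M + ε * R ^ 2 with hM'
  have hM'0 : 0 < M' := by positivity
  let ℓ : Euc d → ℝ := fun x => 1 - ⟪y, x⟫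
  have sℓ : ContDiff ℝ ∞ ℓ := contDiff_const.sub (inner_sm y)
  have hDℓ : ∀ k z, DD (e k) ℓ z = -⟪y, e k⟫ := by
    intro k z
    simp only [ℓ]
    rw [DD_sub (differentiableAt_const _) (sm_diff (inner_sm y) z), DD_const, DD_inner]; simp
  have Lℓ : ∀ z, Lop e a ℓ z = 0 := by
    intro z
    simp only [ℓ]
    rw [Lop_sub e a contDiff_const (inner_sm y), Lop_inner]
    simp [Lop]
    refine Finset.sum_eq_zero fun k _ => ?_
    have : DD (e k) (fun _ : Euc d => (1 : ℝ)) = fun _ => 0 := funext fun z => DD_const _ _ _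
    rw [this, DD_const]; simp
  -- squared distance equals `2 ℓ - ρ`
  let s : Euc d → ℝ := fun x => 2 * ℓ x - rho x
  have ss : ContDiff ℝ ∞ s := (contDiff_const.mul sℓ).sub rho_contDiff
  have hs : ∀ z, s z = dist z y ^ 2 := by
    intro z
    simp only [s, ℓ, rho]
    rw [dist_eq_norm, norm_sub_sq_real, hy1, real_inner_comm]; ring
  have Ls : ∀ z, Lop e a s z = 2 * ∑ k, a k := by
    intro z
    simp only [s]
    rw [Lop_sub e a (contDiff_const.mul sℓ) rho_contDiff, Lop_const_mul e a sℓ, Lℓ, Lop_rho]; ring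
  let φ : Euc d → ℝ := fun x => (M' / R ^ 2) * (s x + κ * (2 * R * ℓ x - ℓ x * ℓ x))
  have sφ1 : ContDiff ℝ ∞ (fun x => 2 * R * ℓ x - ℓ x * ℓ x) :=
    (contDiff_const.mul sℓ).sub (sℓ.mul sℓ)
  have sφ2 : ContDiff ℝ ∞ (fun x => s x + κ * (2 * R * ℓ x - ℓ x * ℓ x)) :=
    ss.add (contDiff_const.mul sφ1)
  have sφ : ContDiff ℝ ∞ φ := contDiff_const.mul sφ2
  have Lφ : ∀ z, Lop e a φ z ≤ -(2 * ε) := by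
    intro z
    have h1 : Lop e a φ z = (M' / R ^ 2) * (2 * ∑ k, a k - κ * (2 * ∑ k, a k * ⟪y, e k⟫ ^ 2)) := by
      simp only [φ]
      rw [Lop_const_mul e a sφ2, Lop_add e a ss (contDiff_const.mul sφ1), Lop_const_mul e a sφ1,
        Lop_sub e a (contDiff_const.mul sℓ) (sℓ.mul sℓ), Lop_const_mul e a sℓ, Lop_mul e a sℓ sℓ,
        Lℓ, Ls]
      simp only [hDℓ]
      simp [sq]
      left; ring
    have h2 : lam ≤ ∑ k, a k * ⟪y, e k⟫ ^ 2 := by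
      have h3 := sum_inner_sq e y
      rw [hy1] at h3
      calc lam = lam * ∑ k, ⟪e k, y⟫ ^ 2 := by rw [h3]; ring
        _ ≤ _ := by
          rw [Finset.mul_sum]
          refine Finset.sum_le_sum fun k _ => ?_
          rw [real_inner_comm]; gcongr; exact ha k
    have h3 : κ * lam ≤ κ * ∑ k, a k * ⟪y, e k⟫ ^ 2 := by gcongr
    have h4 : κ * lam = d * Lam + 1 := by rw [hκ]; field_simp
    rw [h1]
    have h5 : ε ≤ M' / R ^ 2 := by rw [le_div_iff₀ (by positivity)]; linarith
    nlinarith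
  have hℓ0 : ∀ z ∈ closedBall (0 : Euc d) 1, 0 ≤ ℓ z := by
    intro z hz
    have h1 := real_inner_le_norm y z
    have h2 : ‖z‖ ≤ 1 := by simpa using hz
    rw [hy1] at h1; simp only [ℓ]; linarith
  have hℓ1 : ∀ z, ℓ z ≤ dist z y := by
    intro z
    have h1 := real_inner_le_norm y (y - z)
    rw [inner_sub_right, real_inner_self_eq_norm_sq, hy1] at h1
    rw [dist_comm, dist_eq_norm]
    simp only [ℓ]; linarith
  have key : ∀ w : Euc d → ℝ, ContDiff ℝ ∞ w → (∀ x ∈ sphere (0 : Euc d) 1, w x = 0) →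
      (∀ x ∈ ball (0 : Euc d) 1 ∩ ball y R, -ε ≤ Lop e a w x) →
      (∀ x ∈ closedBall (0 : Euc d) 1 ∩ closedBall y R, w x ≤ M) → w x ≤ φ x := by
    intro w hw hw0 hwL hwM
    have h := max_principle e a ha0 (hw.sub sφ) y R
      (by
        intro z hz
        rw [Lop_sub e a hw sφ]
        have := hwL z hz
        have := Lφ z
        linarith)
      (by
        intro z hz hz'
        have l0 := hℓ0 z hz.1
        have l1 : ℓ z ≤ R := (hℓ1 z).trans hz.2
        have q0 : 0 ≤ κ * (2 * R * ℓ z - ℓ z * ℓ z) := mul_nonneg hκ0 (by nlinarith)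
        have s0 : 0 ≤ s z := by rw [hs]; positivity
        have mr : 0 < M' / R ^ 2 := by positivity
        rcases hz' with hz' | hz'
        · have : z ∈ sphere (0 : Euc d) 1 := by simpa using hz'
          have : 0 ≤ φ z := by simp only [φ]; positivity
          simp only [hw0 z ‹_›]; linarith
        · have h1 := hwM z hz
          have h2 : M' ≤ φ z := by
            simp only [φ]
            have : s z = R ^ 2 := by rw [hs, hz']
            rw [this]
            calc M' = M' / R ^ 2 * (R ^ 2) := by field_simp
              _ ≤ _ := by gcongr; linarith
          have : M ≤ M' := by rw [hM']; have : 0 ≤ ε * R ^ 2 := by positivity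
                              linarith
          linarith)
      x hx
    have h' : w x - φ x ≤ 0 := h
    linarith
  have hφ : φ x ≤ (1 + 2 * κ) * M' * (dist x y / R) := by
    have l0 := hℓ0 x hx.1
    have l1 := hℓ1 x
    have d1 : dist x y ≤ R := hx.2
    have d0 : 0 ≤ dist x y := dist_nonneg
    have h1 : s x + κ * (2 * R * ℓ x - ℓ x * ℓ x) ≤ (1 + 2 * κ) * (R * dist x y) := by
      rw [hs]
      have : κ * (2 * R * ℓ x - ℓ x * ℓ x) ≤ κ * (2 * R * dist x y) := by
        gcongr; nlinarith
      nlinarith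
    calc φ x ≤ M' / R ^ 2 * ((1 + 2 * κ) * (R * dist x y)) := by simp only [φ]; gcongr
      _ = _ := by field_simp
  refine le_trans ?_ hφ
  rw [abs_le]
  constructor
  · have := key (fun x => (-1) * v x) (contDiff_const.mul hv) (fun x hx => by simp [h0 x hx])
      (fun x hx => by rw [Lop_const_mul e a hv]; linarith [(abs_le.1 (hL x hx)).2])
      (fun x hx => by linarith [(abs_le.1 (hM x hx)).1])
    linarith
  · exact key v hv h0 (fun x hx => (abs_le.1 (hL x hx)).1) (fun x hx => (abs_le.1 (hM x hx)).2)

end maxp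


section polys
variable {d : ℕ} (e : OrthonormalBasis (Fin d) ℝ (Euc d)) (a : Fin d → ℝ)

/-- polynomial functions in the coordinates of the basis `e`. -/
noncomputable def pf (p : MvPolynomial (Fin d) ℝ) : Euc d → ℝ :=
  fun x => MvPolynomial.eval (fun k => ⟪e k, x⟫) p

lemma pf_smooth (p : MvPolynomial (Fin d) ℝ) : ContDiff ℝ ∞ (pf e p) := by
  induction p using MvPolynomial.induction_on with
  | C c =>
    have : pf e (MvPolynomial.C c) = fun _ => c := by funext x; simp [pf]
    rw [this]; exact contDiff_const
  | add p q hp hq =>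
    have : pf e (p + q) = fun x => pf e p x + pf e q x := by funext x; simp [pf]
    rw [this]; exact hp.add hq
  | mul_X p k hp =>
    have : pf e (p * MvPolynomial.X k) = fun x => pf e p x * ⟪e k, x⟫ := by funext x; simp [pf]
    rw [this]; exact hp.mul (inner_sm _)

lemma DD_pf (p : MvPolynomial (Fin d) ℝ) (k : Fin d) :
    DD (e k) (pf e p) = pf e (MvPolynomial.pderiv k p) := by
  classical
  induction p using MvPolynomial.induction_on with
  | C c =>
    have : pf e (MvPolynomial.C c) = fun _ => c := by funext x; simp [pf]
    rw [this]; funext x; simp [DD, pf]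
  | add p q hp hq =>
    have : pf e (p + q) = fun x => pf e p x + pf e q x := by funext x; simp [pf]
    rw [this]; funext x
    rw [DD_add (sm_diff (pf_smooth e p) x) (sm_diff (pf_smooth e q) x), hp, hq]
    simp [pf]
  | mul_X p j hp =>
    have : pf e (p * MvPolynomial.X j) = fun x => pf e p x * ⟪e j, x⟫ := by funext x; simp [pf]
    rw [this]; funext x
    rw [DD_mul (sm_diff (pf_smooth e p) x) (sm_diff (inner_sm _) x), hp, DD_inner]
    have : (⟪e j, e k⟫ : ℝ) = if j = k then 1 else 0 := by
      simpa using orthonormal_iff_ite.1 e.orthonormal j k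
    rw [this]
    simp only [pf, Derivation.leibniz, MvPolynomial.pderiv_X, smul_eq_mul, map_add, map_mul,
      MvPolynomial.eval_X]
    by_cases h : j = k
    · subst h; simp; ring
    · simp [h, Pi.single_apply, Ne.symm h]; ring

lemma pderiv_deg {n : ℕ} {p : MvPolynomial (Fin d) ℝ} (k : Fin d)
    (hp : p ∈ MvPolynomial.restrictTotalDegree (Fin d) ℝ (n + 1)) :
    MvPolynomial.pderiv k p ∈ MvPolynomial.restrictTotalDegree (Fin d) ℝ n := by
  rw [MvPolynomial.mem_restrictTotalDegree] at hp
  rw [p.as_sum, map_sum]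
  refine Submodule.sum_mem _ fun s hs => ?_
  rw [MvPolynomial.pderiv_monomial, MvPolynomial.mem_restrictTotalDegree]
  by_cases h0 : s k = 0
  · simp [h0]
  refine (MvPolynomial.totalDegree_monomial_le _ _).trans ?_
  have h1 := MvPolynomial.le_totalDegree hs
  have h2 : s = (s - Finsupp.single k 1) + Finsupp.single k 1 := by
    ext j; by_cases hj : j = k
    · subst hj; simp; omega
    · simp [Finsupp.single_apply, Ne.symm hj]
  have h3 : (s.sum fun _ e => e) = ((s - Finsupp.single k 1).sum fun _ e => e) + 1 := by
    conv_lhs => rw [h2]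
    rw [Finsupp.sum_add_index'] <;> simp
  show ((s - Finsupp.single k 1).sum fun _ e => e) ≤ n
  omega

/-- polynomial version of `rho`. -/
noncomputable def rhoP (d : ℕ) : MvPolynomial (Fin d) ℝ := 1 - ∑ k, MvPolynomial.X k ^ 2

lemma pf_rhoP (x : Euc d) : pf e (rhoP d) x = rho x := by
  simp [pf, rhoP, rho, sum_inner_sq]

lemma pf_rhoP_mul (q : MvPolynomial (Fin d) ℝ) :
    pf e (rhoP d * q) = fun x => rho x * pf e q x := by
  funext x
  rw [← pf_rhoP e x]; simp [pf]

/-- the operator on polynomials. -/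
noncomputable def PhiL : MvPolynomial (Fin d) ℝ →ₗ[ℝ] MvPolynomial (Fin d) ℝ :=
  (∑ k, a k • ((MvPolynomial.pderiv k).toLinearMap ∘ₗ (MvPolynomial.pderiv k).toLinearMap)) ∘ₗ
    LinearMap.mulLeft ℝ (rhoP d)

lemma PhiL_apply (q : MvPolynomial (Fin d) ℝ) :
    PhiL a q = ∑ k, a k • MvPolynomial.pderiv k (MvPolynomial.pderiv k (rhoP d * q)) := by
  simp [PhiL, LinearMap.sum_apply]

lemma Lop_pf (q : MvPolynomial (Fin d) ℝ) :
    Lop e a (fun x => rho x * pf e q x) = pf e (PhiL a q) := by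
  rw [← pf_rhoP_mul, PhiL_apply]
  funext x
  simp only [Lop, DD_pf]
  simp only [pf, map_sum, MvPolynomial.smul_eval]

lemma PhiL_deg {n : ℕ} {q : MvPolynomial (Fin d) ℝ}
    (hq : q ∈ MvPolynomial.restrictTotalDegree (Fin d) ℝ n) :
    PhiL a q ∈ MvPolynomial.restrictTotalDegree (Fin d) ℝ n := by
  rw [PhiL_apply]
  refine Submodule.sum_mem _ fun k _ => Submodule.smul_mem _ _ ?_
  apply pderiv_deg; apply pderiv_deg
  rw [MvPolynomial.mem_restrictTotalDegree] at hq ⊢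
  refine (MvPolynomial.totalDegree_mul _ _).trans ?_
  have : (rhoP d).totalDegree ≤ 2 := by
    rw [rhoP]
    refine (MvPolynomial.totalDegree_sub _ _).trans ?_
    simp only [MvPolynomial.totalDegree_one, zero_le, sup_of_le_right]
    refine (MvPolynomial.totalDegree_finsetSum_le fun k _ => ?_)
    simp [MvPolynomial.totalDegree_X_pow]
  omega

lemma pf_eq_zero (hd : 0 < d) {q : MvPolynomial (Fin d) ℝ}
    (h : ∀ x ∈ ball (0 : Euc d) 1, pf e q x = 0) : q = 0 := by
  have hd' : (0 : ℝ) < d := by exact_mod_cast hd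
  refine MvPolynomial.funext_set (fun _ => Set.Ioo (0 : ℝ) (1 / (d + 1)))
    (fun _ => Set.Ioo_infinite (by positivity)) fun c hc => ?_
  have hx : (∑ k, c k • e k) ∈ ball (0 : Euc d) 1 := by
    rw [mem_ball_zero_iff]
    calc ‖∑ k, c k • e k‖ ≤ ∑ k, ‖c k • e k‖ := norm_sum_le _ _
      _ ≤ ∑ k : Fin d, (1 / ((d : ℝ) + 1)) := by
        refine Finset.sum_le_sum fun k _ => ?_
        have := hc k (Set.mem_univ _)
        rw [norm_smul, e.norm_eq_one, mul_one, Real.norm_eq_abs, abs_of_pos this.1]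
        exact this.2.le
      _ < 1 := by
        simp; rw [mul_inv_lt_iff₀ (by positivity)]; linarith
  have h1 := h _ hx
  have h2 : (fun k => ⟪e k, ∑ k, c k • e k⟫) = c := by
    funext k
    have := e.orthonormal.inner_right_fintype c k
    simpa using this
  rw [pf, h2] at h1
  simpa using h1

lemma PhiL_inj (hd : 0 < d) {lam : ℝ} (hlam : 0 < lam) (ha : ∀ k, lam ≤ a k)
    {q : MvPolynomial (Fin d) ℝ} (h : PhiL a q = 0) : q = 0 := by
  let e : OrthonormalBasis (Fin d) ℝ (Euc d) := EuclideanSpace.basisFun _ _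
  refine pf_eq_zero e hd fun x hx => ?_
  have hs : ContDiff ℝ ∞ (fun x => rho x * pf e q x) := rho_contDiff.mul (pf_smooth e q)
  have hb : ∀ ε : ℝ, 0 < ε → |rho x * pf e q x| ≤ 0 + ε := by
    intro ε hε
    have := sup_bound (ε := ε * lam) e a hd hlam ha hs
      (fun x hx => by simp [rho_eq_zero hx]) (by positivity)
      (fun x _ => by rw [Lop_pf, h]; simp [pf]; positivity) x (ball_subset_closedBall hx)
    simpa [hlam.ne'] using this
  have h1 := le_of_forall_pos_le_add hb
  have h2 : rho x * pf e q x = 0 := abs_eq_zero.1 (le_antisymm h1 (abs_nonneg _))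
  rcases mul_eq_zero.1 h2 with h3 | h3
  · exact absurd h3 (rho_pos hx).ne'
  · exact h3

lemma exists_sol (hd : 0 < d) {lam : ℝ} (hlam : 0 < lam) (ha : ∀ k, lam ≤ a k)
    (p : MvPolynomial (Fin d) ℝ) : ∃ q, PhiL a q = p := by
  set n := p.totalDegree
  let V := MvPolynomial.restrictTotalDegree (Fin d) ℝ n
  let F : V →ₗ[ℝ] V := (PhiL a).restrict fun q hq => PhiL_deg a hq
  have hF : Function.Injective F := by
    rw [← LinearMap.ker_eq_bot, LinearMap.ker_eq_bot']
    intro m hm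
    have : PhiL a m.1 = 0 := by
      have := congrArg Subtype.val hm
      simpa [F] using this
    exact Subtype.ext (PhiL_inj a hd hlam ha this)
  have hS := LinearMap.injective_iff_surjective.1 hF
  obtain ⟨q, hq⟩ := hS ⟨p, (MvPolynomial.mem_restrictTotalDegree _ _ _).2 le_rfl⟩
  refine ⟨q.1, ?_⟩
  have := congrArg Subtype.val hq
  simpa [F] using this

/-- the solution operator on polynomials -/
noncomputable def solP (hd : 0 < d) {lam : ℝ} (hlam : 0 < lam) (ha : ∀ k, lam ≤ a k) :
    MvPolynomial (Fin d) ℝ →ₗ[ℝ] MvPolynomial (Fin d) ℝ :=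
  (LinearEquiv.ofBijective (PhiL a)
    ⟨(LinearMap.ker_eq_bot.1 (LinearMap.ker_eq_bot'.2 fun _ h => PhiL_inj a hd hlam ha h)),
      exists_sol a hd hlam ha⟩).symm.toLinearMap

lemma PhiL_solP (hd : 0 < d) {lam : ℝ} (hlam : 0 < lam) (ha : ∀ k, lam ≤ a k)
    (p : MvPolynomial (Fin d) ℝ) : PhiL a (solP a hd hlam ha p) = p :=
  LinearEquiv.apply_symm_apply (LinearEquiv.ofBijective (PhiL a) _) p

/-- polynomials are uniformly dense on the closed ball -/
lemma pf_dense {ψ : Euc d → ℝ} (hψ : Continuous ψ) {ε : ℝ} (hε : 0 < ε) :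
    ∃ p, ∀ x ∈ closedBall (0 : Euc d) 1, |pf e p x - ψ x| < ε := by
  let F : MvPolynomial (Fin d) ℝ →ₐ[ℝ] C(Euc d, ℝ) :=
    MvPolynomial.aeval (fun k => (⟨fun x => ⟪e k, x⟫, by fun_prop⟩ : C(Euc d, ℝ)))
  have hF : ∀ p x, F p x = pf e p x := by
    intro p x
    induction p using MvPolynomial.induction_on with
    | C c => simp [F, pf]
    | add p q hp hq => simp only [pf, map_add, ContinuousMap.add_apply] at *; rw [hp, hq]
    | mul_X p k hp =>
      simp only [pf, map_mul, ContinuousMap.mul_apply] at *; rw [hp]; simp [F]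
  have hsep : (F.range).SeparatesPoints := by
    intro x y hxy
    have : ∃ k, ⟪e k, x⟫ ≠ ⟪e k, y⟫ := by
      by_contra hcon
      push Not at hcon
      refine hxy (e.repr.injective ?_)
      ext k
      rw [e.repr_apply_apply, e.repr_apply_apply]; exact hcon k
    obtain ⟨k, hk⟩ := this
    refine ⟨_, ⟨F (MvPolynomial.X k), ⟨_, rfl⟩, rfl⟩, ?_⟩
    simpa [F] using hk
  obtain ⟨g, ⟨p, rfl⟩, hg⟩ :=
    ContinuousMap.exists_mem_subalgebra_near_continuous_of_isCompact_of_separatesPoints hsep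
    (⟨ψ, hψ⟩ : C(Euc d, ℝ)) (isCompact_closedBall (0 : Euc d) 1) hε
  refine ⟨p, fun x hx => ?_⟩
  have := hg x hx
  rw [Real.norm_eq_abs] at this
  have h2 := hF p x
  simpa [← h2] using this

end polys


section meanvalue

/-- truncated powers -/
noncomputable def pw (n : ℕ) (s : ℝ) : ℝ := (max 0 (1 - s)) ^ n

lemma pw_nonneg (n : ℕ) (s : ℝ) : 0 ≤ pw n s := by unfold pw; positivity

lemma pw_cont (n : ℕ) : Continuous (pw n) := by unfold pw; fun_prop

lemma pw_le_one (n : ℕ) {s : ℝ} (hs : 0 ≤ s) : pw n s ≤ 1 := by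
  unfold pw
  exact pow_le_one₀ (by positivity) (max_le (by norm_num) (by linarith))

lemma pw_zero (n : ℕ) {s : ℝ} (hs : 1 ≤ s) : pw (n + 1) s = 0 := by
  unfold pw; rw [max_eq_left (by linarith)]; simp

lemma pw_deriv (n : ℕ) (s : ℝ) : HasDerivAt (pw (n + 2)) (-(n + 2) * pw (n + 1) s) s := by
  rcases lt_trichotomy s 1 with h | h | h
  · have h1 : HasDerivAt (fun s : ℝ => (1 - s) ^ (n + 2)) (-(n + 2) * (1 - s) ^ (n + 1)) s := by
      have := ((hasDerivAt_id s).const_sub 1).pow (n + 2)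
      refine this.congr_deriv ?_
      push_cast; simp only [id]; ring_nf
    rw [pw, max_eq_right (by linarith)]
    refine h1.congr_of_eventuallyEq ?_
    filter_upwards [eventually_lt_nhds h] with y hy
    rw [pw, max_eq_right (by linarith)]
  · subst h
    rw [pw_zero n le_rfl, mul_zero]
    have : pw (n + 2) =O[𝓝 1] fun x => ‖x - 1‖ ^ (n + 2) := by
      refine Asymptotics.IsBigO.of_bound 1 (Eventually.of_forall fun x => ?_)
      rw [one_mul, pw, norm_pow, norm_pow, norm_norm]
      refine pow_le_pow_left₀ (norm_nonneg _) ?_ _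
      rw [Real.norm_eq_abs, Real.norm_eq_abs, abs_of_nonneg (by positivity)]
      refine max_le (abs_nonneg _) ?_
      rw [abs_sub_comm]; exact le_abs_self _
    have := this.hasFDerivAt (𝕜 := ℝ) (by omega)
    simpa using this.hasDerivAt
  · rw [pw_zero n h.le, mul_zero]
    refine (hasDerivAt_const s (0:ℝ)).congr_of_eventuallyEq ?_
    filter_upwards [eventually_gt_nhds h] with y hy
    exact pw_zero (n + 1) hy.le

lemma pw_c1 (n : ℕ) : ContDiff ℝ 1 (pw (n + 2)) := by
  rw [contDiff_one_iff_deriv]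
  refine ⟨fun s => (pw_deriv n s).differentiableAt, ?_⟩
  have : deriv (pw (n + 2)) = fun s => -(n + 2) * pw (n + 1) s := by
    funext s; exact (pw_deriv n s).deriv
  rw [this]; exact continuous_const.mul (pw_cont _)

lemma pw_c2 (n : ℕ) : ContDiff ℝ 2 (pw (n + 3)) := by
  rw [show (2 : WithTop ℕ∞) = 1 + 1 by norm_num, contDiff_succ_iff_deriv]
  refine ⟨fun s => (pw_deriv (n + 1) s).differentiableAt, by simp, ?_⟩
  have : deriv (pw (n + 3)) = fun s => -((n + 1 : ℕ) + 2) * pw (n + 2) s := by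
    funext s; exact (pw_deriv (n + 1) s).deriv
  rw [this]; exact contDiff_const.mul (pw_c1 _)

variable {d : ℕ} (e : OrthonormalBasis (Fin d) ℝ (Euc d)) (a : Fin d → ℝ)

/-- the adapted quadratic form -/
noncomputable def Nn (x : Euc d) : ℝ := ∑ k, ⟪e k, x⟫ ^ 2 / a k

lemma Nn_smooth {n : WithTop ℕ∞} : ContDiff ℝ n (Nn e a) := by
  unfold Nn
  refine ContDiff.sum fun k _ => ?_
  exact ((contDiff_const.inner ℝ contDiff_id).pow 2).div_const _

lemma DD_Nn (k : Fin d) (x : Euc d) : DD (e k) (Nn e a) x = 2 * ⟪e k, x⟫ / a k := by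
  have h1 : Nn e a = fun x => ∑ j, (a j)⁻¹ * (⟪e j, x⟫ * ⟪e j, x⟫) := by
    funext x; simp only [Nn]; refine Finset.sum_congr rfl fun j _ => ?_
    rw [div_eq_inv_mul]; ring
  rw [h1, DD_sum]
  · have : ∀ j, DD (e k) (fun x : Euc d => (a j)⁻¹ * (⟪e j, x⟫ * ⟪e j, x⟫)) x
        = if j = k then 2 * ⟪e k, x⟫ / a k else 0 := by
      intro j
      rw [DD_const_mul (sm_diff ((inner_sm _).mul (inner_sm _)) x),
        DD_mul (sm_diff (inner_sm _) x) (sm_diff (inner_sm _) x), DD_inner]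
      have : (⟪e j, e k⟫ : ℝ) = if j = k then 1 else 0 := by
        simpa using orthonormal_iff_ite.1 e.orthonormal j k
      rw [this]
      split_ifs with h
      · subst h; rw [div_eq_inv_mul]; ring
      · ring
    simp only [this]; simp
  · intro j _
    exact sm_diff (contDiff_const.mul ((inner_sm _).mul (inner_sm _))) x

variable {a} {lam Lam : ℝ} 

lemma Nn_nonneg (hlam : 0 < lam) (ha : ∀ k, lam ≤ a k) (x : Euc d) : 0 ≤ Nn e a x :=
  Finset.sum_nonneg fun k _ => div_nonneg (sq_nonneg _) (hlam.le.trans (ha k))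

lemma Nn_le (hlam : 0 < lam) (ha : ∀ k, lam ≤ a k) (x : Euc d) : Nn e a x ≤ ‖x‖ ^ 2 / lam := by
  rw [← sum_inner_sq e x, Finset.sum_div]
  refine Finset.sum_le_sum fun k _ => ?_
  gcongr; exact ha k

lemma le_Nn (hlam : 0 < lam) (ha : ∀ k, lam ≤ a k) (ha' : ∀ k, a k ≤ Lam) (x : Euc d) :
    ‖x‖ ^ 2 ≤ Lam * Nn e a x := by
  rw [← sum_inner_sq e x, Nn, Finset.mul_sum]
  refine Finset.sum_le_sum fun k _ => ?_
  have := hlam.trans_le (ha k)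
  rw [mul_div_assoc', le_div_iff₀ this, mul_comm]
  gcongr; exact ha' k

/-- the cutoffs -/
noncomputable def Th (e : OrthonormalBasis (Fin d) ℝ (Euc d)) (a : Fin d → ℝ)
    (n : ℕ) (z : Euc d) (r : ℝ) (x : Euc d) : ℝ := pw n (Nn e a (x - z) / r ^ 2)

lemma Th_c1 (n : ℕ) (z : Euc d) (r : ℝ) : ContDiff ℝ 1 (Th e a (n + 2) z r) := by
  unfold Th
  exact (pw_c1 n).comp (((Nn_smooth e a).comp (contDiff_id.sub contDiff_const)).div_const _)

lemma Th_cont (n : ℕ) (z : Euc d) (r : ℝ) : Continuous (Th e a n z r) := by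
  unfold Th
  exact (pw_cont n).comp ((((Nn_smooth (n := 0) e a).continuous).comp (by fun_prop)).div_const _)

lemma DD_Th (n : ℕ) (z : Euc d) (r : ℝ) (k : Fin d) (x : Euc d) :
    DD (e k) (Th e a (n + 2) z r) x
      = (-(n + 2) * Th e a (n + 1) z r x) * (2 * ⟪e k, x - z⟫ / a k / r ^ 2) := by
  have h1 : HasFDerivAt (fun x : Euc d => Nn e a (x - z)) (fderiv ℝ (Nn e a) (x - z)) x := by
    have := ((Nn_smooth (n := 1) e a).differentiable (by simp) (x - z)).hasFDerivAt
    exact (this.comp x ((hasFDerivAt_id x).sub_const z))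
  have h2 := h1.mul_const ((r ^ 2)⁻¹)
  have h3 := (pw_deriv n (Nn e a (x - z) * (r ^ 2)⁻¹)).comp_hasFDerivAt x h2
  have h4 : Th e a (n + 2) z r = pw (n + 2) ∘ fun x : Euc d => Nn e a (x - z) * (r ^ 2)⁻¹ := by
    funext x; simp [Th, div_eq_mul_inv]
  rw [DD, h4, h3.fderiv]
  have h5 := DD_Nn e a k (x - z)
  rw [DD] at h5
  simp only [smul_apply, smul_eq_mul, h5, Th, div_eq_mul_inv]
  ring

lemma Lop_Th (hlam : 0 < lam) (ha : ∀ k, lam ≤ a k) (z : Euc d) (r : ℝ) (hr : 0 < r) (x : Euc d) :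
    Lop e a (Th e a 4 z r) x
      = (48 * (Nn e a (x - z) / r ^ 2) * Th e a 2 z r x - 8 * d * Th e a 3 z r x) / r ^ 2 := by
  have h1 : ∀ k, DD (e k) (Th e a 4 z r) =
      fun x => (-8 / a k / r ^ 2) * (Th e a 3 z r x * ⟪e k, x - z⟫) := by
    intro k; funext x
    rw [DD_Th e 2 z r k x]; push_cast; ring
  have h2 : ∀ k, a k * DD (e k) (DD (e k) (Th e a 4 z r)) x
      = 48 / r ^ 4 * Th e a 2 z r x * (⟪e k, x - z⟫ ^ 2 / a k) - 8 * Th e a 3 z r x / r ^ 2 := by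
    intro k
    have hk := (hlam.trans_le (ha k)).ne'
    have hi : ContDiff ℝ ∞ (fun x : Euc d => ⟪e k, x - z⟫) :=
      contDiff_const.inner ℝ (contDiff_id.sub contDiff_const)
    have hT : DifferentiableAt ℝ (Th e a 3 z r) x :=
      (Th_c1 e 1 z r).differentiable (by simp) x
    have hDi : DD (e k) (fun x : Euc d => ⟪e k, x - z⟫) x = 1 := by
      have : (fun x : Euc d => ⟪e k, x - z⟫) = fun x => ⟪e k, x⟫ - ⟪e k, z⟫ := by
        funext x; rw [inner_sub_right]
      rw [this, DD_sub (sm_diff (inner_sm _) x) (by fun_prop), DD_inner]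
      simp [DD, e.norm_eq_one]
    have hm : DifferentiableAt ℝ (fun x => Th e a 3 z r x * ⟪e k, x - z⟫) x :=
      hT.mul (sm_diff hi x)
    rw [h1, DD_const_mul hm, DD_mul hT (sm_diff hi x), DD_Th e 1 z r k x, hDi]
    push_cast
    field_simp
    ring
  rw [Lop, Finset.sum_congr rfl fun k _ => h2 k, Finset.sum_sub_distrib, ← Finset.mul_sum]
  rw [show ∑ k, ⟪e k, x - z⟫ ^ 2 / a k = Nn e a (x - z) from rfl]
  simp
  field_simp

/-- kernels -/
noncomputable def Kr (e : OrthonormalBasis (Fin d) ℝ (Euc d)) (a : Fin d → ℝ)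
    (z : Euc d) (r : ℝ) (x : Euc d) : ℝ := (r⁻¹) ^ d * (4 * Th e a 3 z r x)

lemma Kr_deriv (hlam : 0 < lam) (ha : ∀ k, lam ≤ a k) (z : Euc d) (r : ℝ) (hr : 0 < r) (x : Euc d) :
    HasDerivAt (fun r => Kr e a z r x)
      ((r⁻¹) ^ d * r / 2 * Lop e a (Th e a 4 z r) x) r := by
  have h1 : HasDerivAt (fun r : ℝ => (r⁻¹) ^ d) (d * (r⁻¹) ^ (d - 1) * (-(r ^ 2)⁻¹)) r :=
    (hasDerivAt_inv hr.ne').pow d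
  have h2 : HasDerivAt (fun r : ℝ => Nn e a (x - z) / r ^ 2)
      (Nn e a (x - z) * (-2 / r ^ 3)) r := by
    have h := ((hasDerivAt_pow 2 r).inv (by positivity)).const_mul (Nn e a (x - z))
    refine h.congr_deriv ?_
    push_cast
    field_simp
  have h3 := (pw_deriv 1 (Nn e a (x - z) / r ^ 2)).comp r h2
  have h4 := h1.mul (h3.const_mul 4)
  refine h4.congr_deriv ?_
  rw [Lop_Th e hlam ha z r hr]
  simp only [Function.comp, Th]
  have h5 : (d : ℝ) * (r⁻¹) ^ (d - 1) = d * ((r⁻¹) ^ d * r) := by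
    rcases d with _ | n
    · simp
    · rw [Nat.add_sub_cancel, pow_succ]; field_simp
  rw [h5]
  push_cast
  field_simp
  ring

end meanvalue


section meanvalue2
variable {d : ℕ} (e : OrthonormalBasis (Fin d) ℝ (Euc d)) {a : Fin d → ℝ} {lam Lam : ℝ}

lemma Kr_nonneg (z : Euc d) {r : ℝ} (hr : 0 < r) (x : Euc d) : 0 ≤ Kr e a z r x := by
  unfold Kr Th
  have := pw_nonneg 3 (Nn e a (x - z) / r ^ 2)
  positivity

lemma Kr_cont (z : Euc d) (r : ℝ) : Continuous (Kr e a z r) :=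
  continuous_const.mul (continuous_const.mul (Th_cont e 3 z r))

lemma Th_zero (n : ℕ) (z : Euc d) {r : ℝ} (hr : 0 < r) {x : Euc d} (hx : r ^ 2 ≤ Nn e a (x - z)) :
    Th e a (n + 1) z r x = 0 := by
  rw [Th, pw_zero]; rwa [le_div_iff₀ (by positivity), one_mul]

lemma lt_of_Nn (hlam : 0 < lam) (ha : ∀ k, lam ≤ a k) (ha' : ∀ k, a k ≤ Lam) (hL : 0 < Lam)
    {r : ℝ} (hr : 0 < r) {x z : Euc d} (h : Nn e a (x - z) < r ^ 2) :
    dist x z < √Lam * r := by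
  have h1 := le_Nn e hlam ha ha' (x - z)
  rw [dist_eq_norm]
  refine lt_of_pow_lt_pow_left₀ 2 (by positivity) ?_
  rw [mul_pow, Real.sq_sqrt hL.le]
  nlinarith

lemma Kr_supp (hlam : 0 < lam) (ha : ∀ k, lam ≤ a k) (ha' : ∀ k, a k ≤ Lam) (hL : 0 < Lam)
    {r : ℝ} (hr : 0 < r) {x z : Euc d} (h : √Lam * r ≤ dist x z) : Kr e a z r x = 0 := by
  have : r ^ 2 ≤ Nn e a (x - z) := by
    by_contra hcon
    exact absurd (lt_of_Nn e hlam ha ha' hL hr (not_le.1 hcon)) (not_lt.2 h)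
  rw [Kr, Th_zero e 2 z hr this]; simp

lemma Kr_integrable (hlam : 0 < lam) (ha : ∀ k, lam ≤ a k) (ha' : ∀ k, a k ≤ Lam) (hL : 0 < Lam)
    (z : Euc d) {r : ℝ} (hr : 0 < r) : Integrable (Kr e a z r) := by
  refine (Kr_cont e z r).integrable_of_hasCompactSupport ?_
  refine HasCompactSupport.intro (isCompact_closedBall z (√Lam * r)) fun x hx => ?_
  refine Kr_supp e hlam ha ha' hL hr ?_
  simp at hx; exact hx.le

/-- the normalisation -/
noncomputable def c0 (e : OrthonormalBasis (Fin d) ℝ (Euc d)) (a : Fin d → ℝ) : ℝ :=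
  ∫ x, 4 * pw 3 (Nn e a x)

lemma int_Kr (z : Euc d) {r : ℝ} (hr : 0 < r) : ∫ x, Kr e a z r x = c0 e a := by
  have h1 : ∀ x : Euc d, Nn e a x / r ^ 2 = Nn e a (r⁻¹ • x) := by
    intro x
    simp only [Nn, inner_smul_right, Finset.sum_div]
    refine Finset.sum_congr rfl fun k _ => ?_
    field_simp
  have h2 := integral_sub_right_eq_self (μ := (volume : Measure (Euc d)))
    (fun x : Euc d => (r⁻¹) ^ d * (4 * pw 3 (Nn e a (r⁻¹ • x)))) z
  have h3 : ∫ x, Kr e a z r x = ∫ x : Euc d, (r⁻¹) ^ d * (4 * pw 3 (Nn e a (r⁻¹ • x))) := by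
    rw [← h2]; simp only [Kr, Th, h1]
  rw [h3, integral_const_mul,
    Measure.integral_comp_inv_smul_of_nonneg volume (fun x => 4 * pw 3 (Nn e a x)) hr.le]
  have : Module.finrank ℝ (Euc d) = d := by simp [Euc]
  rw [this, smul_eq_mul, ← mul_assoc, ← mul_pow, inv_mul_cancel₀ hr.ne', one_pow, one_mul, c0]

lemma int_Kr_ball (hlam : 0 < lam) (ha : ∀ k, lam ≤ a k) (ha' : ∀ k, a k ≤ Lam) (hL : 0 < Lam)
    (z : Euc d) {r : ℝ} (hr : 0 < r) (hz : ball z (√Lam * r) ⊆ ball (0 : Euc d) 1) :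
    ∫ x in ball (0 : Euc d) 1, Kr e a z r x = c0 e a := by
  rw [← int_Kr e z hr]
  refine setIntegral_eq_integral_of_forall_compl_eq_zero fun x hx => ?_
  refine Kr_supp e hlam ha ha' hL hr ?_
  by_contra hcon
  exact hx (hz (not_le.1 hcon))

lemma int_Kr_le (hlam : 0 < lam) (ha : ∀ k, lam ≤ a k) (ha' : ∀ k, a k ≤ Lam) (hL : 0 < Lam)
    (z : Euc d) {r : ℝ} (hr : 0 < r) :
    ∫ x in ball (0 : Euc d) 1, Kr e a z r x ≤ c0 e a := by
  rw [← int_Kr e z hr]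
  exact setIntegral_le_integral (Kr_integrable e hlam ha ha' hL z hr)
    (Eventually.of_forall fun x => Kr_nonneg e z hr x)

lemma Th_four_c1 (z : Euc d) (r : ℝ) (k : Fin d) : ContDiff ℝ 1 (DD (e k) (Th e a 4 z r)) := by
  have : DD (e k) (Th e a 4 z r) = fun x =>
      (-((2 : ℕ) + 2) * Th e a 3 z r x) * (2 * ⟪e k, x - z⟫ / a k / r ^ 2) := by
    funext x; rw [DD_Th e 2 z r k x]
  rw [this]
  refine (contDiff_const.mul (Th_c1 e 1 z r)).mul ?_
  exact ((contDiff_const.mul (contDiff_const.inner ℝ (contDiff_id.sub contDiff_const))).div_const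
    _).div_const _

lemma Th_ibp {G : Euc d → ℝ} (hG : ContDiff ℝ ∞ G) (z : Euc d) {r : ℝ} (hr : 0 < r)
    (hbd : ∀ x ∈ sphere (0 : Euc d) 1, Nn e a (x - z) < r ^ 2 →
      G x = 0 ∧ ∀ k, DD (e k) G x = 0) :
    ∫ x in ball (0 : Euc d) 1, G x * Lop e a (Th e a 4 z r) x
      = ∫ x in ball (0 : Euc d) 1, Lop e a G x * Th e a 4 z r x := by
  have hT1 := Th_c1 e (a := a) 2 z r
  have hk : ∀ k, ∫ x in ball (0 : Euc d) 1, G x * DD (e k) (DD (e k) (Th e a 4 z r)) x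
      = ∫ x in ball (0 : Euc d) 1, DD (e k) (DD (e k) G) x * Th e a 4 z r x := by
    intro k
    rw [ibp (sm_one hG) (Th_four_c1 e z r k), ibp (sm_one (DD_smooth hG _)) hT1, neg_neg]
    · intro x hx
      by_cases h : Nn e a (x - z) < r ^ 2
      · simp [(hbd x hx h).2 k]
      · rw [Th_zero e 3 z hr (not_lt.1 h), mul_zero]
    · intro x hx
      by_cases h : Nn e a (x - z) < r ^ 2
      · simp [(hbd x hx h).1]
      · rw [DD_Th e 2 z r k x, Th_zero e 2 z hr (not_lt.1 h)]; simp
  have i1 : ∀ k, IntegrableOn (fun x => G x * DD (e k) (DD (e k) (Th e a 4 z r)) x)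
      (ball (0 : Euc d) 1) := fun k => ball_int (hG.continuous.mul
        (by
          have := (Th_four_c1 e (a := a) z r k).continuous_fderiv (by simp)
          exact this.clm_apply continuous_const))
  have i2 : ∀ k, IntegrableOn (fun x => DD (e k) (DD (e k) G) x * Th e a 4 z r x)
      (ball (0 : Euc d) 1) := fun k => ball_int
        ((DD_smooth (DD_smooth hG _) _).continuous.mul hT1.continuous)
  calc ∫ x in ball (0 : Euc d) 1, G x * Lop e a (Th e a 4 z r) x
      = ∫ x in ball (0 : Euc d) 1, ∑ k, a k * (G x * DD (e k) (DD (e k) (Th e a 4 z r)) x) := by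
        refine integral_congr_ae (Eventually.of_forall fun x => ?_)
        simp only [Lop, Finset.mul_sum]
        exact Finset.sum_congr rfl fun k _ => by ring
    _ = ∑ k, a k * ∫ x in ball (0 : Euc d) 1, DD (e k) (DD (e k) G) x * Th e a 4 z r x := by
        rw [integral_finsetSum _ fun k _ => (i1 k).const_mul _]
        refine Finset.sum_congr rfl fun k _ => ?_
        rw [integral_const_mul, hk]
    _ = ∫ x in ball (0 : Euc d) 1, ∑ k, a k * (DD (e k) (DD (e k) G) x * Th e a 4 z r x) := by
        rw [integral_finsetSum _ fun k _ => (i2 k).const_mul _]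
        refine Finset.sum_congr rfl fun k _ => ?_
        rw [integral_const_mul]
    _ = _ := by
        refine integral_congr_ae (Eventually.of_forall fun x => ?_)
        simp only [Lop, Finset.sum_mul]
        exact Finset.sum_congr rfl fun k _ => by ring

lemma m_deriv (hlam : 0 < lam) (ha : ∀ k, lam ≤ a k) {G : Euc d → ℝ} (hG : Continuous G)
    (z : Euc d) {r : ℝ} (hr : 0 < r) :
    HasDerivAt (fun r => ∫ x in ball (0 : Euc d) 1, G x * Kr e a z r x)
      ((r⁻¹) ^ d * r / 2 * ∫ x in ball (0 : Euc d) 1, G x * Lop e a (Th e a 4 z r) x) r := by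
  let F' : ℝ → Euc d → ℝ := fun r x => G x * ((r⁻¹) ^ d * r / 2 *
    ((48 * (Nn e a (x - z) / r ^ 2) * Th e a 2 z r x - 8 * d * Th e a 3 z r x) / r ^ 2))
  have hN : Continuous (fun x : Euc d => Nn e a (x - z)) :=
    (Nn_smooth (n := 0) e a).continuous.comp (by fun_prop)
  have hs : Set.Ioo (r / 2) (2 * r) ∈ 𝓝 r := Ioo_mem_nhds (by linarith) (by linarith)
  have hc : ContinuousOn (fun q : ℝ × Euc d => F' q.1 q.2)
      (Set.Icc (r / 2) (2 * r) ×ˢ closedBall (0 : Euc d) 1) := by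
    have hpos : ∀ q ∈ Set.Icc (r / 2) (2 * r) ×ˢ closedBall (0 : Euc d) 1, q.1 ≠ 0 := by
      intro q hq; have := hq.1.1; intro h; rw [h] at this; linarith
    have hpos2 : ∀ q ∈ Set.Icc (r / 2) (2 * r) ×ˢ closedBall (0 : Euc d) 1, q.1 ^ 2 ≠ 0 :=
      fun q hq => pow_ne_zero 2 (hpos q hq)
    have c1 : ContinuousOn (fun q : ℝ × Euc d => Nn e a (q.2 - z) / q.1 ^ 2)
        (Set.Icc (r / 2) (2 * r) ×ˢ closedBall (0 : Euc d) 1) :=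
      ((hN.comp continuous_snd).continuousOn).div (by fun_prop) hpos2
    have cT : ∀ n, ContinuousOn (fun q : ℝ × Euc d => Th e a n z q.1 q.2)
        (Set.Icc (r / 2) (2 * r) ×ˢ closedBall (0 : Euc d) 1) := fun n =>
      (pw_cont n).comp_continuousOn c1
    have ci : ContinuousOn (fun q : ℝ × Euc d => q.1⁻¹)
        (Set.Icc (r / 2) (2 * r) ×ˢ closedBall (0 : Euc d) 1) :=
      continuousOn_fst.inv₀ hpos
    refine (hG.comp continuous_snd).continuousOn.mul ?_
    refine (((ci.pow d).mul continuousOn_fst).div_const _).mul ?_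
    refine ContinuousOn.div ?_ (by fun_prop) hpos2
    exact ((continuousOn_const.mul c1).mul (cT 2)).sub (continuousOn_const.mul (cT 3))
  obtain ⟨C, hC⟩ := (isCompact_Icc.prod (isCompact_closedBall (0 : Euc d) 1)).exists_bound_of_continuousOn hc
  have hder : ∀ x, ∀ s ∈ Set.Ioo (r / 2) (2 * r),
      HasDerivAt (fun s => G x * Kr e a z s x) (F' s x) s := by
    intro x s hs
    have hs0 : 0 < s := by linarith [hs.1]
    have := (Kr_deriv e hlam ha z s hs0 x).const_mul (G x)
    rw [Lop_Th e hlam ha z s hs0] at this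
    exact this
  have hT : ∀ n, Continuous (Th e a n z r) := fun n => Th_cont e n z r
  have h := hasDerivAt_integral_of_dominated_loc_of_deriv_le
    (μ := volume.restrict (ball (0 : Euc d) 1)) (F := fun s x => G x * Kr e a z s x) (F' := F')
    (x₀ := r) (bound := fun _ => C) hs
    (Eventually.of_forall fun s => (hG.mul (Kr_cont e z s)).aestronglyMeasurable)
    (ball_int (hG.mul (Kr_cont e z r)))
    (Continuous.aestronglyMeasurable (by
      have := hT 2
      have := hT 3
      simp only [F']; fun_prop))
    ((ae_restrict_iff' measurableSet_ball).2 (Eventually.of_forall fun x hx s hs =>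
      hC (s, x) ⟨⟨hs.1.le, hs.2.le⟩, ball_subset_closedBall hx⟩))
    (ball_int continuous_const)
    (Eventually.of_forall fun x s hs => hder x s hs)
  refine h.2.congr_deriv ?_
  rw [← integral_const_mul]
  refine integral_congr_ae (Eventually.of_forall fun x => ?_)
  simp only [F']
  rw [Lop_Th e hlam ha z r hr]; ring

lemma m_deriv_ge (hlam : 0 < lam) (ha : ∀ k, lam ≤ a k) (ha' : ∀ k, a k ≤ Lam) (hL : 0 < Lam)
    {G : Euc d → ℝ} (hG : ContDiff ℝ ∞ G)
    (z : Euc d) {r : ℝ} (hr : 0 < r) {η : ℝ} (hη : 0 ≤ η)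
    (hbd : ∀ x ∈ sphere (0 : Euc d) 1, Nn e a (x - z) < r ^ 2 →
      G x = 0 ∧ ∀ k, DD (e k) G x = 0)
    (hLG : ∀ x ∈ ball (0 : Euc d) 1, Nn e a (x - z) < r ^ 2 → -η ≤ Lop e a G x) :
    -(η * c0 e a / 2 * r) ≤ (r⁻¹) ^ d * r / 2 *
      ∫ x in ball (0 : Euc d) 1, G x * Lop e a (Th e a 4 z r) x := by
  rw [Th_ibp e hG z hr hbd]
  have h1 : ∫ x in ball (0 : Euc d) 1, (-η * r ^ d) * Kr e a z r x
      ≤ ∫ x in ball (0 : Euc d) 1, Lop e a G x * Th e a 4 z r x := by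
    refine setIntegral_mono_on (ball_int (continuous_const.mul (Kr_cont e z r)))
      (ball_int ((Lop_smooth e a hG).continuous.mul (Th_cont e 4 z r))) measurableSet_ball ?_
    intro x hx
    have hK : r ^ d * Kr e a z r x = 4 * Th e a 3 z r x := by
      rw [Kr, ← mul_assoc, ← mul_pow, mul_inv_cancel₀ hr.ne', one_pow, one_mul]
    by_cases h : Nn e a (x - z) < r ^ 2
    · have h2 := hLG x hx h
      have h0 : 0 ≤ Nn e a (x - z) / r ^ 2 := by
        have := Nn_nonneg e hlam ha (x - z); positivity
      have h4 : 0 ≤ Th e a 4 z r x := pw_nonneg _ _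
      have h43 : Th e a 4 z r x ≤ Th e a 3 z r x := by
        have h1 := pw_le_one 1 h0
        have h3 := pw_nonneg 3 (Nn e a (x - z) / r ^ 2)
        have : Th e a 4 z r x = Th e a 3 z r x * pw 1 (Nn e a (x - z) / r ^ 2) := by
          simp only [Th, pw]; ring
        rw [this]; exact mul_le_of_le_one_right h3 h1
      have : (-η * r ^ d) * Kr e a z r x = -(η * (4 * Th e a 3 z r x)) := by rw [← hK]; ring
      rw [this]
      nlinarith [mul_nonneg hη h4, mul_nonneg hη (h4.trans h43), mul_le_mul_of_nonneg_left h43 hη]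
    · rw [Th_zero e 3 z hr (not_lt.1 h), Kr, Th_zero e 2 z hr (not_lt.1 h)]; simp
  rw [integral_const_mul] at h1
  have h2 := int_Kr_le e hlam ha ha' hL z hr
  have h3 : -(η * c0 e a / 2 * r) = (r⁻¹) ^ d * r / 2 * ((-η * r ^ d) * c0 e a) := by
    rw [inv_pow]; field_simp
  rw [h3]
  refine mul_le_mul_of_nonneg_left (le_trans ?_ h1) (by positivity)
  have : 0 ≤ η * r ^ d := by positivity
  nlinarith

theorem mean_value (hlam : 0 < lam) (ha : ∀ k, lam ≤ a k) (ha' : ∀ k, a k ≤ Lam) (hL : 0 < Lam)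
    {G : Euc d → ℝ} (hG : ContDiff ℝ ∞ G)
    {z : Euc d} (hz : z ∈ ball (0 : Euc d) 1) {R : ℝ} (hR : 0 < R) {η : ℝ} (hη : 0 ≤ η)
    (hbd : ∀ x ∈ sphere (0 : Euc d) 1, Nn e a (x - z) < R ^ 2 →
      G x = 0 ∧ ∀ k, DD (e k) G x = 0)
    (hLG : ∀ x ∈ ball (0 : Euc d) 1, Nn e a (x - z) < R ^ 2 → -η ≤ Lop e a G x) :
    c0 e a * G z ≤ (∫ x in ball (0 : Euc d) 1, G x * Kr e a z R x) + η * c0 e a / 4 * R ^ 2 := by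
  set m : ℝ → ℝ := fun r => ∫ x in ball (0 : Euc d) 1, G x * Kr e a z r x
  have hc0 : 0 ≤ c0 e a := integral_nonneg fun x => by
    have := pw_nonneg 3 (Nn e a x); show 0 ≤ 4 * pw 3 (Nn e a x); positivity
  have hder : ∀ r, 0 < r → HasDerivAt (fun r => m r + η * c0 e a / 4 * r ^ 2)
      ((r⁻¹) ^ d * r / 2 * (∫ x in ball (0 : Euc d) 1, G x * Lop e a (Th e a 4 z r) x)
        + η * c0 e a / 2 * r) r := by
    intro r hr
    have h1 := (m_deriv e hlam ha hG.continuous z hr).add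
      ((hasDerivAt_pow 2 r).const_mul (η * c0 e a / 4))
    refine h1.congr_deriv ?_
    push_cast; ring
  have hmono : ∀ δ, 0 < δ → δ ≤ R → m δ ≤ m R + η * c0 e a / 4 * R ^ 2 := by
    intro δ hδ hδR
    have h : MonotoneOn (fun r => m r + η * c0 e a / 4 * r ^ 2) (Set.Icc δ R) := by
      refine monotoneOn_of_deriv_nonneg (convex_Icc _ _) ?_ ?_ ?_
      · intro r hr
        exact (hder r (hδ.trans_le hr.1)).continuousAt.continuousWithinAt
      · intro r hr
        rw [interior_Icc] at hr
        exact (hder r (hδ.trans hr.1)).differentiableAt.differentiableWithinAt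
      · intro r hr
        rw [interior_Icc] at hr
        have hr0 := hδ.trans hr.1
        rw [(hder r hr0).deriv]
        have hrR : r ^ 2 ≤ R ^ 2 := by gcongr; exact hr.2.le
        have := m_deriv_ge e hlam ha ha' hL hG z hr0 hη
          (fun x hx h => hbd x hx (h.trans_le hrR)) (fun x hx h => hLG x hx (h.trans_le hrR))
        linarith
    have := h ⟨le_rfl, hδR⟩ ⟨hδR, le_rfl⟩ hδR
    have h2 : 0 ≤ η * c0 e a / 4 * δ ^ 2 := by positivity
    simp only at this
    linarith
  refine le_of_forall_pos_le_add fun ε hε => ?_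
  obtain ⟨ε', hε', hε''⟩ : ∃ ε', 0 < ε' ∧ c0 e a * ε' ≤ ε := by
    refine ⟨ε / (c0 e a + 1), by positivity, ?_⟩
    rw [mul_div_assoc', div_le_iff₀ (by positivity)]; nlinarith
  obtain ⟨s, hs, hsG⟩ : ∃ s > 0, ∀ x, dist x z < s → x ∈ ball (0 : Euc d) 1 ∧ G z - ε' ≤ G x := by
    have h1 : ∀ᶠ x in 𝓝 z, x ∈ ball (0 : Euc d) 1 ∧ G z - ε' ≤ G x := by
      filter_upwards [isOpen_ball.mem_nhds hz,
        hG.continuous.continuousAt.eventually (lt_mem_nhds (sub_lt_self (G z) hε'))]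
        with x hx hx' using ⟨hx, hx'.le⟩
    exact Metric.eventually_nhds_iff.1 h1
  set δ := min R (s / √Lam)
  have hsL : 0 < √Lam := Real.sqrt_pos.2 hL
  have hδ : 0 < δ := lt_min hR (by positivity)
  have hδs : √Lam * δ ≤ s := by
    calc √Lam * δ ≤ √Lam * (s / √Lam) := by gcongr; exact min_le_right _ _
      _ = s := by field_simp
  have h1 := hmono δ hδ (min_le_left _ _)
  have h2 : ∫ x in ball (0 : Euc d) 1, (G z - ε') * Kr e a z δ x ≤ m δ := by
    refine setIntegral_mono_on (ball_int (continuous_const.mul (Kr_cont e z δ)))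
      (ball_int (hG.continuous.mul (Kr_cont e z δ))) measurableSet_ball ?_
    intro x _
    by_cases h : √Lam * δ ≤ dist x z
    · rw [Kr_supp e hlam ha ha' hL hδ h]; simp
    · exact mul_le_mul_of_nonneg_right (hsG x ((not_le.1 h).trans_le hδs)).2 (Kr_nonneg e z hδ x)
  rw [integral_const_mul, int_Kr_ball e hlam ha ha' hL z hδ
    (fun x hx => (hsG x ((mem_ball.1 hx).trans_le hδs)).1)] at h2
  have h3 : m R = ∫ x in ball (0 : Euc d) 1, G x * Kr e a z R x := rfl
  rw [← h3]
  nlinarith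

end meanvalue2


section holder
variable {d : ℕ} (e : OrthonormalBasis (Fin d) ℝ (Euc d)) {a : Fin d → ℝ} {lam Lam : ℝ}

/-- lower bound for the normalisation -/
noncomputable def cmin (d : ℕ) (lam : ℝ) : ℝ :=
  (1 / 2) * (volume : Measure (Euc d)).real (ball (0 : Euc d) √(lam / 2))

lemma cmin_pos (hlam : 0 < lam) : 0 < cmin d lam := by
  have : 0 < (volume : Measure (Euc d)).real (ball (0 : Euc d) √(lam / 2)) :=
    ENNReal.toReal_pos (measure_ball_pos volume _ (Real.sqrt_pos.2 (by positivity))).ne'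
      measure_ball_lt_top.ne
  unfold cmin; positivity

lemma cmin_le (hlam : 0 < lam) (ha : ∀ k, lam ≤ a k) (ha' : ∀ k, a k ≤ Lam) (hL : 0 < Lam) :
    cmin d lam ≤ c0 e a := by
  have hK : ∀ x, Kr e a 0 1 x = 4 * pw 3 (Nn e a x) := by intro x; simp [Kr, Th]
  have hi : Integrable (fun x : Euc d => 4 * pw 3 (Nn e a x)) := by
    have := Kr_integrable e hlam ha ha' hL 0 one_pos
    simpa only [hK] using (show Integrable (fun x => Kr e a 0 1 x) from this)
  calc cmin d lam = ∫ x in ball (0 : Euc d) √(lam / 2), (1 / 2 : ℝ) := by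
        rw [setIntegral_const, cmin, smul_eq_mul, mul_comm]
    _ ≤ ∫ x in ball (0 : Euc d) √(lam / 2), 4 * pw 3 (Nn e a x) := by
        refine setIntegral_mono_on (integrableOn_const measure_ball_lt_top.ne) hi.integrableOn
          measurableSet_ball fun x hx => ?_
        have h1 := Nn_le e hlam ha x
        have h2 : ‖x‖ ^ 2 ≤ lam / 2 := by
          have : ‖x‖ < √(lam / 2) := by simpa using hx
          calc ‖x‖ ^ 2 ≤ √(lam / 2) ^ 2 := by gcongr
            _ = _ := Real.sq_sqrt (by positivity)
        have h3 : Nn e a x ≤ 1 / 2 := h1.trans (by rw [div_le_iff₀ hlam]; linarith)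
        have h4 : (1 / 2 : ℝ) ≤ max 0 (1 - Nn e a x) := le_max_of_le_right (by linarith)
        have h5 : (1 / 2 : ℝ) ^ 3 ≤ pw 3 (Nn e a x) := pow_le_pow_left₀ (by norm_num) h4 3
        norm_num at h5 ⊢; linarith
    _ ≤ c0 e a := setIntegral_le_integral hi (Eventually.of_forall fun x => by
        have := pw_nonneg 3 (Nn e a x); show 0 ≤ 4 * pw 3 (Nn e a x); positivity)

/-- local sup bound by the `L²` norm -/
lemma sup_sq (hlam : 0 < lam) (ha : ∀ k, lam ≤ a k) (ha' : ∀ k, a k ≤ Lam) (hL : 0 < Lam)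
    {v : Euc d → ℝ} (hv : ContDiff ℝ ∞ v) (h0 : ∀ x ∈ sphere (0 : Euc d) 1, v x = 0)
    {z : Euc d} (hz : z ∈ ball (0 : Euc d) 1) {R : ℝ} (hR : 0 < R) {ε M : ℝ} (hε : 0 ≤ ε)
    (hM : 0 ≤ M)
    (hLv : ∀ x ∈ ball (0 : Euc d) 1, Nn e a (x - z) < R ^ 2 → |Lop e a v x| ≤ ε)
    (hvM : ∀ x ∈ ball (0 : Euc d) 1, |v x| ≤ M) :
    v z ^ 2 ≤ 4 / cmin d lam * ((R⁻¹) ^ d * ∫ x in ball (0 : Euc d) 1, v x ^ 2)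
      + ε * M / 2 * R ^ 2 := by
  have hG : ContDiff ℝ ∞ (fun x => v x * v x) := hv.mul hv
  have hm := mean_value e hlam ha ha' hL hG hz hR (η := 2 * (ε * M)) (by positivity)
    (by
      intro x hx _
      refine ⟨by simp [h0 x hx], fun k => ?_⟩
      rw [DD_mul (sm_diff hv x) (sm_diff hv x), h0 x hx]; ring)
    (by
      intro x hx hN
      rw [Lop_mul e a hv hv]
      have h1 : 0 ≤ ∑ k, a k * (DD (e k) v x * DD (e k) v x) :=
        Finset.sum_nonneg fun k _ => mul_nonneg (hlam.le.trans (ha k)) (mul_self_nonneg _)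
      have h2 : |v x * Lop e a v x| ≤ M * ε := by
        rw [abs_mul]; exact mul_le_mul (hvM x hx) (hLv x hx hN) (abs_nonneg _) hM
      have := (abs_le.1 h2).1
      linarith)
  have hc := cmin_pos (d := d) hlam
  have hc' := cmin_le e hlam ha ha' hL
  have hI : 0 ≤ ∫ x in ball (0 : Euc d) 1, v x ^ 2 := integral_nonneg fun x => sq_nonneg _
  have h1 : ∫ x in ball (0 : Euc d) 1, v x * v x * Kr e a z R x
      ≤ ∫ x in ball (0 : Euc d) 1, 4 * (R⁻¹) ^ d * v x ^ 2 := by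
    refine setIntegral_mono_on (ball_int (hG.continuous.mul (Kr_cont e z R)))
      (ball_int (continuous_const.mul (hv.continuous.pow 2))) measurableSet_ball fun x _ => ?_
    have : Kr e a z R x ≤ 4 * (R⁻¹) ^ d := by
      have h3 : Th e a 3 z R x ≤ 1 := pw_le_one 3 (by
        have := Nn_nonneg e hlam ha (x - z); positivity)
      have : 0 < (R⁻¹) ^ d := by positivity
      rw [Kr]; nlinarith
    calc v x * v x * Kr e a z R x = v x ^ 2 * Kr e a z R x := by ring
      _ ≤ v x ^ 2 * (4 * (R⁻¹) ^ d) := by gcongr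
      _ = _ := by ring
  rw [integral_const_mul] at h1
  set I := ∫ x in ball (0 : Euc d) 1, v x ^ 2
  have h2 : c0 e a * v z ^ 2 ≤ c0 e a * (4 / cmin d lam * ((R⁻¹) ^ d * I) + ε * M / 2 * R ^ 2) := by
    have h3 : 4 * (R⁻¹) ^ d * I ≤ c0 e a * (4 / cmin d lam * ((R⁻¹) ^ d * I)) := by
      have : (1 : ℝ) ≤ c0 e a / cmin d lam := by rw [le_div_iff₀ hc]; linarith
      calc 4 * (R⁻¹) ^ d * I = 1 * (4 * ((R⁻¹) ^ d * I)) := by ring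
        _ ≤ c0 e a / cmin d lam * (4 * ((R⁻¹) ^ d * I)) := by gcongr
        _ = _ := by ring
    nlinarith
  exact le_of_mul_le_mul_left h2 (hc.trans_le hc')

lemma pw_lip {s t : ℝ} (hs : 0 ≤ s) (ht : 0 ≤ t) : |pw 3 s - pw 3 t| ≤ 3 * |s - t| := by
  unfold pw
  set A := max 0 (1 - s) with hA
  set B := max 0 (1 - t) with hB
  have hA0 : 0 ≤ A := le_max_left _ _
  have hB0 : 0 ≤ B := le_max_left _ _
  have hA1 : A ≤ 1 := max_le (by norm_num) (by linarith)
  have hB1 : B ≤ 1 := max_le (by norm_num) (by linarith)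
  have h1 : |A - B| ≤ |s - t| := by
    have := abs_max_sub_max_le_abs (1 - s) (1 - t) 0
    rw [max_comm _ (0 : ℝ), max_comm _ (0 : ℝ)] at this
    rw [hA, hB]
    refine this.trans (le_of_eq ?_)
    rw [abs_sub_comm s t]; congr 1; ring
  have h2 : A ^ 3 - B ^ 3 = (A - B) * (A ^ 2 + A * B + B ^ 2) := by ring
  have h3 : |A ^ 2 + A * B + B ^ 2| ≤ 3 := by
    rw [abs_of_nonneg (by positivity)]; nlinarith
  rw [h2, abs_mul, mul_comm]
  exact mul_le_mul h3 h1 (abs_nonneg _) (by norm_num)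

lemma Nn_diff (hlam : 0 < lam) (ha : ∀ k, lam ≤ a k) (x y : Euc d) :
    |Nn e a x - Nn e a y| ≤ d / lam * (‖x - y‖ * (‖x‖ + ‖y‖)) := by
  have h1 : Nn e a x - Nn e a y = ∑ k, ⟪e k, x - y⟫ * ⟪e k, x + y⟫ / a k := by
    simp only [Nn, ← Finset.sum_sub_distrib, inner_sub_right, inner_add_right]
    refine Finset.sum_congr rfl fun k _ => by ring
  have hin : ∀ k (w : Euc d), |⟪e k, w⟫| ≤ ‖w‖ := fun k w => by
    have := abs_real_inner_le_norm (e k) w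
    rwa [e.norm_eq_one, one_mul] at this
  rw [h1]
  refine (Finset.abs_sum_le_sum_abs _ _).trans ?_
  calc ∑ k, |⟪e k, x - y⟫ * ⟪e k, x + y⟫ / a k|
      ≤ ∑ k : Fin d, (‖x - y‖ * (‖x‖ + ‖y‖)) / lam := by
        refine Finset.sum_le_sum fun k _ => ?_
        rw [abs_div, abs_mul, abs_of_pos (hlam.trans_le (ha k))]
        gcongr
        · exact hin k _
        · exact (hin k _).trans (norm_add_le _ _)
        · exact ha k
    _ = _ := by simp; ring

/-- the Lipschitz constant -/
noncomputable def CLip (d : ℕ) (lam Lam : ℝ) : ℝ :=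
  (volume : Measure (Euc d)).real (ball (0 : Euc d) (2 * √Lam)) * (36 * (d / lam) * √Lam) / cmin d lam

lemma Kr_diff (hlam : 0 < lam) (ha : ∀ k, lam ≤ a k) (ha' : ∀ k, a k ≤ Lam) (hL : 0 < Lam)
    {z z' : Euc d} {R : ℝ} (hR : 0 < R) (hzz : dist z z' ≤ √Lam * R) :
    ∫ x in ball (0 : Euc d) 1, |Kr e a z R x - Kr e a z' R x|
      ≤ (volume : Measure (Euc d)).real (ball (0 : Euc d) (2 * √Lam)) *
        (36 * (d / lam) * √Lam) * (dist z z' / R) := by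
  have hsL : 0 < √Lam := Real.sqrt_pos.2 hL
  set c : ℝ := (R⁻¹) ^ d * ((36 * (d / lam) * √Lam) * (dist z z' / R))
  have hc : 0 ≤ c := by positivity
  have hpt : ∀ x, |Kr e a z R x - Kr e a z' R x|
      ≤ (ball z (R * (2 * √Lam))).indicator (fun _ => c) x := by
    intro x
    by_cases hx : x ∈ ball z (R * (2 * √Lam))
    · rw [Set.indicator_of_mem hx]
      by_cases hb : √Lam * R ≤ dist x z ∧ √Lam * R ≤ dist x z'
      · rw [Kr_supp e hlam ha ha' hL hR hb.1, Kr_supp e hlam ha ha' hL hR hb.2]; simpa using hc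
      have hsum : dist x z + dist x z' ≤ 3 * √Lam * R := by
        have t1 := dist_triangle x z z'
        have t2 := dist_triangle x z' z
        rw [dist_comm z' z] at t2
        by_cases h1 : √Lam * R ≤ dist x z
        · have : dist x z' < √Lam * R := by
            by_contra h; exact hb ⟨h1, not_lt.1 h⟩
          linarith
        · push Not at h1; linarith
      have hd : Kr e a z R x - Kr e a z' R x
          = (R⁻¹) ^ d * (4 * (pw 3 (Nn e a (x - z) / R ^ 2) - pw 3 (Nn e a (x - z') / R ^ 2))) := by
        simp only [Kr, Th]; ring
      have hl := pw_lip (s := Nn e a (x - z) / R ^ 2) (t := Nn e a (x - z') / R ^ 2)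
        (by have := Nn_nonneg e hlam ha (x - z); positivity)
        (by have := Nn_nonneg e hlam ha (x - z'); positivity)
      have hn := Nn_diff e hlam ha (x - z) (x - z')
      rw [← sub_div, abs_div, abs_of_pos (show 0 < R ^ 2 by positivity)] at hl
      have e1 : ‖x - z - (x - z')‖ = dist z z' := by
        rw [dist_comm, dist_eq_norm]; congr 1; abel
      rw [e1, ← dist_eq_norm, ← dist_eq_norm] at hn
      rw [hd, abs_mul, abs_mul, abs_of_pos (show 0 < (R⁻¹) ^ d by positivity),
        abs_of_pos (show (0:ℝ) < 4 by norm_num)]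
      simp only [c]
      refine mul_le_mul_of_nonneg_left ?_ (by positivity)
      calc 4 * |pw 3 (Nn e a (x - z) / R ^ 2) - pw 3 (Nn e a (x - z') / R ^ 2)|
          ≤ 4 * (3 * (|Nn e a (x - z) - Nn e a (x - z')| / R ^ 2)) := by gcongr
        _ ≤ 4 * (3 * ((d / lam * (dist z z' * (3 * √Lam * R))) / R ^ 2)) := by
            gcongr
            refine hn.trans ?_
            gcongr
        _ = _ := by field_simp; ring
    · rw [Set.indicator_of_notMem hx]
      have h1 : R * (2 * √Lam) ≤ dist x z := by simpa using hx
      have h2 : √Lam * R ≤ dist x z' := by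
        have := dist_triangle x z' z
        rw [dist_comm z' z] at this; linarith
      have h3 : √Lam * R ≤ dist x z := by nlinarith
      rw [Kr_supp e hlam ha ha' hL hR h3, Kr_supp e hlam ha ha' hL hR h2]; simp
  have hci : Integrable ((ball z (R * (2 * √Lam))).indicator (fun _ => c)) :=
    (integrable_indicator_iff measurableSet_ball).2 (integrableOn_const measure_ball_lt_top.ne)
  calc ∫ x in ball (0 : Euc d) 1, |Kr e a z R x - Kr e a z' R x|
      ≤ ∫ x, |Kr e a z R x - Kr e a z' R x| :=
        setIntegral_le_integral ((Kr_integrable e hlam ha ha' hL z hR).sub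
          (Kr_integrable e hlam ha ha' hL z' hR)).abs (Eventually.of_forall fun x => abs_nonneg _)
    _ ≤ ∫ x, (ball z (R * (2 * √Lam))).indicator (fun _ => c) x :=
        integral_mono ((Kr_integrable e hlam ha ha' hL z hR).sub
          (Kr_integrable e hlam ha ha' hL z' hR)).abs hci hpt
    _ = (volume : Measure (Euc d)).real (ball z (R * (2 * √Lam))) * c := by
        rw [integral_indicator measurableSet_ball, setIntegral_const, smul_eq_mul]
    _ = R ^ d * (volume : Measure (Euc d)).real (ball (0 : Euc d) (2 * √Lam)) * c := by
        rw [measureReal_def, Measure.addHaar_ball_mul_of_pos _ _ hR, ENNReal.toReal_mul,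
          ENNReal.toReal_ofReal (by positivity)]
        have : Module.finrank ℝ (Euc d) = d := by simp [Euc]
        rw [this, measureReal_def]
    _ = _ := by
        simp only [c]
        rw [inv_pow]
        field_simp

lemma int_lip (hlam : 0 < lam) (ha : ∀ k, lam ≤ a k) (ha' : ∀ k, a k ≤ Lam) (hL : 0 < Lam)
    {v : Euc d → ℝ} (hv : ContDiff ℝ ∞ v)
    {z z' : Euc d} {R : ℝ} (hR : 0 < R) (hzz : dist z z' ≤ √Lam * R) {U : Set (Euc d)}
    (hU : U ⊆ ball (0 : Euc d) 1)
    (hz : ball z (√Lam * R) ⊆ U) (hz' : ball z' (√Lam * R) ⊆ U)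
    {ε M : ℝ} (hε : 0 ≤ ε) (hM : 0 ≤ M)
    (hLv : ∀ x ∈ U, |Lop e a v x| ≤ ε) (hvM : ∀ x ∈ U, |v x| ≤ M) :
    v z - v z' ≤ CLip d lam Lam * (M * (dist z z' / R)) + ε / 2 * R ^ 2 := by
  have hsL : 0 < √Lam := Real.sqrt_pos.2 hL
  have hc := cmin_pos (d := d) hlam
  have hc' := cmin_le e hlam ha ha' hL
  have hself : ∀ w : Euc d, ball w (√Lam * R) ⊆ U → w ∈ ball (0 : Euc d) 1 := fun w hw =>
    hU (hw (mem_ball_self (by positivity)))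
  have key : ∀ w : Euc d, ball w (√Lam * R) ⊆ U → ∀ G : Euc d → ℝ, ContDiff ℝ ∞ G →
      (∀ x ∈ U, -ε ≤ Lop e a G x) →
      c0 e a * G w ≤ (∫ x in ball (0 : Euc d) 1, G x * Kr e a w R x) + ε * c0 e a / 4 * R ^ 2 := by
    intro w hw G hG hLG
    refine mean_value e hlam ha ha' hL hG (hself w hw) hR hε ?_ ?_
    · intro x hx hN
      have h1 : x ∈ ball (0 : Euc d) 1 := hU (hw (lt_of_Nn e hlam ha ha' hL hR hN))
      simp at h1 hx; linarith
    · intro x _ hN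
      exact hLG x (hw (lt_of_Nn e hlam ha ha' hL hR hN))
  have k1 := key z hz v hv (fun x hx => (abs_le.1 (hLv x hx)).1)
  have k2 := key z' hz' (fun x => (-1) * v x) (contDiff_const.mul hv) (fun x hx => by
    rw [Lop_const_mul e a hv]; linarith [(abs_le.1 (hLv x hx)).2])
  have hIntg : ∀ w, IntegrableOn (fun x => v x * Kr e a w R x) (ball (0 : Euc d) 1) := fun w =>
    ball_int (hv.continuous.mul (Kr_cont e w R))
  have h1 : (∫ x in ball (0 : Euc d) 1, v x * Kr e a z R x)
      + ∫ x in ball (0 : Euc d) 1, (-1) * v x * Kr e a z' R x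
      ≤ ∫ x in ball (0 : Euc d) 1, M * |Kr e a z R x - Kr e a z' R x| := by
    have hIntg' : IntegrableOn (fun x => (-1) * v x * Kr e a z' R x) (ball (0 : Euc d) 1) :=
      ball_int ((continuous_const.mul hv.continuous).mul (Kr_cont e z' R))
    rw [← integral_add (hIntg z) hIntg']
    refine setIntegral_mono_on ?_ ?_ measurableSet_ball ?_
    · exact ball_int ((hv.continuous.mul (Kr_cont e z R)).add
        ((continuous_const.mul hv.continuous).mul (Kr_cont e z' R)))
    · exact ball_int (continuous_const.mul ((Kr_cont e z R).sub (Kr_cont e z' R)).abs)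
    · intro x _
      by_cases hx : x ∈ U
      · calc v x * Kr e a z R x + (-1) * v x * Kr e a z' R x
            = v x * (Kr e a z R x - Kr e a z' R x) := by ring
          _ ≤ |v x * (Kr e a z R x - Kr e a z' R x)| := le_abs_self _
          _ ≤ _ := by rw [abs_mul]; gcongr; exact hvM x hx
      · have s1 : Kr e a z R x = 0 := Kr_supp e hlam ha ha' hL hR (by
          by_contra h; exact hx (hz (not_le.1 h)))
        have s2 : Kr e a z' R x = 0 := Kr_supp e hlam ha ha' hL hR (by
          by_contra h; exact hx (hz' (not_le.1 h)))
        rw [s1, s2]; simp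
  rw [integral_const_mul] at h1
  have h2 := mul_le_mul_of_nonneg_left (Kr_diff e hlam ha ha' hL hR hzz) hM
  set W := (volume : Measure (Euc d)).real (ball (0 : Euc d) (2 * √Lam)) * (36 * (d / lam) * √Lam)
    with hW
  have hW0 : 0 ≤ W := by positivity
  have h3 : c0 e a * (v z - v z') ≤ M * (W * (dist z z' / R)) + ε * c0 e a / 2 * R ^ 2 := by
    linarith
  have h4 : M * (W * (dist z z' / R)) ≤ c0 e a * (CLip d lam Lam * (M * (dist z z' / R))) := by
    have : (1 : ℝ) ≤ c0 e a / cmin d lam := by rw [le_div_iff₀ hc]; linarith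
    calc M * (W * (dist z z' / R)) = 1 * (M * (W * (dist z z' / R))) := by ring
      _ ≤ c0 e a / cmin d lam * (M * (W * (dist z z' / R))) := by gcongr
      _ = _ := by rw [CLip, ← hW]; ring
  have h5 : c0 e a * (v z - v z')
      ≤ c0 e a * (CLip d lam Lam * (M * (dist z z' / R)) + ε / 2 * R ^ 2) := by
    nlinarith
  exact le_of_mul_le_mul_left h5 (hc.trans_le hc')

end holder


section holder2
variable {d : ℕ} (e : OrthonormalBasis (Fin d) ℝ (Euc d)) {a : Fin d → ℝ} {lam Lam : ℝ}

/-- the Hoelder constant -/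
noncomputable def CH (d : ℕ) (lam Lam : ℝ) : ℝ :=
  4 * √Lam * CLip d lam Lam + 1 / Lam + 16 * (1 + 2 * ((d * Lam + 1) / lam))

lemma CLip_nonneg (hlam : 0 < lam) : 0 ≤ CLip d lam Lam := by
  have := cmin_pos (d := d) hlam
  unfold CLip; positivity

lemma CH_pos (hlam : 0 < lam) (hL : 0 < Lam) : 0 < CH d lam Lam := by
  have := CLip_nonneg (d := d) (Lam := Lam) hlam
  unfold CH; positivity

lemma holder_aux (hlam : 0 < lam) (ha : ∀ k, lam ≤ a k) (ha' : ∀ k, a k ≤ Lam) (hL : 0 < Lam)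
    {v : Euc d → ℝ} (hv : ContDiff ℝ ∞ v) (h0 : ∀ x ∈ sphere (0 : Euc d) 1, v x = 0)
    {y : Euc d} (hy : y ∈ ball (0 : Euc d) 1) {τ R : ℝ} (hτ : 0 < τ) (hτ8 : τ ≤ 1 / 8)
    (hR : 0 < R) (hR4 : R ≤ 4) {ε M : ℝ} (hε : 0 < ε) (hM : 0 ≤ M)
    (hLv : ∀ x ∈ ball (0 : Euc d) 1, x ∈ ball y R → |Lop e a v x| ≤ ε)
    (hvM : ∀ x ∈ ball (0 : Euc d) 1, x ∈ ball y (R / 2) → |v x| ≤ M)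
    {x x' : Euc d} (hx : x ∈ ball (0 : Euc d) 1) (hx' : x' ∈ ball (0 : Euc d) 1)
    (hxy : x ∈ ball y (τ ^ 2 * R)) (hxy' : x' ∈ ball y (τ ^ 2 * R)) :
    v x - v x' ≤ CH d lam Lam * (τ * M + ε) := by
  have hsL : 0 < √Lam := Real.sqrt_pos.2 hL
  have hC := CLip_nonneg (d := d) (Lam := Lam) hlam
  have hK : 0 < 1 + 2 * ((d * Lam + 1) / lam) := by positivity
  set K := 1 + 2 * ((d * Lam + 1) / lam) with hKd
  have hb : 0 ≤ τ * M + ε := by positivity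
  have hτM : 0 ≤ τ * M := by positivity
  set s := τ * R with hs
  have hs0 : 0 < s := by positivity
  have hsR : s ≤ R / 8 := by rw [hs]; nlinarith
  have hρ : τ ^ 2 * R = τ * s := by rw [hs]; ring
  have hρs : τ * s ≤ s / 8 := by nlinarith
  rw [hρ] at hxy hxy'
  rw [mem_ball] at hxy hxy'
  have hy1 : ‖y‖ < 1 := by simpa using hy
  by_cases hA : ‖y‖ + s ≤ 1
  · have hRR : √Lam * (s / (2 * √Lam)) = s / 2 := by field_simp
    have hdd : dist x x' ≤ 2 * (τ * s) := by
      have := dist_triangle_right x x' y; linarith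
    have h := int_lip e hlam ha ha' hL hv (z := x) (z' := x') (R := s / (2 * √Lam)) (by positivity)
      (by rw [hRR]; linarith) (U := ball y s)
      (ball_subset_ball' (by simpa [add_comm] using hA))
      (by rw [hRR]; exact ball_subset_ball' (by linarith))
      (by rw [hRR]; exact ball_subset_ball' (by linarith)) hε.le hM
      (fun z hz => hLv z (ball_subset_ball' (by simpa [add_comm] using hA) hz)
        (ball_subset_ball (by linarith) hz))
      (fun z hz => hvM z (ball_subset_ball' (by simpa [add_comm] using hA) hz)
        (ball_subset_ball (by linarith) hz))
    have h1 : dist x x' / (s / (2 * √Lam)) ≤ 4 * √Lam * τ := by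
      rw [div_le_iff₀ (by positivity)]
      calc dist x x' ≤ 2 * (τ * s) := hdd
        _ = _ := by field_simp; ring
    have h2 : ε / 2 * (s / (2 * √Lam)) ^ 2 ≤ ε * (1 / Lam) := by
      have : (s / (2 * √Lam)) ^ 2 = s ^ 2 / 4 * (1 / Lam) := by
        rw [div_pow, mul_pow 2, Real.sq_sqrt hL.le]; field_simp; norm_num
      rw [this]
      have hs2 : s ^ 2 ≤ 1 := by nlinarith
      have h3 : s ^ 2 / 4 * (1 / Lam) ≤ 1 * (1 / Lam) := by gcongr; linarith
      nlinarith
    have h3 : CLip d lam Lam * (M * (dist x x' / (s / (2 * √Lam)))) ≤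
        CLip d lam Lam * (M * (4 * √Lam * τ)) := by gcongr
    calc v x - v x' ≤ CLip d lam Lam * (M * (4 * √Lam * τ)) + ε * (1 / Lam) := by linarith
      _ = (4 * √Lam * CLip d lam Lam) * (τ * M) + (1 / Lam) * ε := by ring
      _ ≤ (4 * √Lam * CLip d lam Lam) * (τ * M + ε) + (1 / Lam) * (τ * M + ε)
          + 16 * K * (τ * M + ε) := by
          have a1 : (4 * √Lam * CLip d lam Lam) * (τ * M) ≤ (4 * √Lam * CLip d lam Lam) * (τ * M + ε) := by
            gcongr; linarith
          have a2 : (1 / Lam) * ε ≤ (1 / Lam) * (τ * M + ε) := by gcongr; linarith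
          have a3 : 0 ≤ 16 * K * (τ * M + ε) := by positivity
          linarith
      _ = _ := by rw [CH, ← hKd]; ring
  · push Not at hA
    have hyp : 0 < ‖y‖ := by linarith
    set y0 : Euc d := (‖y‖⁻¹ : ℝ) • y with hy0
    have hy0s : y0 ∈ sphere (0 : Euc d) 1 := by
      simp [hy0, norm_smul, hyp.ne']
    have hyy0 : dist y y0 < s := by
      have : y - y0 = (1 - ‖y‖⁻¹ : ℝ) • y := by rw [sub_smul, one_smul]
      rw [dist_eq_norm, this, norm_smul, Real.norm_eq_abs]
      have h1 : (1 - ‖y‖⁻¹ : ℝ) ≤ 0 := by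
        rw [sub_nonpos]; exact (one_le_inv₀ hyp).2 hy1.le
      rw [abs_of_nonpos h1]
      have : -(1 - ‖y‖⁻¹) * ‖y‖ = 1 - ‖y‖ := by field_simp; ring
      linarith
    have hbar : ∀ z ∈ ball (0 : Euc d) 1, dist z y < τ * s →
        |v z| ≤ K * (M + ε) * (8 * τ) := by
      intro z hz hzy
      have hzy0 : dist z y0 ≤ 2 * s := by
        have := dist_triangle z y y0; linarith
      have h := barrier e a hlam ha ha' hv h0 hε (R := R / 4) (M := M) (by positivity) y0 hy0s
        (fun w hw => hLv w hw.1 (by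
          have := hw.2
          rw [mem_ball] at this ⊢
          have := dist_triangle_right w y y0; linarith)) hM
        (fun w hw => by
          rcases (mem_closedBall.1 hw.1).lt_or_eq with h | h
          · refine hvM w h ?_
            have := hw.2
            rw [mem_closedBall] at this
            rw [mem_ball]
            have := dist_triangle_right w y y0; linarith
          · rw [h0 w h]; simpa using hM) z
        ⟨ball_subset_closedBall hz, by rw [mem_closedBall]; linarith⟩
      refine h.trans ?_
      rw [← hKd]
      have h1 : dist z y0 / (R / 4) ≤ 8 * τ := by
        rw [div_le_iff₀ (by positivity)]; rw [hs] at hzy0; linarith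
      have h2 : ε * (R / 4) ^ 2 ≤ ε := by
        have : (R / 4) ^ 2 ≤ 1 := by nlinarith
        nlinarith
      gcongr
    have b1 := hbar x hx hxy
    have b2 := hbar x' hx' hxy'
    have b3 : v x - v x' ≤ |v x| + |v x'| := by
      have := le_abs_self (v x); have := neg_abs_le (v x'); linarith
    have a1 : 0 ≤ 4 * √Lam * CLip d lam Lam * (τ * M + ε) := by positivity
    have a2 : 0 ≤ 1 / Lam * (τ * M + ε) := by positivity
    have a3 : K * (M + ε) * (8 * τ) ≤ 8 * K * (τ * M + ε) := by
      have : τ * ε ≤ 1 * ε := by gcongr; linarith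
      calc K * (M + ε) * (8 * τ) = 8 * K * (τ * M + τ * ε) := by ring
        _ ≤ _ := by gcongr; linarith
    calc v x - v x' ≤ 16 * K * (τ * M + ε) := by linarith
      _ ≤ _ := by rw [CH, ← hKd]; linarith

/-- Hoelder estimate in terms of the `L²` norm -/
lemma holder_main (hlam : 0 < lam) (ha : ∀ k, lam ≤ a k) (ha' : ∀ k, a k ≤ Lam) (hL : 0 < Lam)
    {v : Euc d → ℝ} (hv : ContDiff ℝ ∞ v) (h0 : ∀ x ∈ sphere (0 : Euc d) 1, v x = 0)
    {y : Euc d} (hy : y ∈ ball (0 : Euc d) 1) {τ R : ℝ} (hτ : 0 < τ) (hτ8 : τ ≤ 1 / 8)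
    (hR : 0 < R) (hR4 : R ≤ 4) {ε M : ℝ} (hε : 0 < ε) (hM : 0 ≤ M)
    (hLv : ∀ x ∈ ball (0 : Euc d) 1, x ∈ ball y R → |Lop e a v x| ≤ ε)
    (hvM : ∀ x ∈ ball (0 : Euc d) 1, |v x| ≤ M)
    {x x' : Euc d} (hx : x ∈ ball (0 : Euc d) 1) (hx' : x' ∈ ball (0 : Euc d) 1)
    (hxy : x ∈ ball y (τ ^ 2 * R)) (hxy' : x' ∈ ball y (τ ^ 2 * R)) :
    |v x - v x'| ≤ CH d lam Lam * (τ * √(4 / cmin d lam *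
      (((R / (2 * √Lam))⁻¹) ^ d * ∫ x in ball (0 : Euc d) 1, v x ^ 2)
        + ε * M / 2 * (R / (2 * √Lam)) ^ 2) + ε) := by
  have hsL : 0 < √Lam := Real.sqrt_pos.2 hL
  have hsup : ∀ z ∈ ball (0 : Euc d) 1, z ∈ ball y (R / 2) → |v z| ≤
      √(4 / cmin d lam * (((R / (2 * √Lam))⁻¹) ^ d * ∫ x in ball (0 : Euc d) 1, v x ^ 2)
        + ε * M / 2 * (R / (2 * √Lam)) ^ 2) := by
    intro z hz hzy
    refine Real.abs_le_sqrt (sup_sq e hlam ha ha' hL hv h0 hz (by positivity) hε.le hM ?_ hvM)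
    intro w hw hN
    refine hLv w hw ?_
    have h1 := lt_of_Nn e hlam ha ha' hL (by positivity) hN
    have h2 : √Lam * (R / (2 * √Lam)) = R / 2 := by field_simp
    have h3 : dist w z < R / 2 := by
      first
        | (rw [h2] at h1; exact h1)
        | (have := mem_ball.1 h1; rw [h2] at this; exact this)
    rw [mem_ball] at hzy ⊢
    have := dist_triangle w z y; linarith
  refine abs_le.2 ⟨?_, ?_⟩
  · have := holder_aux e hlam ha ha' hL hv h0 hy hτ hτ8 hR hR4 hε (Real.sqrt_nonneg _) hLv hsup
      hx' hx hxy' hxy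
    linarith
  · exact holder_aux e hlam ha ha' hL hv h0 hy hτ hτ8 hR hR4 hε (Real.sqrt_nonneg _) hLv hsup
      hx hx' hxy hxy'

end holder2


section opT
variable {d : ℕ} (e : OrthonormalBasis (Fin d) ℝ (Euc d)) {a : Fin d → ℝ} {lam Lam : ℝ}

/-- Lebesgue measure on the unit ball -/
noncomputable abbrev muB (d : ℕ) : Measure (Euc d) := volume.restrict (ball (0 : Euc d) 1)

instance muB_fin : IsFiniteMeasure (muB d) := ⟨by
  rw [Measure.restrict_apply_univ]; exact measure_ball_lt_top⟩

lemma cont_bdd {f : Euc d → ℝ} (hf : Continuous f) :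
    ∃ C, 0 ≤ C ∧ ∀ x ∈ closedBall (0 : Euc d) 1, |f x| ≤ C := by
  obtain ⟨C, hC⟩ := (isCompact_closedBall (0 : Euc d) 1).exists_bound_of_continuousOn hf.continuousOn
  exact ⟨max C 0, le_max_right _ _, fun x hx => (hC x hx).trans (le_max_left _ _)⟩

lemma ae_ball {P : Euc d → Prop} (h : ∀ x ∈ ball (0 : Euc d) 1, P x) : ∀ᵐ x ∂muB d, P x :=
  (ae_restrict_iff' measurableSet_ball).2 (Eventually.of_forall h)

lemma cont_memLp {f : Euc d → ℝ} (hf : Continuous f) (q : ℝ≥0∞) : MemLp f q (muB d) := by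
  obtain ⟨C, -, hC⟩ := cont_bdd hf
  exact MemLp.of_bound hf.aestronglyMeasurable C
    (ae_ball fun x hx => hC x (ball_subset_closedBall hx))

lemma toLp_inner {μ : Measure (Euc d)} {f g : Euc d → ℝ} (hf : MemLp f 2 μ) (hg : MemLp g 2 μ) :
    ⟪hf.toLp f, hg.toLp g⟫ = ∫ x, f x * g x ∂μ := by
  rw [L2.inner_def]
  refine integral_congr_ae ?_
  filter_upwards [hf.coeFn_toLp, hg.coeFn_toLp] with x h1 h2
  rw [h1, h2]; simp [mul_comm]

lemma Lp_inner {μ : Measure (Euc d)} (f g : Lp ℝ 2 μ) :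
    ⟪f, g⟫ = ∫ x, f x * g x ∂μ := by
  rw [L2.inner_def]
  refine integral_congr_ae (Eventually.of_forall fun x => ?_)
  simp [mul_comm]

lemma Lp_norm_sq {μ : Measure (Euc d)} (f : Lp ℝ 2 μ) :
    ‖f‖ ^ 2 = ∫ x, f x ^ 2 ∂μ := by
  rw [← real_inner_self_eq_norm_sq, Lp_inner]
  simp only [sq]

lemma pf_add (p q : MvPolynomial (Fin d) ℝ) : pf e (p + q) = pf e p + pf e q := by
  funext x; simp [pf]

lemma pf_smul (c : ℝ) (q : MvPolynomial (Fin d) ℝ) : pf e (c • q) = c • pf e q := by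
  funext x; simp [pf]

lemma pf_memLp (p : MvPolynomial (Fin d) ℝ) (q : ℝ≥0∞) : MemLp (pf e p) q (muB d) :=
  cont_memLp (pf_smooth e p).continuous q

/-- polynomials as elements of `L²(B)` -/
noncomputable def iota : MvPolynomial (Fin d) ℝ →ₗ[ℝ] Lp ℝ 2 (muB d) where
  toFun p := (pf_memLp e p 2).toLp (pf e p)
  map_add' p q := by
    rw [← MemLp.toLp_add]
    exact MemLp.toLp_congr _ _ (by rw [pf_add])
  map_smul' c p := by
    rw [RingHom.id_apply, ← MemLp.toLp_const_smul]
    exact MemLp.toLp_congr _ _ (by rw [pf_smul])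

lemma iota_coe (p : MvPolynomial (Fin d) ℝ) : iota e p =ᵐ[muB d] pf e p :=
  (pf_memLp e p 2).coeFn_toLp

lemma iota_inner (p q : MvPolynomial (Fin d) ℝ) :
    ⟪iota e p, iota e q⟫ = ∫ x in ball (0 : Euc d) 1, pf e p x * pf e q x :=
  toLp_inner (pf_memLp e p 2) (pf_memLp e q 2)

lemma iota_norm_sq (p : MvPolynomial (Fin d) ℝ) :
    ‖iota e p‖ ^ 2 = ∫ x in ball (0 : Euc d) 1, pf e p x ^ 2 := by
  rw [← real_inner_self_eq_norm_sq, iota_inner]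
  simp only [sq]

/-- polynomials are dense in `L^q(B)` -/
lemma pf_dense_Lp {q : ℝ≥0∞} (hq : q ≠ ⊤) (hq1 : 1 ≤ q) {f : Euc d → ℝ} (hf : MemLp f q (muB d))
    {ε : ℝ} (hε : 0 < ε) : ∃ p, eLpNorm (f - pf e p) q (muB d) ≤ ENNReal.ofReal ε := by
  obtain ⟨g, hg1, hg2, hg3⟩ := hf.exist_eLpNorm_sub_le hq hq1 (half_pos hε)
  set V : ℝ≥0∞ := (muB d) Set.univ ^ (q.toReal⁻¹) with hV
  have hVt : V ≠ ⊤ := ENNReal.rpow_ne_top_of_nonneg (by positivity) (measure_ne_top _ _)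
  set V' : ℝ := V.toReal + 1 with hV'
  have hV'0 : 0 < V' := by positivity
  obtain ⟨p, hp⟩ := pf_dense e hg2.continuous (ε := ε / 2 / V') (by positivity)
  refine ⟨p, ?_⟩
  have h1 : eLpNorm (g - pf e p) q (muB d) ≤ ENNReal.ofReal (ε / 2) := by
    have h2 : ∀ᵐ x ∂muB d, ‖(g - pf e p) x‖ ≤ ε / 2 / V' := ae_ball fun x hx => by
      have := hp x (ball_subset_closedBall hx)
      rw [abs_sub_comm] at this
      exact this.le
    refine (eLpNorm_le_of_ae_bound h2).trans ?_
    rw [← hV]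
    calc V * ENNReal.ofReal (ε / 2 / V') ≤ ENNReal.ofReal V' * ENNReal.ofReal (ε / 2 / V') := by
          gcongr
          rw [← ENNReal.ofReal_toReal hVt]
          exact ENNReal.ofReal_le_ofReal (by linarith)
      _ = ENNReal.ofReal (ε / 2) := by
          rw [← ENNReal.ofReal_mul hV'0.le]; congr 1; field_simp
  have hg4 : MemLp g q (muB d) := cont_memLp hg2.continuous q
  calc eLpNorm (f - pf e p) q (muB d) = eLpNorm ((f - g) + (g - pf e p)) q (muB d) := by
        congr 1; simp
    _ ≤ eLpNorm (f - g) q (muB d) + eLpNorm (g - pf e p) q (muB d) :=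
        eLpNorm_add_le (hf.sub hg4).1 (hg4.sub (pf_memLp e p q)).1 hq1
    _ ≤ ENNReal.ofReal (ε / 2) + ENNReal.ofReal (ε / 2) := add_le_add hg3 h1
    _ = _ := by rw [← ENNReal.ofReal_add (by positivity) (by positivity)]; congr 1; ring

lemma iota_dense : DenseRange (iota e) := by
  intro f
  rw [Metric.mem_closure_iff]
  intro ε hε
  obtain ⟨p, hp⟩ := pf_dense_Lp e (q := 2) (by simp) (by simp) (Lp.memLp f) (half_pos hε)
  refine ⟨iota e p, ⟨p, rfl⟩, ?_⟩
  rw [dist_eq_norm, Lp.norm_def]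
  have : eLpNorm (f - iota e p : Lp ℝ 2 (muB d)) 2 (muB d) = eLpNorm ((f : Euc d → ℝ) - pf e p) 2 (muB d) := by
    refine eLpNorm_congr_ae ?_
    filter_upwards [Lp.coeFn_sub f (iota e p), iota_coe e p] with x h1 h2
    rw [h1]; simp [h2]
  rw [this]
  exact (ENNReal.toReal_le_of_le_ofReal (by positivity) hp).trans_lt (by linarith)

/-- polynomial solution, as a polynomial -/
noncomputable def uP (a : Fin d → ℝ) (hd : 0 < d) {lam : ℝ} (hlam : 0 < lam) (ha : ∀ k, lam ≤ a k) :
    MvPolynomial (Fin d) ℝ →ₗ[ℝ] MvPolynomial (Fin d) ℝ :=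
  (LinearMap.mulLeft ℝ (rhoP d)).comp (solP a hd hlam ha)

lemma pf_uP (hd : 0 < d) (hlam : 0 < lam) (ha : ∀ k, lam ≤ a k) (p : MvPolynomial (Fin d) ℝ) :
    pf e (uP a hd hlam ha p) = fun x => rho x * pf e (solP a hd hlam ha p) x :=
  pf_rhoP_mul e _

lemma uP_sphere (hd : 0 < d) (hlam : 0 < lam) (ha : ∀ k, lam ≤ a k) (p : MvPolynomial (Fin d) ℝ)
    {x : Euc d} (hx : x ∈ sphere (0 : Euc d) 1) : pf e (uP a hd hlam ha p) x = 0 := by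
  rw [pf_uP]; simp [rho_eq_zero hx]

lemma Lop_uP (hd : 0 < d) (hlam : 0 < lam) (ha : ∀ k, lam ≤ a k) (p : MvPolynomial (Fin d) ℝ) :
    Lop e a (pf e (uP a hd hlam ha p)) = pf e p := by
  rw [pf_uP, Lop_pf, PhiL_solP]

/-- self-adjointness -/
lemma Lop_symm {u v : Euc d → ℝ} (hu : ContDiff ℝ ∞ u) (hv : ContDiff ℝ ∞ v)
    (hu0 : ∀ x ∈ sphere (0 : Euc d) 1, u x = 0) (hv0 : ∀ x ∈ sphere (0 : Euc d) 1, v x = 0) :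
    ∫ x in ball (0 : Euc d) 1, u x * Lop e a v x = ∫ x in ball (0 : Euc d) 1, Lop e a u x * v x := by
  have key : ∀ k, ∫ x in ball (0 : Euc d) 1, u x * DD (e k) (DD (e k) v) x
      = ∫ x in ball (0 : Euc d) 1, DD (e k) (DD (e k) u) x * v x := by
    intro k
    rw [ibp (sm_one hu) (sm_one (DD_smooth hv _)) (fun x hx => by simp [hu0 x hx]),
      ibp (sm_one (DD_smooth hu _)) (sm_one hv) (fun x hx => by simp [hv0 x hx]), neg_neg]
  have e1 : ∀ x, u x * Lop e a v x = ∑ k, a k * (u x * DD (e k) (DD (e k) v) x) := fun x => by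
    rw [Lop, Finset.mul_sum]; exact Finset.sum_congr rfl fun k _ => by ring
  have e2 : ∀ x, Lop e a u x * v x = ∑ k, a k * (DD (e k) (DD (e k) u) x * v x) := fun x => by
    rw [Lop, Finset.sum_mul]; exact Finset.sum_congr rfl fun k _ => by ring
  simp only [e1, e2]
  rw [integral_finsetSum, integral_finsetSum]
  · refine Finset.sum_congr rfl fun k _ => ?_
    rw [integral_const_mul, integral_const_mul, key]
  · exact fun k _ => ball_int (continuous_const.mul
      ((DD_smooth (DD_smooth hu _) _).continuous.mul hv.continuous))
  · exact fun k _ => ball_int (continuous_const.mul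
      (hu.continuous.mul (DD_smooth (DD_smooth hv _) _).continuous))

/-- `L²` bound for the solution -/
lemma poincare (hd : 0 < d) (hlam : 0 < lam) (ha : ∀ k, lam ≤ a k)
    {u : Euc d → ℝ} (hu : ContDiff ℝ ∞ u) (hu0 : ∀ x ∈ sphere (0 : Euc d) 1, u x = 0) :
    ∫ x in ball (0 : Euc d) 1, u x ^ 2 ≤ (4 * lam⁻¹) ^ 2 * ∫ x in ball (0 : Euc d) 1, (Lop e a u x) ^ 2 := by
  have sD : ∀ k, ContDiff ℝ ∞ (DD (e k) u) := fun k => DD_smooth hu _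
  have sL := Lop_smooth e a hu
  let k0 : Fin d := ⟨0, hd⟩
  -- energy
  have en : ∀ k, ∫ x in ball (0 : Euc d) 1, u x * DD (e k) (DD (e k) u) x
      = - ∫ x in ball (0 : Euc d) 1, (DD (e k) u x) ^ 2 := by
    intro k
    rw [ibp (sm_one hu) (sm_one (sD k)) (fun x hx => by simp [hu0 x hx])]
    simp only [sq]
  have e1 : ∫ x in ball (0 : Euc d) 1, u x * Lop e a u x
      = - ∑ k, a k * ∫ x in ball (0 : Euc d) 1, (DD (e k) u x) ^ 2 := by
    have e1 : ∀ x, u x * Lop e a u x = ∑ k, a k * (u x * DD (e k) (DD (e k) u) x) := fun x => by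
      rw [Lop, Finset.mul_sum]; exact Finset.sum_congr rfl fun k _ => by ring
    simp only [e1]
    have hii : ∀ k ∈ Finset.univ, IntegrableOn (fun x => a k * (u x * DD (e k) (DD (e k) u) x))
        (ball (0 : Euc d) 1) := fun k _ => ball_int (continuous_const.mul
      (hu.continuous.mul (DD_smooth (sD k) _).continuous))
    rw [integral_finsetSum _ hii]
    rw [← Finset.sum_neg_distrib]
    refine Finset.sum_congr rfl fun k _ => ?_
    rw [integral_const_mul, en]; ring
  have e2 : lam * ∫ x in ball (0 : Euc d) 1, (DD (e k0) u x) ^ 2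
      ≤ - ∫ x in ball (0 : Euc d) 1, u x * Lop e a u x := by
    rw [e1, neg_neg]
    have hnn : ∀ k, 0 ≤ ∫ x in ball (0 : Euc d) 1, (DD (e k) u x) ^ 2 := fun k =>
      integral_nonneg fun x => sq_nonneg _
    calc lam * ∫ x in ball (0 : Euc d) 1, (DD (e k0) u x) ^ 2
        ≤ a k0 * ∫ x in ball (0 : Euc d) 1, (DD (e k0) u x) ^ 2 :=
          mul_le_mul_of_nonneg_right (ha k0) (hnn k0)
      _ ≤ _ := Finset.single_le_sum (f := fun k => a k * ∫ x in ball (0 : Euc d) 1, (DD (e k) u x) ^ 2)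
          (fun k _ => mul_nonneg (hlam.le.trans (ha k)) (hnn k)) (Finset.mem_univ k0)
  have hU : IntegrableOn (fun x => u x ^ 2) (ball (0 : Euc d) 1) := ball_int (hu.continuous.pow 2)
  have hDU : IntegrableOn (fun x => DD (e k0) u x ^ 2) (ball (0 : Euc d) 1) :=
    ball_int ((sD k0).continuous.pow 2)
  have hLU : IntegrableOn (fun x => Lop e a u x ^ 2) (ball (0 : Euc d) 1) :=
    ball_int (sL.continuous.pow 2)
  -- Poincare
  have e3 : ∫ x in ball (0 : Euc d) 1, u x ^ 2
      ≤ ∫ x in ball (0 : Euc d) 1, (1 / 2 * u x ^ 2 + 2 * DD (e k0) u x ^ 2) := by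
    have hs : ContDiff ℝ ∞ (fun x => u x * u x) := hu.mul hu
    have h := ibp (sm_one hs) (sm_one (inner_sm (e k0))) (fun x hx => by simp [hu0 x hx]) (e k0)
    have h1 : ∀ x : Euc d, DD (e k0) (fun x => ⟪e k0, x⟫) x = 1 := fun x => by
      rw [DD_inner]; simp
    have h2 : ∀ x : Euc d, DD (e k0) (fun x => u x * u x) x = 2 * (u x * DD (e k0) u x) := fun x => by
      rw [DD_mul (sm_diff hu x) (sm_diff hu x)]; ring
    simp only [h1, h2, mul_one] at h
    have h3 : ∫ x in ball (0 : Euc d) 1, u x ^ 2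
        = ∫ x in ball (0 : Euc d) 1, -(2 * (u x * DD (e k0) u x) * ⟪e k0, x⟫) := by
      rw [integral_neg, ← h]; simp only [sq]
    rw [h3]
    refine setIntegral_mono_on (ball_int ((continuous_const.mul
      (hu.continuous.mul (sD k0).continuous)).mul (inner_sm (e k0)).continuous).neg)
      ((hU.const_mul _).add (hDU.const_mul _)) measurableSet_ball fun x hx => ?_
    have hx1 : ⟪e k0, x⟫ ^ 2 ≤ 1 := by
      have h4 := abs_real_inner_le_norm (e k0) x
      have h5 : ‖x‖ < 1 := by simpa using hx
      have h6 : ‖e k0‖ = 1 := by simp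
      rw [h6, one_mul] at h4
      rw [← sq_abs]
      exact pow_le_one₀ (abs_nonneg _) (by linarith)
    set w := ⟪e k0, x⟫
    set D := DD (e k0) u x
    nlinarith [sq_nonneg (u x + 2 * (w * D)), mul_le_mul_of_nonneg_left hx1 (sq_nonneg D)]
  have e4 : ∫ x in ball (0 : Euc d) 1, (1 / 2 * u x ^ 2 + 2 * DD (e k0) u x ^ 2)
      = 1 / 2 * (∫ x in ball (0 : Euc d) 1, u x ^ 2) + 2 * ∫ x in ball (0 : Euc d) 1, DD (e k0) u x ^ 2 := by
    rw [integral_add (hU.const_mul _) (hDU.const_mul _), integral_const_mul, integral_const_mul]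
  have e5 : (- ∫ x in ball (0 : Euc d) 1, u x * Lop e a u x)
      ≤ lam / 8 * (∫ x in ball (0 : Euc d) 1, u x ^ 2)
        + 2 * lam⁻¹ * ∫ x in ball (0 : Euc d) 1, Lop e a u x ^ 2 := by
    rw [← integral_neg, ← integral_const_mul, ← integral_const_mul,
      ← integral_add (hU.const_mul _) (hLU.const_mul _)]
    refine integral_mono (ball_int (hu.continuous.mul sL.continuous)).neg
      ((hU.const_mul _).add (hLU.const_mul _)) fun x => ?_
    show -(u x * Lop e a u x) ≤ lam / 8 * u x ^ 2 + 2 * lam⁻¹ * Lop e a u x ^ 2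
    have : lam / 8 * u x ^ 2 + 2 * lam⁻¹ * Lop e a u x ^ 2 + u x * Lop e a u x
        = lam / 8 * (u x + 4 * lam⁻¹ * Lop e a u x) ^ 2 := by field_simp; ring
    have h0 : 0 ≤ lam / 8 * (u x + 4 * lam⁻¹ * Lop e a u x) ^ 2 := by positivity
    linarith
  rw [e4] at e3
  set I := ∫ x in ball (0 : Euc d) 1, u x ^ 2
  set J := ∫ x in ball (0 : Euc d) 1, DD (e k0) u x ^ 2
  set K := ∫ x in ball (0 : Euc d) 1, Lop e a u x ^ 2
  have e6 : lam * J ≤ lam / 8 * I + 2 * lam⁻¹ * K := e2.trans e5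
  have e7 : J ≤ I / 8 + 2 * (lam⁻¹) ^ 2 * K := by
    have := mul_le_mul_of_nonneg_left e6 (inv_nonneg.2 hlam.le)
    calc J = lam⁻¹ * (lam * J) := by field_simp
      _ ≤ _ := this
      _ = _ := by field_simp
  nlinarith

end opT


section opT2
variable {d : ℕ} (e : OrthonormalBasis (Fin d) ℝ (Euc d)) {a : Fin d → ℝ} {lam Lam : ℝ}
  (hd : 0 < d) (hlam : 0 < lam) (ha : ∀ k, lam ≤ a k)

/-- solution operator on polynomials -/
noncomputable def S0 : MvPolynomial (Fin d) ℝ →ₗ[ℝ] Lp ℝ 2 (muB d) :=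
  (iota e).comp (uP a hd hlam ha)

/-- second derivatives of the solution operator on polynomials -/
noncomputable def T0 (j k : Fin d) : MvPolynomial (Fin d) ℝ →ₗ[ℝ] Lp ℝ 2 (muB d) :=
  (iota e).comp (((MvPolynomial.pderiv j).toLinearMap.comp
    (MvPolynomial.pderiv k).toLinearMap).comp (uP a hd hlam ha))

lemma sq_le_aux {x y c : ℝ} (hc : 0 ≤ c) (hy : 0 ≤ y) (h : x ^ 2 ≤ c ^ 2 * y ^ 2) : x ≤ c * y := by
  rw [← mul_pow] at h
  exact le_of_abs_le (abs_le_of_sq_le_sq h (by positivity))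

lemma S0_norm (p : MvPolynomial (Fin d) ℝ) : ‖S0 e hd hlam ha p‖ ≤ 4 * lam⁻¹ * ‖iota e p‖ := by
  refine sq_le_aux (by positivity) (norm_nonneg _) ?_
  have := poincare e hd hlam ha (pf_smooth e (uP a hd hlam ha p)) (fun x hx => uP_sphere e hd hlam ha p hx)
  rw [Lop_uP] at this
  rw [S0, LinearMap.comp_apply, iota_norm_sq, iota_norm_sq]
  exact this

lemma T0_norm (j k : Fin d) (p : MvPolynomial (Fin d) ℝ) :
    ‖T0 e hd hlam ha j k p‖ ≤ lam⁻¹ * ‖iota e p‖ := by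
  refine sq_le_aux (by positivity) (norm_nonneg _) ?_
  have := mt_comp e a hlam ha (pf_smooth e (solP a hd hlam ha p)) j k
  rw [← pf_uP e hd hlam ha p, Lop_uP, DD_pf, DD_pf] at this
  rw [T0, LinearMap.comp_apply, iota_norm_sq, iota_norm_sq]
  exact this

/-- solution operator -/
noncomputable def Sop : Lp ℝ 2 (muB d) →L[ℝ] Lp ℝ 2 (muB d) :=
  (S0 e hd hlam ha).extendOfNorm (iota e)

/-- Hessian operator -/
noncomputable def Tjk (j k : Fin d) : Lp ℝ 2 (muB d) →L[ℝ] Lp ℝ 2 (muB d) :=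
  (T0 e hd hlam ha j k).extendOfNorm (iota e)

lemma Sop_iota (p : MvPolynomial (Fin d) ℝ) :
    Sop e hd hlam ha (iota e p) = iota e (uP a hd hlam ha p) :=
  LinearMap.extendOfNorm_eq (iota_dense e) ⟨_, S0_norm e hd hlam ha⟩ p

lemma Tjk_iota (j k : Fin d) (p : MvPolynomial (Fin d) ℝ) :
    Tjk e hd hlam ha j k (iota e p)
      = iota e (MvPolynomial.pderiv j (MvPolynomial.pderiv k (uP a hd hlam ha p))) :=
  LinearMap.extendOfNorm_eq (iota_dense e) ⟨_, T0_norm e hd hlam ha j k⟩ p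

lemma Tjk_norm (j k : Fin d) (f : Lp ℝ 2 (muB d)) : ‖Tjk e hd hlam ha j k f‖ ≤ lam⁻¹ * ‖f‖ :=
  LinearMap.norm_extendOfNorm_apply_le (iota_dense e) _ (T0_norm e hd hlam ha j k) f

lemma Sop_symm (f g : Lp ℝ 2 (muB d)) :
    ⟪Sop e hd hlam ha f, g⟫ = ⟪f, Sop e hd hlam ha g⟫ := by
  refine (iota_dense e).induction_on₂ (p := fun f g => ⟪Sop e hd hlam ha f, g⟫ = ⟪f, Sop e hd hlam ha g⟫)
    ?_ ?_ f g
  · exact isClosed_eq (by fun_prop) (by fun_prop)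
  · intro p q
    rw [Sop_iota, Sop_iota, iota_inner, iota_inner]
    have := Lop_symm e (a := a) (pf_smooth e (uP a hd hlam ha p)) (pf_smooth e (uP a hd hlam ha q))
      (fun x hx => uP_sphere e hd hlam ha p hx) (fun x hx => uP_sphere e hd hlam ha q hx)
    rwa [Lop_uP, Lop_uP] at this

lemma ibp2 {h u : Euc d → ℝ} (hh : ContDiff ℝ ∞ h) (hu : ContDiff ℝ ∞ u)
    (hh0 : ∀ x ∈ sphere (0 : Euc d) 1, h x = 0) (hu0 : ∀ x ∈ sphere (0 : Euc d) 1, u x = 0)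
    (v w : Euc d) :
    ∫ x in ball (0 : Euc d) 1, h x * DD v (DD w u) x
      = ∫ x in ball (0 : Euc d) 1, DD w (DD v h) x * u x := by
  rw [ibp (sm_one hh) (sm_one (DD_smooth hu _)) (fun x hx => by simp [hh0 x hx]),
      ibp (sm_one (DD_smooth hh _)) (sm_one hu) (fun x hx => by simp [hu0 x hx]), neg_neg]

lemma Tjk_dual (j k : Fin d) {h : Euc d → ℝ} (hh : ContDiff ℝ ∞ h)
    (hh0 : ∀ x ∈ sphere (0 : Euc d) 1, h x = 0) (f : Lp ℝ 2 (muB d)) :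
    ⟪(cont_memLp hh.continuous 2).toLp h, Tjk e hd hlam ha j k f⟫
      = ⟪Sop e hd hlam ha ((cont_memLp (DD_smooth (DD_smooth hh (e j)) (e k)).continuous 2).toLp _), f⟫ := by
  rw [Sop_symm]
  refine (iota_dense e).induction_on (p := fun f =>
    ⟪(cont_memLp hh.continuous 2).toLp h, Tjk e hd hlam ha j k f⟫
      = ⟪((cont_memLp (DD_smooth (DD_smooth hh (e j)) (e k)).continuous 2).toLp _),
        Sop e hd hlam ha f⟫) f (isClosed_eq (by fun_prop) (by fun_prop)) ?_
  intro p
  rw [Sop_iota, Tjk_iota]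
  have := ibp2 hh (pf_smooth e (uP a hd hlam ha p)) hh0 (fun x hx => uP_sphere e hd hlam ha p hx)
    (e j) (e k)
  rw [DD_pf, DD_pf] at this
  have e1 := toLp_inner (cont_memLp hh.continuous 2) (pf_memLp e
    (MvPolynomial.pderiv j (MvPolynomial.pderiv k (uP a hd hlam ha p))) 2)
  have e2 := toLp_inner (cont_memLp (DD_smooth (DD_smooth hh (e j)) (e k)).continuous 2)
    (pf_memLp e (uP a hd hlam ha p) 2)
  exact e1.trans (this.trans e2.symm)

lemma Sop_bound (j k : Fin d) {h : Euc d → ℝ} (hh : ContDiff ℝ ∞ h)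
    (hh0 : ∀ x ∈ sphere (0 : Euc d) 1, h x = 0) :
    ‖Sop e hd hlam ha ((cont_memLp (DD_smooth (DD_smooth hh (e j)) (e k)).continuous 2).toLp _)‖
      ≤ lam⁻¹ * ‖(cont_memLp hh.continuous 2).toLp h‖ := by
  set w := Sop e hd hlam ha ((cont_memLp (DD_smooth (DD_smooth hh (e j)) (e k)).continuous 2).toLp _)
  have h1 := Tjk_dual e hd hlam ha j k hh hh0 w
  have h2 : ‖w‖ ^ 2 ≤ ‖(cont_memLp hh.continuous 2).toLp h‖ * (lam⁻¹ * ‖w‖) := by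
    rw [← real_inner_self_eq_norm_sq, ← h1]
    refine (real_inner_le_norm _ _).trans ?_
    gcongr
    exact Tjk_norm e hd hlam ha j k w
  rcases (norm_nonneg w).eq_or_lt with h | h
  · rw [← h]; positivity
  · nlinarith

lemma Lp_int (b : Lp ℝ 2 (muB d)) : Integrable b (muB d) :=
  (Lp.memLp b).integrable (by norm_num)

lemma DD_local {U : Set (Euc d)} (hU : IsOpen U) {h : Euc d → ℝ} (h0 : ∀ x ∈ U, h x = 0) (v : Euc d) :
    ∀ x ∈ U, DD v h x = 0 := by
  intro x hx
  have : h =ᶠ[𝓝 x] fun _ => (0 : ℝ) := by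
    filter_upwards [hU.mem_nhds hx] with y hy using h0 y hy
  rw [DD, this.fderiv_eq]; simp

/-- the main duality estimate -/
lemma pairing (ha' : ∀ k, a k ≤ Lam) (hL : 0 < Lam) (j k : Fin d) {h : Euc d → ℝ} (hh : ContDiff ℝ ∞ h)
    (hh0 : ∀ x ∈ sphere (0 : Euc d) 1, h x = 0)
    {y : Euc d} (hy : y ∈ ball (0 : Euc d) 1) {τ R : ℝ} (hτ : 0 < τ) (hτ8 : τ ≤ 1 / 8)
    (hR : 0 < R) (hR4 : R ≤ 4) (hhR : ∀ x ∈ ball y R, h x = 0)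
    (b : Lp ℝ 2 (muB d)) (hb : ∀ᵐ x ∂muB d, x ∉ ball y (τ ^ 2 * R) → b x = 0)
    (hb0 : ∫ x, b x ∂muB d = 0) :
    ⟪(cont_memLp hh.continuous 2).toLp h, Tjk e hd hlam ha j k b⟫
      ≤ (∫ x, |b x| ∂muB d) * (CH d lam Lam * (τ * √(4 / cmin d lam *
      (((R / (2 * √Lam))⁻¹) ^ d * (lam⁻¹ * ‖(cont_memLp hh.continuous 2).toLp h‖) ^ 2)))) := by
  have hψ := (DD_smooth (DD_smooth hh (e j)) (e k)).continuous
  have hψ0 : ∀ x ∈ ball y R, DD (e k) (DD (e j) h) x = 0 :=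
    DD_local isOpen_ball (DD_local isOpen_ball hhR _) _
  rw [Tjk_dual e hd hlam ha j k hh hh0 b]
  set ψ := DD (e k) (DD (e j) h) with hψd
  have hSb : ‖Sop e hd hlam ha ((cont_memLp hψ 2).toLp ψ)‖
      ≤ lam⁻¹ * ‖(cont_memLp hh.continuous 2).toLp h‖ := Sop_bound e hd hlam ha j k hh hh0
  obtain ⟨Cψ, hCψ0, hCψ⟩ := cont_bdd hψ
  let ε : ℕ → ℝ := fun n => 1 / ((n : ℝ) + 1)
  have hε : ∀ n, 0 < ε n := fun n => by positivity
  have hε1 : ∀ n, ε n ≤ 1 := fun n => by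
    show 1 / ((n : ℝ) + 1) ≤ 1
    rw [div_le_one (by positivity)]; linarith [(Nat.cast_nonneg n : (0 : ℝ) ≤ n)]
  have hε0 : Tendsto ε atTop (𝓝 0) := tendsto_one_div_add_atTop_nhds_zero_nat
  choose P hP using fun n => pf_dense e hψ (hε n)
  set M := (Cψ + 1) / lam with hM
  -- convergence
  have hc1 : Tendsto (fun n => iota e (P n)) atTop (𝓝 ((cont_memLp hψ 2).toLp ψ)) := by
    rw [tendsto_iff_norm_sub_tendsto_zero]
    have hbd : ∀ n, ‖iota e (P n) - (cont_memLp hψ 2).toLp ψ‖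
        ≤ ε n * √((muB d).real Set.univ) := by
      intro n
      refine sq_le_aux (hε n).le (Real.sqrt_nonneg _) ?_
      rw [Real.sq_sqrt (by positivity), Lp_norm_sq]
      have : ∀ᵐ x ∂muB d, (iota e (P n) - (cont_memLp hψ 2).toLp ψ : Lp ℝ 2 (muB d)) x ^ 2 ≤ ε n ^ 2 := by
        filter_upwards [Lp.coeFn_sub (iota e (P n)) ((cont_memLp hψ 2).toLp ψ), iota_coe e (P n),
          (cont_memLp hψ 2).coeFn_toLp, ae_ball (fun x hx => hP n x (ball_subset_closedBall hx))]
          with x h1 h2 h3 h4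
        rw [h1, Pi.sub_apply, h2, h3, ← sq_abs]
        exact pow_le_pow_left₀ (abs_nonneg _) h4.le 2
      calc _ ≤ ∫ x, ε n ^ 2 ∂muB d := integral_mono_ae (Lp.memLp _).integrable_sq
            (integrable_const _) this
        _ = _ := by rw [integral_const, smul_eq_mul, mul_comm]
    refine squeeze_zero (fun _ => norm_nonneg _) hbd ?_
    simpa using hε0.mul_const _
  have hc2 : Tendsto (fun n => iota e (uP a hd hlam ha (P n))) atTop
      (𝓝 (Sop e hd hlam ha ((cont_memLp hψ 2).toLp ψ))) := by
    have := ((Sop e hd hlam ha).continuous.tendsto _).comp hc1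
    refine this.congr fun n => ?_
    simp [Sop_iota]
  -- the estimates
  have hest : ∀ n, ⟪iota e (uP a hd hlam ha (P n)), b⟫ ≤ (∫ x, |b x| ∂muB d) *
      (CH d lam Lam * (τ * √(4 / cmin d lam *
      (((R / (2 * √Lam))⁻¹) ^ d * ‖iota e (uP a hd hlam ha (P n))‖ ^ 2)
        + ε n * M / 2 * (R / (2 * √Lam)) ^ 2) + ε n)) := by
    intro n
    set v := pf e (uP a hd hlam ha (P n)) with hv
    have hvs : ContDiff ℝ ∞ v := pf_smooth e _
    have hvb : ∀ x ∈ closedBall (0 : Euc d) 1, |v x| ≤ M :=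
      sup_bound e a hd hlam ha hvs (fun x hx => uP_sphere e hd hlam ha (P n) hx) (by positivity)
        (fun x hx => by
          rw [hv, Lop_uP]
          have h1 := hP n x (ball_subset_closedBall hx)
          have h2 := hCψ x (ball_subset_closedBall hx)
          have h3 := abs_sub_abs_le_abs_sub (pf e (P n) x) (ψ x)
          linarith [hε1 n])
    have hosc : ∀ x ∈ ball (0 : Euc d) 1, x ∈ ball y (τ ^ 2 * R) → |v x - v y| ≤ _ := fun x hx hxy =>
      holder_main e hlam ha ha' hL hvs (fun x hx => uP_sphere e hd hlam ha (P n) hx) hy hτ hτ8 hR hR4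
        (hε n) (show 0 ≤ M by positivity)
        (fun z hz hzy => by
          rw [hv, Lop_uP]
          have h1 := hP n z (ball_subset_closedBall hz)
          rw [hψ0 z hzy, sub_zero] at h1
          exact h1.le)
        (fun z hz => hvb z (ball_subset_closedBall hz)) hx hy hxy (mem_ball_self (by positivity))
    rw [iota_norm_sq]
    rw [← hv]
    set Q := CH d lam Lam * (τ * √(4 / cmin d lam *
      (((R / (2 * √Lam))⁻¹) ^ d * ∫ x in ball (0 : Euc d) 1, v x ^ 2)
        + ε n * M / 2 * (R / (2 * √Lam)) ^ 2) + ε n)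
    have hQ : 0 ≤ Q := (abs_nonneg _).trans (hosc y hy (mem_ball_self (by positivity)))
    have i1 : Integrable (fun x => iota e (uP a hd hlam ha (P n)) x * b x) (muB d) :=
      (Lp.memLp b).integrable_mul (Lp.memLp (iota e (uP a hd hlam ha (P n)))) |>.congr
        (Eventually.of_forall fun x => mul_comm _ _)
    calc ⟪iota e (uP a hd hlam ha (P n)), b⟫
        = (∫ x, iota e (uP a hd hlam ha (P n)) x * b x ∂muB d) - ∫ x, v y * b x ∂muB d := by
          rw [Lp_inner, integral_const_mul, hb0]; ring
      _ = ∫ x, (iota e (uP a hd hlam ha (P n)) x * b x - v y * b x) ∂muB d := by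
          rw [integral_sub i1 ((Lp_int b).const_mul _)]
      _ ≤ ∫ x, |b x| * Q ∂muB d := by
          refine integral_mono_ae (i1.sub ((Lp_int b).const_mul _)) ((Lp_int b).abs.mul_const _) ?_
          filter_upwards [hb, iota_coe e (uP a hd hlam ha (P n)), ae_ball hosc] with x h1 h2 h3
          show iota e (uP a hd hlam ha (P n)) x * b x - v y * b x ≤ |b x| * Q
          rw [h2, ← hv, ← sub_mul]
          by_cases hx : x ∈ ball y (τ ^ 2 * R)
          · refine (le_abs_self _).trans ?_
            rw [abs_mul, mul_comm]
            exact mul_le_mul_of_nonneg_left (h3 hx) (abs_nonneg _)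
          · rw [h1 hx]; simp
      _ = _ := by rw [integral_mul_const]
  have hlim1 : Tendsto (fun n => ⟪iota e (uP a hd hlam ha (P n)), b⟫) atTop
      (𝓝 ⟪Sop e hd hlam ha ((cont_memLp hψ 2).toLp ψ), b⟫) := hc2.inner tendsto_const_nhds
  have hlim2 : Tendsto (fun n => (∫ x, |b x| ∂muB d) *
      (CH d lam Lam * (τ * √(4 / cmin d lam *
      (((R / (2 * √Lam))⁻¹) ^ d * ‖iota e (uP a hd hlam ha (P n))‖ ^ 2)
        + ε n * M / 2 * (R / (2 * √Lam)) ^ 2) + ε n))) atTop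
      (𝓝 ((∫ x, |b x| ∂muB d) *
      (CH d lam Lam * (τ * √(4 / cmin d lam *
      (((R / (2 * √Lam))⁻¹) ^ d * ‖Sop e hd hlam ha ((cont_memLp hψ 2).toLp ψ)‖ ^ 2)
        + 0 * M / 2 * (R / (2 * √Lam)) ^ 2) + 0)))) := by
    refine Tendsto.const_mul _ (Tendsto.const_mul _ (Tendsto.add (Tendsto.const_mul _
      ((Real.continuous_sqrt.tendsto _).comp (Tendsto.add ?_ ?_))) hε0))
    · exact ((hc2.norm.pow 2).const_mul _).const_mul _
    · exact ((hε0.mul_const _).div_const _).mul_const _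
  refine (le_of_tendsto_of_tendsto' hlim1 hlim2 hest).trans ?_
  have hCH := CH_pos (d := d) hlam hL
  have hcm := cmin_pos (d := d) hlam
  simp only [zero_mul, zero_div, add_zero]
  gcongr

end opT2


section hor
variable {d : ℕ} (e : OrthonormalBasis (Fin d) ℝ (Euc d)) {a : Fin d → ℝ} {lam Lam : ℝ}

lemma toLp_norm_sq {μ : Measure (Euc d)} {f : Euc d → ℝ} (hf : MemLp f 2 μ) :
    ‖hf.toLp f‖ ^ 2 = ∫ x, f x ^ 2 ∂μ := by
  rw [← real_inner_self_eq_norm_sq, toLp_inner]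
  simp only [sq]

lemma toLp_norm {μ : Measure (Euc d)} {f : Euc d → ℝ} (hf : MemLp f 2 μ) :
    ‖hf.toLp f‖ = √(∫ x, f x ^ 2 ∂μ) := by
  rw [← toLp_norm_sq, Real.sqrt_sq (norm_nonneg _)]

lemma cs1 {μ : Measure (Euc d)} [IsFiniteMeasure μ] {G : Euc d → ℝ} (hG : MemLp G 2 μ) :
    ∫ x, |G x| ∂μ ≤ √(μ.real Set.univ) * √(∫ x, G x ^ 2 ∂μ) := by
  have h1 : MemLp (fun x => |G x|) 2 μ := hG.abs
  have h2 : MemLp (fun _ : Euc d => (1 : ℝ)) 2 μ := memLp_const 1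
  have h := real_inner_le_norm (h2.toLp _) (h1.toLp _)
  rw [toLp_inner, toLp_norm, toLp_norm] at h
  simpa using h

/-- smooth functions with compact support in `U`, inside `L²(U)` -/
noncomputable def Wsub (U : Set (Euc d)) : Submodule ℝ (Lp ℝ 2 (volume.restrict U)) where
  carrier := {f | ∃ h : Euc d → ℝ, ContDiff ℝ ∞ h ∧ HasCompactSupport h ∧ tsupport h ⊆ U ∧
    f =ᵐ[volume.restrict U] h}
  add_mem' := by
    rintro f g ⟨h, h1, h2, h3, h4⟩ ⟨h', h1', h2', h3', h4'⟩
    refine ⟨h + h', h1.add h1', h2.add h2', ?_, ?_⟩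
    · exact (tsupport_add h h').trans (Set.union_subset h3 h3')
    · exact (Lp.coeFn_add f g).trans (h4.add h4')
  zero_mem' := ⟨0, contDiff_const, HasCompactSupport.zero, by simp [tsupport], Lp.coeFn_zero _ _ _⟩
  smul_mem' := by
    rintro c f ⟨h, h1, h2, h3, h4⟩
    refine ⟨c • h, contDiff_const.smul h1, h2.smul_left (f := fun _ => c), ?_, ?_⟩
    · exact (tsupport_smul_subset_right (fun _ => c) h).trans h3
    · exact (Lp.coeFn_smul c f).trans (h4.const_smul c)

lemma Wsub_dense {U : Set (Euc d)} (hU : IsOpen U) (hUf : volume U ≠ ⊤) :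
    (Wsub U).topologicalClosure = ⊤ := by
  have : IsFiniteMeasure (volume.restrict U) := ⟨by
    rw [Measure.restrict_apply_univ]; exact hUf.lt_top⟩
  rw [Submodule.topologicalClosure_eq_top_iff, Submodule.eq_bot_iff]
  intro f hf
  rw [Submodule.mem_orthogonal] at hf
  have hfi : IntegrableOn f U volume := (Lp.memLp f).integrable (by norm_num)
  have hz := hU.ae_eq_zero_of_integral_contDiff_smul_eq_zero (f := f) (μ := volume)
    (hfi.locallyIntegrableOn) (by
      intro g g1 g2 g3
      have gm : MemLp g 2 (volume.restrict U) :=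
        (g1.continuous.memLp_of_hasCompactSupport (p := 2) (μ := volume) g2).restrict U
      have h1 := hf (gm.toLp g) ⟨g, g1, g2, g3, gm.coeFn_toLp⟩
      rw [Lp_inner] at h1
      have h2 : ∫ x, g x • f x = ∫ x in U, g x • f x := by
        rw [setIntegral_eq_integral_of_forall_compl_eq_zero]
        intro x hx
        rw [image_eq_zero_of_notMem_tsupport (fun h => hx (g3 h)), zero_smul]
      rw [h2, ← h1]
      refine integral_congr_ae ?_
      filter_upwards [gm.coeFn_toLp] with x hx
      rw [hx, smul_eq_mul])
  rw [Lp.eq_zero_iff_ae_eq_zero]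
  exact (ae_restrict_iff' hU.measurableSet).2 hz

lemma dual_L2 {U : Set (Euc d)} (hU : IsOpen U) (hUf : volume U ≠ ⊤) {G : Euc d → ℝ}
    (hG : MemLp G 2 (volume.restrict U)) {K : ℝ} (hK : 0 ≤ K)
    (h : ∀ h : Euc d → ℝ, ContDiff ℝ ∞ h → tsupport h ⊆ U →
      ∫ x in U, h x * G x ≤ K * √(∫ x in U, h x ^ 2)) :
    √(∫ x in U, G x ^ 2) ≤ K := by
  have hd := Wsub_dense hU hUf
  have key : ∀ f : Lp ℝ 2 (volume.restrict U), ⟪f, hG.toLp G⟫ ≤ K * ‖f‖ := by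
    intro f
    have hf : f ∈ closure (Wsub U : Set (Lp ℝ 2 (volume.restrict U))) := by
      rw [← Submodule.topologicalClosure_coe, hd]; trivial
    refine closure_minimal (s := (Wsub U : Set (Lp ℝ 2 (volume.restrict U))))
      (t := {f | ⟪f, hG.toLp G⟫ ≤ K * ‖f‖}) ?_ (isClosed_le (by fun_prop) (by fun_prop)) hf
    rintro w ⟨g, g1, g2, g3, g4⟩
    have gm : MemLp g 2 (volume.restrict U) :=
      (g1.continuous.memLp_of_hasCompactSupport (p := 2) (μ := volume) g2).restrict U
    have : w = gm.toLp g := by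
      apply Lp.ext; exact g4.trans gm.coeFn_toLp.symm
    show ⟪w, hG.toLp G⟫ ≤ K * ‖w‖
    rw [this, toLp_inner, toLp_norm]
    exact h g g1 g3
  have := key (hG.toLp G)
  rw [real_inner_self_eq_norm_sq] at this
  rw [← toLp_norm hG]
  rcases (norm_nonneg (hG.toLp G)).eq_or_lt with h | h
  · rw [← h]; exact hK
  · nlinarith

variable (hd : 0 < d) (hlam : 0 < lam) (ha : ∀ k, lam ≤ a k)

lemma restrict_sub {U : Set (Euc d)} (hU : U ⊆ ball (0 : Euc d) 1) :
    (volume : Measure (Euc d)).restrict U ≤ muB d := Measure.restrict_mono_set _ hU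

lemma hor_L2 (ha' : ∀ k, a k ≤ Lam) (hL : 0 < Lam) (j k : Fin d)
    {y : Euc d} (hy : y ∈ ball (0 : Euc d) 1) {τ R : ℝ} (hτ : 0 < τ) (hτ8 : τ ≤ 1 / 8)
    (hR : 0 < R) (hR4 : R ≤ 4)
    (b : Lp ℝ 2 (muB d)) (hb : ∀ᵐ x ∂muB d, x ∉ ball y (τ ^ 2 * R) → b x = 0)
    (hb0 : ∫ x, b x ∂muB d = 0) :
    √(∫ x in ball (0 : Euc d) 1 \ closedBall y R, (Tjk e hd hlam ha j k b x) ^ 2)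
      ≤ (∫ x, |b x| ∂muB d) * (CH d lam Lam * (τ * (√(4 / cmin d lam *
      (((R / (2 * √Lam))⁻¹) ^ d)) * lam⁻¹))) := by
  have hU : IsOpen (ball (0 : Euc d) 1 \ closedBall y R) := isOpen_ball.sdiff isClosed_closedBall
  have hUB : ball (0 : Euc d) 1 \ closedBall y R ⊆ ball (0 : Euc d) 1 := Set.diff_subset
  set U := ball (0 : Euc d) 1 \ closedBall y R with hUd
  have hUf : volume U ≠ ⊤ := ((measure_mono hUB).trans_lt measure_ball_lt_top).ne
  have hCH := CH_pos (d := d) hlam hL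
  have hcm := cmin_pos (d := d) hlam
  refine dual_L2 hU hUf ((Lp.memLp (Tjk e hd hlam ha j k b)).mono_measure (restrict_sub hUB))
    (mul_nonneg (integral_nonneg fun _ => abs_nonneg _) (by positivity)) ?_
  intro h hh hs
  have hz : ∀ x, x ∉ U → h x = 0 := fun x hx => image_eq_zero_of_notMem_tsupport fun h => hx (hs h)
  have hp := pairing e hd hlam ha ha' hL j k hh
    (fun x hx => hz x fun hxU => by
      have h1 := mem_ball.1 (hUB hxU); have h2 := mem_sphere.1 hx; linarith) hy hτ hτ8 hR hR4
    (fun x hx => hz x fun hxU => hxU.2 (ball_subset_closedBall hx)) b hb hb0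
  have e0 : ∀ F : Euc d → ℝ, (∀ x, x ∉ U → F x = 0) →
      ∫ x in U, F x = ∫ x in ball (0 : Euc d) 1, F x := by
    intro F hF
    rw [setIntegral_eq_integral_of_forall_compl_eq_zero (s := U) hF,
      setIntegral_eq_integral_of_forall_compl_eq_zero (s := ball (0 : Euc d) 1)
        (fun x hx => hF x fun h => hx (hUB h))]
  have e1 : ⟪(cont_memLp hh.continuous 2).toLp h, Tjk e hd hlam ha j k b⟫
      = ∫ x in U, h x * Tjk e hd hlam ha j k b x := by
    rw [e0 _ (fun x hx => by rw [hz x hx, zero_mul]), Lp_inner]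
    refine integral_congr_ae ?_
    filter_upwards [(cont_memLp hh.continuous 2).coeFn_toLp] with x hx
    rw [hx]
  rw [← e1, e0 _ (fun x hx => by rw [hz x hx]; simp)]
  refine hp.trans (le_of_eq ?_)
  rw [toLp_norm]
  set N := √(∫ x in ball (0 : Euc d) 1, h x ^ 2)
  have hN : 0 ≤ N := Real.sqrt_nonneg _
  rw [← mul_assoc (4 / cmin d lam), Real.sqrt_mul (by positivity), Real.sqrt_sq (by positivity)]
  ring

/-- Hoermander constant -/
noncomputable def Chor (d : ℕ) (lam Lam : ℝ) : ℝ :=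
  CH d lam Lam * lam⁻¹ * √(4 / cmin d lam * (4 * √Lam) ^ d * (volume : Measure (Euc d)).real (ball 0 1)) / 8
    * (1 - (√2)⁻¹)⁻¹

lemma q_lt : (√2 : ℝ)⁻¹ < 1 := inv_lt_one_of_one_lt₀ (by
  rw [Real.lt_sqrt (by norm_num)]; norm_num)

lemma Chor_nonneg (hlam : 0 < lam) (hL : 0 < Lam) : 0 ≤ Chor d lam Lam := by
  have hCH := CH_pos (d := d) hlam hL
  have : 0 < 1 - (√2 : ℝ)⁻¹ := by linarith [q_lt]
  unfold Chor; positivity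

lemma annulus (ha' : ∀ k, a k ≤ Lam) (hL : 0 < Lam) (j k : Fin d)
    {y : Euc d} (hy : y ∈ ball (0 : Euc d) 1) {τ R : ℝ} (hτ : 0 < τ) (hτ8 : τ ≤ 1 / 8)
    (hR : 0 < R)
    (b : Lp ℝ 2 (muB d)) (hb : ∀ᵐ x ∂muB d, x ∉ ball y (τ ^ 2 * R) → b x = 0)
    (hb0 : ∫ x, b x ∂muB d = 0) :
    ∫⁻ x in (ball (0 : Euc d) 1 \ closedBall y R) ∩ closedBall y (2 * R), ‖Tjk e hd hlam ha j k b x‖ₑ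
      ≤ ENNReal.ofReal ((∫ x, |b x| ∂muB d) * (CH d lam Lam * lam⁻¹ *
        √(4 / cmin d lam * (4 * √Lam) ^ d * (volume : Measure (Euc d)).real (ball 0 1)) * τ)) := by
  have hsL : 0 < √Lam := Real.sqrt_pos.2 hL
  by_cases hR4 : R ≤ 4
  swap
  · have : (ball (0 : Euc d) 1 \ closedBall y R) ∩ closedBall y (2 * R) = ∅ := by
      ext x
      simp only [Set.mem_inter_iff, Set.mem_diff, mem_closedBall, Set.mem_empty_iff_false, iff_false]
      rintro ⟨⟨h1, h2⟩, -⟩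
      have := dist_triangle_right x y 0
      rw [mem_ball] at h1 hy
      linarith
    rw [this]; simp
  have hUB : ball (0 : Euc d) 1 \ closedBall y R ⊆ ball (0 : Euc d) 1 := Set.diff_subset
  have hAU : (ball (0 : Euc d) 1 \ closedBall y R) ∩ closedBall y (2 * R)
    ⊆ ball (0 : Euc d) 1 \ closedBall y R := Set.inter_subset_left
  have h2 := hor_L2 e hd hlam ha ha' hL j k hy hτ hτ8 hR hR4 b hb hb0
  set U := ball (0 : Euc d) 1 \ closedBall y R
  set A := U ∩ closedBall y (2 * R) with hA
  set G := Tjk e hd hlam ha j k b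
  have hAf : volume A < ⊤ := (measure_mono (hAU.trans hUB)).trans_lt measure_ball_lt_top
  have : IsFiniteMeasure (volume.restrict A) := ⟨by rwa [Measure.restrict_apply_univ]⟩
  have hGA : MemLp G 2 (volume.restrict A) :=
    (Lp.memLp G).mono_measure (restrict_sub (hAU.trans hUB))
  have hGi : Integrable G (volume.restrict A) := hGA.integrable (by norm_num)
  have hGU : MemLp G 2 (volume.restrict U) := (Lp.memLp G).mono_measure (restrict_sub hUB)
  have e1 : ∫⁻ x in A, ‖G x‖ₑ = ENNReal.ofReal (∫ x in A, |G x|) := by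
    rw [ofReal_integral_eq_lintegral_ofReal hGi.abs (Eventually.of_forall fun _ => abs_nonneg _)]
    refine lintegral_congr fun x => ?_
    rw [Real.enorm_eq_ofReal_abs]
  rw [e1]
  refine ENNReal.ofReal_le_ofReal ((cs1 hGA).trans ?_)
  have hvol : (volume.restrict A).real Set.univ
      ≤ (2 * R) ^ d * (volume : Measure (Euc d)).real (ball 0 1) := by
    rw [measureReal_restrict_apply_univ]
    calc (volume : Measure (Euc d)).real A ≤ (volume : Measure (Euc d)).real (closedBall y (2 * R)) :=
          measureReal_mono Set.inter_subset_right (measure_closedBall_lt_top.ne)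
      _ = _ := by
          rw [measureReal_def, Measure.addHaar_closedBall _ _ (by positivity), ENNReal.toReal_mul,
            ENNReal.toReal_ofReal (by positivity)]
          have : Module.finrank ℝ (Euc d) = d := by simp [Euc]
          rw [this, measureReal_def]
  have hmono : √(∫ x in A, G x ^ 2) ≤ √(∫ x in U, G x ^ 2) :=
    Real.sqrt_le_sqrt (setIntegral_mono_set hGU.integrable_sq
      (Eventually.of_forall fun _ => sq_nonneg _) (HasSubset.Subset.eventuallyLE hAU))
  have hcm := cmin_pos (d := d) hlam
  have hCH := CH_pos (d := d) hlam hL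
  calc √((volume.restrict A).real Set.univ) * √(∫ x in A, G x ^ 2)
      ≤ √((2 * R) ^ d * (volume : Measure (Euc d)).real (ball 0 1)) *
        ((∫ x, |b x| ∂muB d) * (CH d lam Lam * (τ * (√(4 / cmin d lam *
      (((R / (2 * √Lam))⁻¹) ^ d)) * lam⁻¹)))) := by
        gcongr
        exact hmono.trans h2
    _ = (∫ x, |b x| ∂muB d) * (CH d lam Lam * lam⁻¹ *
        (√((2 * R) ^ d * (volume : Measure (Euc d)).real (ball 0 1)) * √(4 / cmin d lam *
      (((R / (2 * √Lam))⁻¹) ^ d))) * τ) := by ring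
    _ = _ := by
        rw [← Real.sqrt_mul (by positivity)]
        have h1 : (2 * R) ^ d * ((R / (2 * √Lam))⁻¹) ^ d = (4 * √Lam) ^ d := by
          rw [← mul_pow]; congr 1; field_simp; norm_num
        have hh : (2 * R) ^ d * (volume : Measure (Euc d)).real (ball 0 1) * (4 / cmin d lam *
            (((R / (2 * √Lam))⁻¹) ^ d)) = 4 / cmin d lam * (4 * √Lam) ^ d *
            (volume : Measure (Euc d)).real (ball 0 1) := by
          rw [← h1]; ring
        rw [hh]

/-- Hoermander estimate -/
lemma hormander (ha' : ∀ k, a k ≤ Lam) (hL : 0 < Lam) (j k : Fin d)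
    {y : Euc d} (hy : y ∈ ball (0 : Euc d) 1) {ρ : ℝ} (hρ : 0 < ρ)
    (b : Lp ℝ 2 (muB d)) (hb : ∀ᵐ x ∂muB d, x ∉ ball y ρ → b x = 0)
    (hb0 : ∫ x, b x ∂muB d = 0) :
    ∫⁻ x in ball (0 : Euc d) 1 \ closedBall y (64 * ρ), ‖Tjk e hd hlam ha j k b x‖ₑ
      ≤ ENNReal.ofReal (Chor d lam Lam * ∫ x, |b x| ∂muB d) := by
  set q : ℝ := (√2)⁻¹ with hq
  have hq0 : 0 < q := by positivity
  have hq1 : q < 1 := q_lt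
  have hq2 : q ^ 2 = 1 / 2 := by rw [hq, inv_pow, Real.sq_sqrt (by norm_num)]; norm_num
  have hsub : ball (0 : Euc d) 1 \ closedBall y (64 * ρ) ⊆ ⋃ i : ℕ,
      (ball (0 : Euc d) 1 \ closedBall y (64 * ρ * 2 ^ i)) ∩ closedBall y (2 * (64 * ρ * 2 ^ i)) := by
    rintro x ⟨hx1, hx2⟩
    rw [mem_closedBall, not_le] at hx2
    have hex : ∃ n : ℕ, dist x y ≤ 64 * ρ * 2 ^ n := by
      obtain ⟨n, hn⟩ := pow_unbounded_of_one_lt (dist x y / (64 * ρ)) (one_lt_two)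
      refine ⟨n, ?_⟩
      rw [div_lt_iff₀ (by positivity)] at hn
      linarith
    classical
    have hm := Nat.find_spec hex
    have hmin := fun m => Nat.find_min hex (m := m)
    set n := Nat.find hex
    have hn0 : n ≠ 0 := by
      intro h; rw [h] at hm; simp at hm; linarith
    obtain ⟨m, hnm⟩ := Nat.exists_eq_succ_of_ne_zero hn0
    rw [hnm] at hm
    refine Set.mem_iUnion.2 ⟨m, ⟨hx1, fun h => hmin m (by omega) (mem_closedBall.1 h)⟩, ?_⟩
    rw [mem_closedBall]
    calc dist x y ≤ _ := hm
      _ = _ := by rw [pow_succ]; ring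
  set D := (∫ x, |b x| ∂muB d) * (CH d lam Lam * lam⁻¹ *
        √(4 / cmin d lam * (4 * √Lam) ^ d * (volume : Measure (Euc d)).real (ball 0 1)) / 8) with hD
  have hCH := CH_pos (d := d) hlam hL
  have hD0 : 0 ≤ D := mul_nonneg (integral_nonneg fun _ => abs_nonneg _) (by positivity)
  calc ∫⁻ x in ball (0 : Euc d) 1 \ closedBall y (64 * ρ), ‖Tjk e hd hlam ha j k b x‖ₑ
      ≤ ∫⁻ x in ⋃ i : ℕ, (ball (0 : Euc d) 1 \ closedBall y (64 * ρ * 2 ^ i)) ∩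
        closedBall y (2 * (64 * ρ * 2 ^ i)), ‖Tjk e hd hlam ha j k b x‖ₑ := lintegral_mono_set hsub
    _ ≤ ∑' i : ℕ, ∫⁻ x in (ball (0 : Euc d) 1 \ closedBall y (64 * ρ * 2 ^ i)) ∩
        closedBall y (2 * (64 * ρ * 2 ^ i)), ‖Tjk e hd hlam ha j k b x‖ₑ := lintegral_iUnion_le _ _
    _ ≤ ∑' i : ℕ, ENNReal.ofReal (D * q ^ i) := by
        refine ENNReal.tsum_le_tsum fun i => ?_
        have hρi : (1 / 8 * q ^ i) ^ 2 * (64 * ρ * 2 ^ i) = ρ := by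
          have : (q ^ i) ^ 2 * 2 ^ i = 1 := by
            rw [← pow_mul, mul_comm i, pow_mul, hq2, ← mul_pow]; norm_num
          calc (1 / 8 * q ^ i) ^ 2 * (64 * ρ * 2 ^ i) = ρ * ((q ^ i) ^ 2 * 2 ^ i) := by ring
            _ = ρ := by rw [this, mul_one]
        have h := annulus e hd hlam ha ha' hL j k hy (τ := 1 / 8 * q ^ i) (R := 64 * ρ * 2 ^ i)
          (by positivity) (by
            have := pow_le_one₀ (n := i) hq0.le hq1.le
            linarith) (by positivity) b (by rw [hρi]; exact hb) hb0
        refine h.trans (ENNReal.ofReal_le_ofReal (le_of_eq ?_))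
        rw [hD]; ring
    _ = ENNReal.ofReal (∑' i : ℕ, D * q ^ i) :=
        (ENNReal.ofReal_tsum_of_nonneg (fun i => by positivity)
          ((summable_geometric_of_lt_one hq0.le hq1).mul_left D)).symm
    _ = _ := by
        rw [tsum_mul_left, tsum_geometric_of_lt_one hq0.le hq1, hD, Chor]
        congr 1; ring

end hor


section cz
variable {d : ℕ}

/-- volume of the unit ball -/
noncomputable abbrev VB (d : ℕ) : ℝ := (volume : Measure (Euc d)).real (ball 0 1)

lemma VB_pos : 0 < VB d := by
  rw [VB, measureReal_def]
  exact ENNReal.toReal_pos (measure_ball_pos _ _ one_pos).ne' measure_ball_lt_top.ne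

lemma vol_cball (x : Euc d) {r : ℝ} (hr : 0 ≤ r) :
    (volume : Measure (Euc d)).real (closedBall x r) = r ^ d * VB d := by
  rw [measureReal_def, Measure.addHaar_closedBall _ _ hr, ENNReal.toReal_mul,
    ENNReal.toReal_ofReal (by positivity)]
  have : Module.finrank ℝ (Euc d) = d := by simp [Euc]
  rw [this, VB, measureReal_def]

lemma vol_ball (x : Euc d) {r : ℝ} (hr : 0 < r) :
    (volume : Measure (Euc d)).real (ball x r) = r ^ d * VB d := by
  rw [measureReal_def, Measure.addHaar_ball_of_pos _ _ hr, ENNReal.toReal_mul,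
    ENNReal.toReal_ofReal (by positivity)]
  have : Module.finrank ℝ (Euc d) = d := by simp [Euc]
  rw [this, VB, measureReal_def]

lemma disj_fin {ι α : Type*} [MeasurableSpace α] [DecidableEq ι] (S : ι → Set α)
    (hS : ∀ i, MeasurableSet (S i)) (v : Finset ι) :
    ∃ E : ι → Set α, (∀ i, E i ⊆ S i) ∧ (∀ i, MeasurableSet (E i)) ∧
      ((v : Set ι).PairwiseDisjoint E) ∧ (⋃ i ∈ v, E i) = ⋃ i ∈ v, S i := by
  induction v using Finset.induction_on with
  | empty => exact ⟨S, fun i => le_rfl, hS, by simp, rfl⟩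
  | insert j v hj ih =>
    obtain ⟨E, h1, h2, h3, h4⟩ := ih
    have hm : MeasurableSet (⋃ i ∈ v, S i) := v.measurableSet_biUnion fun i _ => hS i
    refine ⟨Function.update E j (S j \ ⋃ i ∈ v, S i), ?_, ?_, ?_, ?_⟩
    · intro i
      by_cases hi : i = j
      · subst hi; simp [Set.diff_subset]
      · simpa [hi] using h1 i
    · intro i
      by_cases hi : i = j
      · subst hi; simpa using (hS i).diff hm
      · simpa [hi] using h2 i
    · have hne : ∀ i ∈ v, i ≠ j := fun i hi h => hj (h ▸ hi)
      rw [Finset.coe_insert, Set.pairwiseDisjoint_insert_of_notMem (by simpa using hj)]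
      constructor
      · intro i hi k hk hik
        have := h3 hi hk hik
        simpa [Function.onFun, hne i hi, hne k hk] using this
      · intro i hi
        rw [Function.update_self, Function.update_of_ne (hne i hi)]
        refine Set.disjoint_left.2 fun x hx hx' => hx.2 ?_
        exact Set.mem_biUnion hi (h1 i hx')
    · have hne : ∀ i ∈ v, i ≠ j := fun i hi h => hj (h ▸ hi)
      rw [Finset.set_biUnion_insert, Finset.set_biUnion_insert, Function.update_self]
      have : (⋃ i ∈ v, Function.update E j (S j \ ⋃ i ∈ v, S i) i) = ⋃ i ∈ v, E i :=
        Set.iUnion₂_congr fun i hi => by rw [Function.update_of_ne (hne i hi)]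
      rw [this, h4, Set.diff_union_self]

lemma leb {f : Euc d → ℝ} (hf : Integrable f (muB d)) (t : ℝ) :
    ∀ᵐ x ∂muB d, (∀ r > 0, ∫ y in closedBall x r, |f y| ∂muB d ≤ t * (r ^ d * VB d)) → |f x| ≤ t := by
  have hi : Integrable ((ball (0 : Euc d) 1).indicator fun y => |f y|) volume :=
    (integrable_indicator_iff measurableSet_ball).2 hf.abs
  have h := IsUnifLocDoublingMeasure.ae_tendsto_average (volume : Measure (Euc d))
    hi.locallyIntegrable 1
  have h' : ∀ᵐ x ∂muB d, _ := ae_restrict_of_ae (s := ball (0 : Euc d) 1) h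
  have hB : ∀ᵐ x ∂muB d, x ∈ ball (0 : Euc d) 1 := ae_restrict_mem measurableSet_ball
  filter_upwards [h', hB] with x hx hxB hr
  have ht := hx (l := 𝓝[>] (0 : ℝ)) (fun _ => x) id tendsto_id (by
    filter_upwards [self_mem_nhdsWithin] with j hj
    simp only [id, one_mul]
    exact mem_closedBall_self (le_of_lt hj))
  rw [Set.indicator_of_mem hxB] at ht
  refine le_of_tendsto ht ?_
  filter_upwards [self_mem_nhdsWithin] with r hr0
  have hr0 : 0 < r := hr0
  rw [setAverage_eq, id, vol_cball x hr0.le, smul_eq_mul, inv_mul_le_iff₀ (by have := VB_pos (d := d); positivity)]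
  have := hr r hr0
  rw [mul_comm t] at this
  refine le_of_eq_of_le ?_ this
  rw [setIntegral_indicator measurableSet_ball, Measure.restrict_restrict measurableSet_closedBall]

lemma vit {f : Euc d → ℝ} (hf : MemLp f 2 (muB d)) (hd : 0 < d) {t δ : ℝ} (ht : 0 < t) (hδ : 0 < δ)
    (hF : ∫ x, |f x| ∂muB d < t * VB d) :
    ∃ (v : Finset (Euc d)) (r : Euc d → ℝ),
      (∀ x ∈ v, x ∈ ball (0 : Euc d) 1 ∧ 0 < r x ∧ r x < 1 ∧
        t * (r x ^ d * VB d) < ∫ y in closedBall x (r x), |f y| ∂muB d ∧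
        ∫ y in closedBall x (5 * r x), |f y| ∂muB d ≤ t * ((5 * r x) ^ d * VB d)) ∧
      ((v : Set (Euc d)).PairwiseDisjoint fun x => closedBall x (r x)) ∧
      ∫ y in (⋃ x ∈ v, closedBall x (5 * r x))ᶜ, f y ^ 2 ∂muB d ≤ δ + t * ∫ x, |f x| ∂muB d := by
  have hfi : Integrable f (muB d) := hf.integrable (by norm_num)
  have hV := VB_pos (d := d)
  set S : Euc d → Set ℝ := fun x =>
    {r | 0 < r ∧ t * (r ^ d * VB d) < ∫ y in closedBall x r, |f y| ∂muB d} with hS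
  have hle : ∀ s : Set (Euc d), ∫ y in s, |f y| ∂muB d ≤ ∫ y, |f y| ∂muB d := fun s =>
    setIntegral_le_integral hfi.abs (Eventually.of_forall fun _ => abs_nonneg _)
  have hS1 : ∀ x, ∀ r ∈ S x, r < 1 := by
    rintro x r ⟨h0, h1⟩
    by_contra! hr
    have h2 : 1 ≤ r ^ d := one_le_pow₀ hr
    have h3 := hle (closedBall x r)
    nlinarith [mul_pos ht hV]
  set X : Set (Euc d) := {x | x ∈ ball (0 : Euc d) 1 ∧ (S x).Nonempty}
  have hch : ∀ x, ∃ r : ℝ, x ∈ X → r ∈ S x ∧ 5 * r ∉ S x := by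
    intro x
    by_cases hx : x ∈ X
    · have hb : BddAbove (S x) := ⟨1, fun r hr => (hS1 x r hr).le⟩
      obtain ⟨r0, hr0⟩ := hx.2
      have hs : 0 < sSup (S x) := hr0.1.trans_le (le_csSup hb hr0)
      obtain ⟨r, hr, hr2⟩ := exists_lt_of_lt_csSup hx.2 (show sSup (S x) / 2 < sSup (S x) by linarith)
      refine ⟨r, fun _ => ⟨hr, fun h5 => ?_⟩⟩
      have := le_csSup hb h5
      linarith
    · exact ⟨0, fun h => absurd h hx⟩
  choose r hr using hch
  obtain ⟨u, huX, hdis, hcov⟩ := Vitali.exists_disjoint_subfamily_covering_enlargement_closedBall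
    X id r 1 (fun x hx => (hS1 x _ (hr x hx).1).le) 5 (by norm_num)
  have hcount : u.Countable := hdis.countable_of_nonempty_interior fun x hx =>
    ⟨x, mem_interior_iff_mem_nhds.2 (closedBall_mem_nhds x (hr x (huX hx)).1.1)⟩
  have : Countable u := hcount.to_subtype
  -- the bad set
  set W : Set (Euc d) := ⋃ x : u, closedBall (x : Euc d) (5 * r x)
  have hWm : MeasurableSet W := MeasurableSet.iUnion fun x => measurableSet_closedBall
  have hsq : Integrable (fun y => f y ^ 2) (muB d) := hf.integrable_sq
  have hoff : ∫ y in Wᶜ, f y ^ 2 ∂muB d ≤ t * ∫ x, |f x| ∂muB d := by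
    have hB : ∀ᵐ x ∂muB d, x ∈ ball (0 : Euc d) 1 := ae_restrict_mem measurableSet_ball
    have h1 : ∀ᵐ y ∂muB d, y ∈ Wᶜ → f y ^ 2 ≤ t * |f y| := by
      filter_upwards [leb hfi t, hB] with y hy hyB hyW
      have : |f y| ≤ t := by
        refine hy fun ρ hρ => ?_
        by_contra! hcon
        have hyX : y ∈ X := ⟨hyB, ρ, hρ, hcon⟩
        obtain ⟨b, hb, hb'⟩ := hcov y hyX
        exact hyW (Set.mem_iUnion.2 ⟨⟨b, hb⟩, hb' (mem_closedBall_self (hr y hyX).1.1.le)⟩)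
      rw [← sq_abs]
      nlinarith [abs_nonneg (f y)]
    calc ∫ y in Wᶜ, f y ^ 2 ∂muB d ≤ ∫ y in Wᶜ, t * |f y| ∂muB d :=
          setIntegral_mono_on_ae hsq.integrableOn (hfi.abs.const_mul t).integrableOn hWm.compl h1
      _ = t * ∫ y in Wᶜ, |f y| ∂muB d := integral_const_mul _ _
      _ ≤ _ := mul_le_mul_of_nonneg_left (hle _) ht.le
  have htend := tendsto_setIntegral_of_monotone (μ := muB d) (f := fun y => f y ^ 2)
    (s := fun v : Finset u => ⋃ x ∈ v, closedBall (x : Euc d) (5 * r x))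
    (fun v => v.measurableSet_biUnion fun x _ => measurableSet_closedBall)
    (fun v w hvw => Set.biUnion_subset_biUnion_left hvw) hsq.integrableOn
  have hWeq : (⋃ v : Finset u, ⋃ x ∈ v, closedBall (x : Euc d) (5 * r x)) = W := by
    ext z
    simp only [Set.mem_iUnion, W]
    constructor
    · rintro ⟨v, x, hx, h⟩; exact ⟨x, h⟩
    · rintro ⟨x, h⟩; exact ⟨{x}, x, by simp, h⟩
  rw [hWeq] at htend
  obtain ⟨v, hv⟩ := (htend.eventually (lt_mem_nhds (sub_lt_self (∫ y in W, f y ^ 2 ∂muB d) hδ))).exists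
  classical
  refine ⟨v.map (Function.Embedding.subtype _), r, ?_, ?_, ?_⟩
  · intro x hx
    simp only [Finset.mem_map, Function.Embedding.coe_subtype] at hx
    obtain ⟨y, hy, rfl⟩ := hx
    have hyX := huX y.2
    obtain ⟨h1, h2⟩ := hr y hyX
    refine ⟨hyX.1, h1.1, hS1 _ _ h1, h1.2, ?_⟩
    by_contra! hcon
    exact h2 ⟨by linarith [h1.1], hcon⟩
  · refine hdis.subset ?_
    intro x hx
    simp only [Finset.coe_map, Function.Embedding.coe_subtype, Set.mem_image] at hx
    obtain ⟨y, hy, rfl⟩ := hx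
    exact y.2
  · have hU : (⋃ x ∈ v.map (Function.Embedding.subtype _), closedBall (x : Euc d) (5 * r x))
        = ⋃ x ∈ v, closedBall (x : Euc d) (5 * r x) := by
      ext z; simp
    rw [hU]
    have hm : MeasurableSet (⋃ x ∈ v, closedBall (x : Euc d) (5 * r x)) :=
      v.measurableSet_biUnion fun x _ => measurableSet_closedBall
    have h1 := integral_add_compl hm hsq
    have h2 := integral_add_compl hWm hsq
    linarith

end cz


section czmain
variable {d : ℕ}

lemma L2_cheb {G : Euc d → ℝ} (hG : MemLp G 2 (muB d)) {s : ℝ} (hs : 0 < s) :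
    muB d {x | s < |G x|} ≤ ENNReal.ofReal ((∫ x, G x ^ 2 ∂muB d) / s ^ 2) := by
  have hi : Integrable (fun x => G x ^ 2) (muB d) := hG.integrable_sq
  have h := mul_meas_ge_le_integral_of_nonneg (μ := muB d) (f := fun x => G x ^ 2)
    (Eventually.of_forall fun _ => sq_nonneg _) hi (s ^ 2)
  have hsub : {x | s < |G x|} ⊆ {x | s ^ 2 ≤ G x ^ 2} := fun x hx => by
    have hx : s < |G x| := hx
    show s ^ 2 ≤ G x ^ 2
    rw [← sq_abs (G x)]; gcongr
  refine (measure_mono hsub).trans ?_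
  rw [← ENNReal.ofReal_toReal (measure_ne_top (muB d) {x | s ^ 2 ≤ G x ^ 2})]
  refine ENNReal.ofReal_le_ofReal ?_
  rw [le_div_iff₀ (by positivity), mul_comm]
  exact h

lemma L1_cheb {G : Euc d → ℝ} (hG : AEStronglyMeasurable G (muB d)) (U : Set (Euc d)) {s K : ℝ} (hs : 0 < s)
    (h : ∫⁻ x in U, ‖G x‖ₑ ∂muB d ≤ ENNReal.ofReal K) :
    (muB d).restrict U {x | s < |G x|} ≤ ENNReal.ofReal (K / s) := by
  have h1 := mul_meas_ge_le_lintegral₀ (μ := (muB d).restrict U) (f := fun x => ‖G x‖ₑ)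
    hG.enorm.restrict (ENNReal.ofReal s)
  have hsub : {x | s < |G x|} ⊆ {x | ENNReal.ofReal s ≤ ‖G x‖ₑ} := fun x hx => by
    show ENNReal.ofReal s ≤ ‖G x‖ₑ
    rw [Real.enorm_eq_ofReal_abs]
    exact ENNReal.ofReal_le_ofReal (le_of_lt hx)
  rw [ENNReal.ofReal_div_of_pos hs]
  refine (measure_mono hsub).trans ?_
  rw [ENNReal.le_div_iff_mul_le (Or.inl (by simpa using hs)) (Or.inl ENNReal.ofReal_ne_top), mul_comm]
  exact h1.trans h

/-- the smaller ball -/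
lemma sball {x : Euc d} {r : ℝ} (hx : x ∈ ball (0 : Euc d) 1) (h0 : 0 < r) (h1 : r < 1) :
    ball ((1 - r / 4) • x) (r / 4) ⊆ ball (0 : Euc d) 1 ∩ closedBall x r := by
  intro z hz
  have hx' : ‖x‖ < 1 := by simpa using hx
  rw [mem_ball, dist_eq_norm] at hz
  have e1 : ‖(1 - r / 4) • x‖ = (1 - r / 4) * ‖x‖ := by
    rw [norm_smul, Real.norm_of_nonneg (by linarith)]
  constructor
  · rw [mem_ball_zero_iff]
    have h := norm_add_le (z - (1 - r / 4) • x) ((1 - r / 4) • x)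
    rw [sub_add_cancel, e1] at h
    have : (1 - r / 4) * ‖x‖ ≤ 1 - r / 4 := mul_le_of_le_one_right (by linarith) hx'.le
    linarith
  · rw [mem_closedBall, dist_eq_norm]
    have : z - x = (z - (1 - r / 4) • x) + (-(r / 4)) • x := by module
    rw [this]
    refine (norm_add_le _ _).trans ?_
    rw [norm_smul, norm_neg, Real.norm_of_nonneg (by linarith)]
    nlinarith [norm_nonneg x]

/-- Calderon-Zygmund constant -/
noncomputable def CCZ (d : ℕ) (A A' : ℝ) : ℝ := 8 * A ^ 2 * (2 + 20 ^ d) + 384 ^ d + 4 * A' + 1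

lemma CCZ_pos (d : ℕ) {A A' : ℝ} (h : 0 ≤ A') : 0 < CCZ d A A' := by
  unfold CCZ; positivity

/-- Hoermander property -/
def Hor (A' : ℝ) (T : Lp ℝ 2 (muB d) →L[ℝ] Lp ℝ 2 (muB d)) : Prop :=
  ∀ y ∈ ball (0 : Euc d) 1, ∀ ρ > 0, ∀ b : Lp ℝ 2 (muB d),
    (∀ᵐ x ∂muB d, x ∉ ball y ρ → b x = 0) → ∫ x, b x ∂muB d = 0 →
    ∫⁻ x in ball (0 : Euc d) 1 \ closedBall y (64 * ρ), ‖T b x‖ₑ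
      ≤ ENNReal.ofReal (A' * ∫ x, |b x| ∂muB d)

/-- one bad piece -/
lemma bad_piece {f : Euc d → ℝ} (hf : MemLp f 2 (muB d)) {t : ℝ} (ht : 0 < t)
    {x : Euc d} {r : ℝ} (hx : x ∈ ball (0 : Euc d) 1) (h0 : 0 < r) (h1 : r < 1)
    (h5 : ∫ y in closedBall x (5 * r), |f y| ∂muB d ≤ t * ((5 * r) ^ d * VB d))
    {E : Set (Euc d)} (hE : MeasurableSet E) (hE5 : E ⊆ closedBall x (5 * r)) :
    ∃ c : ℝ, |c| ≤ t * 20 ^ d ∧ |c| * (muB d).real (ball ((1 - r / 4) • x) (r / 4)) ≤ ∫ y in E, |f y| ∂muB d ∧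
      ∫ y, (E.indicator f y - (ball ((1 - r / 4) • x) (r / 4)).indicator (fun _ => c) y) ∂muB d = 0 ∧
      ∫ y, |E.indicator f y - (ball ((1 - r / 4) • x) (r / 4)).indicator (fun _ => c) y| ∂muB d
        ≤ 2 * ∫ y in E, |f y| ∂muB d ∧
      ∀ y, y ∉ ball x (6 * r) →
        E.indicator f y - (ball ((1 - r / 4) • x) (r / 4)).indicator (fun _ => c) y = 0 := by
  have hsb := sball hx h0 h1
  set B' := ball ((1 - r / 4) • x) (r / 4) with hB'
  have hfi : Integrable f (muB d) := hf.integrable (by norm_num)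
  have hV := VB_pos (d := d)
  have hm : (muB d).real B' = (r / 4) ^ d * VB d := by
    rw [measureReal_restrict_apply measurableSet_ball,
      Set.inter_eq_left.2 (hsb.trans Set.inter_subset_left), hB', vol_ball _ (by positivity)]
  have hm0 : 0 < (muB d).real B' := by rw [hm]; positivity
  set c := (∫ y in E, f y ∂muB d) / (muB d).real B' with hc
  have hcm : c * (muB d).real B' = ∫ y in E, f y ∂muB d := div_mul_cancel₀ _ hm0.ne'
  have hE1 : |∫ y in E, f y ∂muB d| ≤ ∫ y in E, |f y| ∂muB d := abs_integral_le_integral_abs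
  have hE2 : ∫ y in E, |f y| ∂muB d ≤ ∫ y in closedBall x (5 * r), |f y| ∂muB d :=
    setIntegral_mono_set hfi.abs.integrableOn (Eventually.of_forall fun _ => abs_nonneg _)
      (HasSubset.Subset.eventuallyLE hE5)
  have hcm' : |c| * (muB d).real B' ≤ ∫ y in E, |f y| ∂muB d := by
    rw [← abs_of_pos hm0, ← abs_mul, hcm]; exact hE1
  have hi1 : Integrable (fun y => E.indicator f y) (muB d) := hfi.indicator hE
  have hi2 : Integrable (fun y => B'.indicator (fun _ => c) y) (muB d) :=
    (integrable_const c).indicator measurableSet_ball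
  refine ⟨c, ?_, hcm', ?_, ?_, ?_⟩
  · have h6 : |c| * ((r / 4) ^ d * VB d) ≤ t * ((5 * r) ^ d * VB d) := by
      rw [← hm]; exact hcm'.trans (hE2.trans h5)
    have h7 : (5 * r) ^ d = 20 ^ d * (r / 4) ^ d := by rw [← mul_pow]; congr 1; ring
    rw [h7] at h6
    refine le_of_mul_le_mul_right ?_ (show 0 < (r / 4) ^ d * VB d by positivity)
    linarith
  · rw [integral_sub hi1 hi2, integral_indicator hE, integral_indicator measurableSet_ball,
      setIntegral_const, smul_eq_mul, mul_comm, hcm, sub_self]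
  · calc _ ≤ ∫ y, (E.indicator (fun y => |f y|) y + B'.indicator (fun _ => |c|) y) ∂muB d := by
          refine integral_mono (hi1.sub hi2).abs ((hfi.abs.indicator hE).add
            ((integrable_const |c|).indicator measurableSet_ball)) fun y => ?_
          refine (abs_sub _ _).trans (le_of_eq ?_)
          simp only [Set.indicator]
          split_ifs <;> simp
      _ = _ := by
          rw [integral_add (hfi.abs.indicator hE) ((integrable_const |c|).indicator measurableSet_ball),
            integral_indicator hE, integral_indicator measurableSet_ball, setIntegral_const, smul_eq_mul]
      _ ≤ _ := by rw [mul_comm]; linarith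
  · intro y hy
    have hyE : y ∉ E := fun h => hy (closedBall_subset_ball (by linarith) (hE5 h))
    have hyB : y ∉ B' := fun h => hy (closedBall_subset_ball (by linarith) (hsb h).2)
    rw [Set.indicator_of_notMem hyE, Set.indicator_of_notMem hyB, sub_self]

end czmain


section czmain2
variable {d : ℕ}

lemma sq_sum_disj {ι : Type*} (v : Finset ι) (B : ι → Set (Euc d)) (c : ι → ℝ)
    (hB : (v : Set ι).PairwiseDisjoint B) (y : Euc d) :
    (∑ i ∈ v, (B i).indicator (fun _ => c i) y) ^ 2 = ∑ i ∈ v, (B i).indicator (fun _ => c i ^ 2) y := by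
  classical
  by_cases h : ∃ i ∈ v, y ∈ B i
  · obtain ⟨i, hi, hy⟩ := h
    have hz : ∀ j ∈ v, j ≠ i → y ∉ B j := fun j hj hji hyj =>
      Set.disjoint_left.1 (hB hj hi hji) hyj hy
    rw [Finset.sum_eq_single_of_mem i hi fun j hj hji => Set.indicator_of_notMem (hz j hj hji) _,
      Finset.sum_eq_single_of_mem i hi fun j hj hji => Set.indicator_of_notMem (hz j hj hji) _,
      Set.indicator_of_mem hy, Set.indicator_of_mem hy]
  · push Not at h
    rw [Finset.sum_eq_zero fun j hj => Set.indicator_of_notMem (h j hj) _,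
      Finset.sum_eq_zero fun j hj => Set.indicator_of_notMem (h j hj) _]
    norm_num

lemma sum_setInt_le {ι : Type*} {f : Euc d → ℝ} (hf : Integrable f (muB d)) (v : Finset ι)
    (E : ι → Set (Euc d)) (hE : ∀ i, MeasurableSet (E i)) (hd : (v : Set ι).PairwiseDisjoint E) :
    ∑ i ∈ v, ∫ y in E i, |f y| ∂muB d ≤ ∫ y, |f y| ∂muB d := by
  rw [← integral_biUnion_finset v (fun i _ => hE i) hd fun i _ => hf.abs.integrableOn]
  exact setIntegral_le_integral hf.abs (Eventually.of_forall fun _ => abs_nonneg _)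

lemma sum_indicator_disj {ι : Type*} (v : Finset ι) (E : ι → Set (Euc d)) (f : Euc d → ℝ)
    (hE : (v : Set ι).PairwiseDisjoint E) (y : Euc d) :
    ∑ i ∈ v, (E i).indicator f y = (⋃ i ∈ v, E i).indicator f y :=
  (Finset.indicator_biUnion_apply v E (fun i hi j hj hij => hE hi hj hij) y).symm

theorem cz_weak (hd : 0 < d) {A A' : ℝ} (hA' : 0 ≤ A')
    (T : Lp ℝ 2 (muB d) →L[ℝ] Lp ℝ 2 (muB d)) (hT : ∀ f, ‖T f‖ ≤ A * ‖f‖) (hH : Hor A' T)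
    (f : Lp ℝ 2 (muB d)) {t : ℝ} (ht : 0 < t) :
    muB d {x | t < |T f x|} ≤ ENNReal.ofReal (CCZ d A A' / t * ∫ x, |f x| ∂muB d) := by
  have hf := Lp.memLp f
  have hfi : Integrable f (muB d) := hf.integrable (by norm_num)
  have hV := VB_pos (d := d)
  have hF0 : 0 ≤ ∫ x, |f x| ∂muB d := integral_nonneg fun _ => abs_nonneg _
  have hC1 : 1 ≤ CCZ d A A' := by
    have : 0 ≤ 8 * A ^ 2 * (2 + 20 ^ d) + 384 ^ d + 4 * A' := by positivity
    unfold CCZ; linarith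
  by_cases hF : t * VB d ≤ ∫ x, |f x| ∂muB d
  · have : muB d {x | t < |T f x|} ≤ ENNReal.ofReal (VB d) := by
      refine (measure_mono (Set.subset_univ _)).trans (le_of_eq ?_)
      rw [Measure.restrict_apply_univ, VB, measureReal_def,
        ENNReal.ofReal_toReal measure_ball_lt_top.ne]
    refine this.trans (ENNReal.ofReal_le_ofReal ?_)
    rw [div_mul_eq_mul_div, le_div_iff₀ ht]
    nlinarith
  push Not at hF
  rcases hF0.eq_or_lt with hz | hFpos
  · have hf0 : f = 0 := by
      have h := (integral_eq_zero_iff_of_nonneg (fun x => abs_nonneg (f x)) hfi.abs).1 hz.symm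
      rw [Lp.eq_zero_iff_ae_eq_zero]
      filter_upwards [h] with x hx
      simpa using hx
    have : muB d {x | t < |T f x|} = 0 := by
      have h0 : T f =ᵐ[muB d] 0 := by
        rw [hf0, map_zero]; exact Lp.coeFn_zero _ _ _
      refine measure_mono_null (fun x hx => ?_) h0
      simp only [Set.mem_compl_iff, Set.mem_setOf_eq] at hx ⊢
      intro h; rw [h] at hx; simp at hx; linarith
    rw [this]; exact zero_le
  obtain ⟨v, r, hv, hdis, hoff⟩ := vit hf hd ht (mul_pos ht hFpos) hF
  set F := ∫ x, |f x| ∂muB d with hFdef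
  classical
  obtain ⟨E, hE5, hEm, hEd, hEU⟩ := disj_fin (fun x : Euc d => closedBall x (5 * r x))
    (fun x => measurableSet_closedBall) v
  have hbad : ∀ x, ∃ c : ℝ, x ∈ v → |c| ≤ t * 20 ^ d ∧
      |c| * (muB d).real (ball ((1 - r x / 4) • x) (r x / 4)) ≤ ∫ y in E x, |f y| ∂muB d ∧
      ∫ y, ((E x).indicator f y - (ball ((1 - r x / 4) • x) (r x / 4)).indicator (fun _ => c) y) ∂muB d = 0 ∧
      ∫ y, |(E x).indicator f y - (ball ((1 - r x / 4) • x) (r x / 4)).indicator (fun _ => c) y| ∂muB d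
        ≤ 2 * ∫ y in E x, |f y| ∂muB d ∧
      ∀ y, y ∉ ball x (6 * r x) →
        (E x).indicator f y - (ball ((1 - r x / 4) • x) (r x / 4)).indicator (fun _ => c) y = 0 := by
    intro x
    by_cases hx : x ∈ v
    · obtain ⟨h1, h2, h3, h4, h5⟩ := hv x hx
      obtain ⟨c, hc⟩ := bad_piece hf ht h1 h2 h3 h5 (hEm x) (hE5 x)
      exact ⟨c, fun _ => hc⟩
    · exact ⟨0, fun h => absurd h hx⟩
  choose c hc using hbad
  set B' : Euc d → Set (Euc d) := fun x => ball ((1 - r x / 4) • x) (r x / 4) with hB'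
  have hB'm : ∀ x, MeasurableSet (B' x) := fun x => measurableSet_ball
  have hB'd : (v : Set (Euc d)).PairwiseDisjoint B' := by
    intro x hx y hy hxy
    refine (hdis hx hy hxy).mono ?_ ?_
    · exact (sball (hv x hx).1 (hv x hx).2.1 (hv x hx).2.2.1).trans Set.inter_subset_right
    · exact (sball (hv y hy).1 (hv y hy).2.1 (hv y hy).2.2.1).trans Set.inter_subset_right
  set bf : Euc d → Euc d → ℝ := fun x y => (E x).indicator f y - (B' x).indicator (fun _ => c x) y with hbf
  have hbL : ∀ x, MemLp (bf x) 2 (muB d) := fun x =>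
    (hf.indicator (hEm x)).sub ((memLp_const (c x)).indicator (hB'm x))
  set b : Euc d → Lp ℝ 2 (muB d) := fun x => (hbL x).toLp (bf x) with hb
  have hbae : ∀ x, b x =ᵐ[muB d] bf x := fun x => (hbL x).coeFn_toLp
  set gf : Euc d → ℝ := fun y => ((⋃ x ∈ v, E x)ᶜ).indicator f y +
    ∑ x ∈ v, (B' x).indicator (fun _ => c x) y with hgf
  have hUm : MeasurableSet (⋃ x ∈ v, E x) := v.measurableSet_biUnion fun x _ => hEm x
  have hg1 : MemLp (fun y => ((⋃ x ∈ v, E x)ᶜ).indicator f y) 2 (muB d) := hf.indicator hUm.compl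
  have hg2 : MemLp (fun y => ∑ x ∈ v, (B' x).indicator (fun _ => c x) y) 2 (muB d) :=
    memLp_finset_sum v fun x _ => (memLp_const (c x)).indicator (hB'm x)
  have hgL : MemLp gf 2 (muB d) := hg1.add hg2
  set g := hgL.toLp gf with hg
  -- decomposition
  have hdec : f = g + ∑ x ∈ v, b x := by
    have e1 : ∑ x ∈ v, b x = (memLp_finset_sum v fun x _ => hbL x).toLp (fun y => ∑ x ∈ v, bf x y) := by
      apply Lp.ext
      refine (Lp.coeFn_finsetSum v b).trans ?_
      refine EventuallyEq.trans ?_ (MemLp.coeFn_toLp _).symm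
      have : ∀ᵐ y ∂muB d, ∀ x ∈ v, b x y = bf x y :=
        (Finset.eventually_all v).2 fun x _ => hbae x
      filter_upwards [this] with y hy
      rw [Finset.sum_apply]
      exact Finset.sum_congr rfl hy
    apply Lp.ext
    refine EventuallyEq.trans ?_ (Lp.coeFn_add _ _).symm
    rw [e1]
    filter_upwards [hgL.coeFn_toLp, (memLp_finset_sum v fun x _ => hbL x).coeFn_toLp] with y h1 h2
    rw [Pi.add_apply, hg, h1, h2, hgf, hbf]
    simp only [Finset.sum_sub_distrib]
    rw [sum_indicator_disj v E f hEd y]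
    have := congrFun (Set.indicator_compl_add_self (⋃ x ∈ v, E x) f) y
    rw [Pi.add_apply] at this
    linarith
  -- good part
  have hgood : ∫ y, gf y ^ 2 ∂muB d ≤ 2 * (2 + 20 ^ d) * (t * F) := by
    have i1 : Integrable (fun y => ((⋃ x ∈ v, E x)ᶜ).indicator f y ^ 2) (muB d) := hg1.integrable_sq
    have i2 : Integrable (fun y => (∑ x ∈ v, (B' x).indicator (fun _ => c x) y) ^ 2) (muB d) :=
      hg2.integrable_sq
    have s1 : ∫ y, ((⋃ x ∈ v, E x)ᶜ).indicator f y ^ 2 ∂muB d ≤ 2 * (t * F) := by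
      have : (fun y => ((⋃ x ∈ v, E x)ᶜ).indicator f y ^ 2)
          = ((⋃ x ∈ v, E x)ᶜ).indicator fun y => f y ^ 2 := by
        funext y; simp only [Set.indicator]; split_ifs <;> simp
      rw [this, integral_indicator hUm.compl, hEU]
      linarith
    have s2 : ∫ y, (∑ x ∈ v, (B' x).indicator (fun _ => c x) y) ^ 2 ∂muB d ≤ 20 ^ d * (t * F) := by
      simp only [sq_sum_disj v B' c hB'd]
      rw [integral_finsetSum v fun x _ => (integrable_const (c x ^ 2)).indicator (hB'm x)]
      calc ∑ x ∈ v, ∫ y, (B' x).indicator (fun _ => c x ^ 2) y ∂muB d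
          ≤ ∑ x ∈ v, (t * 20 ^ d) * ∫ y in E x, |f y| ∂muB d := by
            refine Finset.sum_le_sum fun x hx => ?_
            rw [integral_indicator (hB'm x), setIntegral_const, smul_eq_mul, ← sq_abs]
            obtain ⟨h1, h2, -⟩ := hc x hx
            have h3 : 0 ≤ ∫ y in E x, |f y| ∂muB d := integral_nonneg fun _ => abs_nonneg _
            calc (muB d).real (B' x) * |c x| ^ 2 = |c x| * (|c x| * (muB d).real (B' x)) := by ring
              _ ≤ (t * 20 ^ d) * ∫ y in E x, |f y| ∂muB d := by gcongr
        _ = (t * 20 ^ d) * ∑ x ∈ v, ∫ y in E x, |f y| ∂muB d := by rw [Finset.mul_sum]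
        _ ≤ (t * 20 ^ d) * F := by gcongr; exact sum_setInt_le hfi v E hEm hEd
        _ = _ := by ring
    calc ∫ y, gf y ^ 2 ∂muB d ≤ ∫ y, (2 * ((⋃ x ∈ v, E x)ᶜ).indicator f y ^ 2 +
          2 * (∑ x ∈ v, (B' x).indicator (fun _ => c x) y) ^ 2) ∂muB d := by
          refine integral_mono hgL.integrable_sq ((i1.const_mul 2).add (i2.const_mul 2)) fun y => ?_
          simp only [hgf]
          nlinarith [sq_nonneg (((⋃ x ∈ v, E x)ᶜ).indicator f y -
            ∑ x ∈ v, (B' x).indicator (fun _ => c x) y)]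
      _ = _ := by
          rw [integral_add (i1.const_mul 2) (i2.const_mul 2), integral_const_mul, integral_const_mul]
      _ ≤ _ := by linarith
  have hTg : muB d {x | t / 2 < |T g x|} ≤ ENNReal.ofReal (8 * A ^ 2 * (2 + 20 ^ d) / t * F) := by
    refine (L2_cheb (Lp.memLp (T g)) (half_pos ht)).trans (ENNReal.ofReal_le_ofReal ?_)
    have h1 : ∫ x, T g x ^ 2 ∂muB d = ‖T g‖ ^ 2 := (Lp_norm_sq (T g)).symm
    have h2 : ‖g‖ ^ 2 = ∫ y, gf y ^ 2 ∂muB d := toLp_norm_sq hgL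
    have h3 : ‖T g‖ ^ 2 ≤ A ^ 2 * (2 * (2 + 20 ^ d) * (t * F)) := by
      calc ‖T g‖ ^ 2 ≤ (A * ‖g‖) ^ 2 := by gcongr; exact hT g
        _ = A ^ 2 * ‖g‖ ^ 2 := by ring
        _ ≤ _ := by rw [h2]; gcongr
    rw [h1]
    calc ‖T g‖ ^ 2 / (t / 2) ^ 2 ≤ (A ^ 2 * (2 * (2 + 20 ^ d) * (t * F))) / (t / 2) ^ 2 := by gcongr
      _ = _ := by field_simp; ring
  -- bad part
  set Om : Set (Euc d) := ⋃ x ∈ v, closedBall x (384 * r x) with hOm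
  have hOmm : MeasurableSet Om := v.measurableSet_biUnion fun x _ => measurableSet_closedBall
  have hOmv : muB d Om ≤ ENNReal.ofReal (384 ^ d / t * F) := by
    calc muB d Om ≤ ∑ x ∈ v, muB d (closedBall x (384 * r x)) := measure_biUnion_finset_le _ _
      _ ≤ ∑ x ∈ v, ENNReal.ofReal (384 ^ d / t * ∫ y in closedBall x (r x), |f y| ∂muB d) := by
          refine Finset.sum_le_sum fun x hx => ?_
          obtain ⟨h1, h2, h3, h4, h5⟩ := hv x hx
          refine (Measure.restrict_apply_le _ _).trans ?_
          rw [← ENNReal.ofReal_toReal (measure_closedBall_lt_top (μ := (volume : Measure (Euc d)))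
            (x := x) (r := 384 * r x)).ne]
          refine ENNReal.ofReal_le_ofReal ?_
          have := vol_cball x (show 0 ≤ 384 * r x by positivity)
          rw [measureReal_def] at this
          rw [this, div_mul_eq_mul_div, le_div_iff₀ ht, mul_pow]
          have : (0 : ℝ) < 384 ^ d := by positivity
          nlinarith
      _ = ENNReal.ofReal (∑ x ∈ v, 384 ^ d / t * ∫ y in closedBall x (r x), |f y| ∂muB d) :=
          (ENNReal.ofReal_sum_of_nonneg fun x _ => mul_nonneg (by positivity)
            (integral_nonneg fun _ => abs_nonneg _)).symm
      _ ≤ _ := by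
          rw [← Finset.mul_sum]
          refine ENNReal.ofReal_le_ofReal ?_
          gcongr
          exact sum_setInt_le hfi v _ (fun x => measurableSet_closedBall) hdis
  set S := T (∑ x ∈ v, b x) with hS
  have hTb : ∫⁻ x in Omᶜ, ‖S x‖ₑ ∂muB d ≤ ENNReal.ofReal (A' * (2 * F)) := by
    have hSae : S =ᵐ[muB d] fun y => ∑ x ∈ v, T (b x) y := by
      rw [hS, map_sum]
      refine (Lp.coeFn_finsetSum v _).trans (Eventually.of_forall fun y => ?_)
      rw [Finset.sum_apply]
    calc ∫⁻ y in Omᶜ, ‖S y‖ₑ ∂muB d ≤ ∫⁻ y in Omᶜ, ∑ x ∈ v, ‖T (b x) y‖ₑ ∂muB d := by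
          refine lintegral_mono_ae ((ae_restrict_of_ae hSae).mono fun y hy => ?_)
          rw [hy]; exact enorm_sum_le v _
      _ = ∑ x ∈ v, ∫⁻ y in Omᶜ, ‖T (b x) y‖ₑ ∂muB d :=
          lintegral_finsetSum' v fun x _ => (Lp.aestronglyMeasurable _).enorm.restrict
      _ ≤ ∑ x ∈ v, ENNReal.ofReal (A' * (2 * ∫ y in E x, |f y| ∂muB d)) := by
          refine Finset.sum_le_sum fun x hx => ?_
          obtain ⟨h1, h2, h3, h4, h5⟩ := hv x hx
          obtain ⟨-, -, k3, k4, k5⟩ := hc x hx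
          have e1 : ∫ y, b x y ∂muB d = 0 := (integral_congr_ae (hbae x)).trans k3
          have e2 : ∫ y, |b x y| ∂muB d = ∫ y, |bf x y| ∂muB d :=
            integral_congr_ae ((hbae x).mono fun y hy => by simp only [hy])
          have h := hH x h1 (6 * r x) (by positivity) (b x)
            ((hbae x).mono fun y hy hy' => by rw [hy]; exact k5 y hy') e1
          rw [e2] at h
          refine le_trans ?_ (h.trans (ENNReal.ofReal_le_ofReal (by gcongr)))
          rw [Measure.restrict_restrict hOmm.compl]
          refine lintegral_mono_set ?_
          rintro y ⟨hy1, hy2⟩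
          refine ⟨hy2, fun hy3 => hy1 ?_⟩
          rw [show 64 * (6 * r x) = 384 * r x by ring] at hy3
          exact Set.mem_biUnion hx hy3
      _ = ENNReal.ofReal (∑ x ∈ v, A' * (2 * ∫ y in E x, |f y| ∂muB d)) :=
          (ENNReal.ofReal_sum_of_nonneg fun x _ => mul_nonneg hA' (mul_nonneg two_pos.le
            (integral_nonneg fun _ => abs_nonneg _))).symm
      _ ≤ _ := by
          rw [← Finset.mul_sum, ← Finset.mul_sum]
          refine ENNReal.ofReal_le_ofReal ?_
          gcongr
          exact sum_setInt_le hfi v E hEm hEd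
  have hTb2 := L1_cheb (Lp.aestronglyMeasurable S) Omᶜ (half_pos ht) hTb
  -- conclusion
  have hsum : T f =ᵐ[muB d] fun y => T g y + S y := by
    conv_lhs => rw [hdec, map_add]
    exact Lp.coeFn_add _ _
  have hnull : muB d {y | T f y = T g y + S y}ᶜ = 0 := hsum
  have hsub : {x | t < |T f x|} ⊆ ({x | t / 2 < |T g x|} ∪ Om ∪ ({x | t / 2 < |S x|} ∩ Omᶜ)) ∪
      {y | T f y = T g y + S y}ᶜ := by
    intro y hy
    by_contra hcon
    simp only [Set.mem_union, Set.mem_inter_iff, Set.mem_compl_iff, Set.mem_setOf_eq, not_or, not_and,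
      not_not, not_lt] at hcon
    obtain ⟨⟨⟨h1, h2⟩, h3⟩, h4⟩ := hcon
    have hy : t < |T f y| := hy
    rw [h4] at hy
    have h5 : |S y| ≤ t / 2 := by
      by_contra! h; exact h2 (h3 h)
    have := abs_add_le (T g y) (S y)
    linarith
  have hlast : muB d ({x | t / 2 < |S x|} ∩ Omᶜ) ≤ ENNReal.ofReal (A' * (2 * F) / (t / 2)) := by
    rw [← Measure.restrict_apply' hOmm.compl]; exact hTb2
  calc muB d {x | t < |T f x|} ≤ _ := measure_mono hsub
    _ ≤ _ := measure_union_le _ _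
    _ ≤ _ := add_le_add (measure_union_le _ _) le_rfl
    _ ≤ _ := add_le_add (add_le_add (measure_union_le _ _) le_rfl) le_rfl
    _ ≤ ENNReal.ofReal (8 * A ^ 2 * (2 + 20 ^ d) / t * F) + ENNReal.ofReal (384 ^ d / t * F)
        + ENNReal.ofReal (A' * (2 * F) / (t / 2)) + 0 := by
        gcongr
        exact hnull.le
    _ = ENNReal.ofReal (8 * A ^ 2 * (2 + 20 ^ d) / t * F + 384 ^ d / t * F + A' * (2 * F) / (t / 2)) := by
        rw [add_zero, ENNReal.ofReal_add (by positivity) (by positivity),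
          ENNReal.ofReal_add (by positivity) (by positivity)]
    _ ≤ _ := by
        refine ENNReal.ofReal_le_ofReal ?_
        have : CCZ d A A' / t * F = 8 * A ^ 2 * (2 + 20 ^ d) / t * F + 384 ^ d / t * F
          + A' * (2 * F) / (t / 2) + F / t := by
          unfold CCZ; field_simp; ring
        rw [this]
        have : 0 ≤ F / t := by positivity
        linarith

end czmain2


section interp
variable {d : ℕ}

lemma weak_q {A C q : ℝ} (hC : 0 ≤ C) (hq1 : 1 < q) (hq2 : q < 2)
    (T : Lp ℝ 2 (muB d) →L[ℝ] Lp ℝ 2 (muB d)) (hT : ∀ f, ‖T f‖ ≤ A * ‖f‖)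
    (hW : ∀ (f : Lp ℝ 2 (muB d)) (t : ℝ), 0 < t →
      muB d {x | t < |T f x|} ≤ ENNReal.ofReal (C / t * ∫ x, |f x| ∂muB d))
    (f : Lp ℝ 2 (muB d)) (hi : Integrable (fun x => |f x| ^ q) (muB d))
    (h1 : ∫ x, |f x| ^ q ∂muB d ≤ 1) {t : ℝ} (ht : 0 < t) :
    muB d {x | t < |T f x|} ≤ ENNReal.ofReal ((2 * C + 4 * A ^ 2) * t ^ (-q)) := by
  have hf := Lp.memLp f
  have hm : StronglyMeasurable f := Lp.stronglyMeasurable f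
  set U : Set (Euc d) := {x | t < |f x|} with hU
  have hUm : MeasurableSet U := measurableSet_lt measurable_const hm.measurable.abs
  have hf1 : MemLp (U.indicator f) 2 (muB d) := hf.indicator hUm
  have hf2 : MemLp (Uᶜ.indicator f) 2 (muB d) := hf.indicator hUm.compl
  have hdec : f = hf1.toLp _ + hf2.toLp _ := by
    apply Lp.ext
    refine EventuallyEq.trans ?_ (Lp.coeFn_add _ _).symm
    filter_upwards [hf1.coeFn_toLp, hf2.coeFn_toLp] with x e1 e2
    rw [Pi.add_apply, e1, e2]
    exact (congrFun (Set.indicator_self_add_compl U f) x).symm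
  have s1 : ∫ x, |hf1.toLp _ x| ∂muB d ≤ t ^ (1 - q) := by
    have e1 : ∫ x, |hf1.toLp _ x| ∂muB d = ∫ x, |U.indicator f x| ∂muB d :=
      integral_congr_ae (hf1.coeFn_toLp.mono fun y hy => by simp only [hy])
    rw [e1]
    calc ∫ x, |U.indicator f x| ∂muB d ≤ ∫ x, t ^ (1 - q) * |f x| ^ q ∂muB d := by
          refine integral_mono (hf1.integrable (by norm_num)).abs (hi.const_mul _) fun x => ?_
          by_cases hx : x ∈ U
          · simp only [Set.indicator_of_mem hx]
            have hx' : t < |f x| := hx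
            have h0 : 0 < |f x| := ht.trans hx'
            calc |f x| = |f x| ^ (1 - q) * |f x| ^ q := by
                  rw [← Real.rpow_add h0]; simp
              _ ≤ t ^ (1 - q) * |f x| ^ q := by
                  refine mul_le_mul_of_nonneg_right ?_ (by positivity)
                  exact Real.rpow_le_rpow_of_nonpos ht hx'.le (by linarith)
          · simp only [Set.indicator_of_notMem hx, abs_zero]; positivity
      _ = t ^ (1 - q) * ∫ x, |f x| ^ q ∂muB d := integral_const_mul _ _
      _ ≤ t ^ (1 - q) := mul_le_of_le_one_right (by positivity) h1
  have s2 : ‖hf2.toLp _‖ ^ 2 ≤ t ^ (2 - q) := by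
    rw [toLp_norm_sq]
    calc ∫ x, Uᶜ.indicator f x ^ 2 ∂muB d ≤ ∫ x, t ^ (2 - q) * |f x| ^ q ∂muB d := by
          refine integral_mono hf2.integrable_sq (hi.const_mul _) fun x => ?_
          by_cases hx : x ∈ U
          · simp only [Set.indicator_of_notMem (show x ∉ Uᶜ from fun h => h hx)]
            have : 0 ≤ t ^ (2 - q) * |f x| ^ q := by positivity
            simpa using this
          · simp only [Set.indicator_of_mem (show x ∈ Uᶜ from hx)]
            have hx' : |f x| ≤ t := not_lt.1 hx
            rcases (abs_nonneg (f x)).eq_or_lt with h0 | h0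
            · have : f x = 0 := abs_eq_zero.1 h0.symm
              rw [this]
              have : 0 ≤ t ^ (2 - q) * |(0 : ℝ)| ^ q := by positivity
              simpa using this
            calc f x ^ 2 = |f x| ^ (2 - q) * |f x| ^ q := by
                  rw [← Real.rpow_add h0, ← sq_abs]; simp
              _ ≤ t ^ (2 - q) * |f x| ^ q := by
                  refine mul_le_mul_of_nonneg_right ?_ (by positivity)
                  exact Real.rpow_le_rpow h0.le hx' (by linarith)
      _ = t ^ (2 - q) * ∫ x, |f x| ^ q ∂muB d := integral_const_mul _ _
      _ ≤ t ^ (2 - q) := mul_le_of_le_one_right (by positivity) h1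
  have w1 := hW (hf1.toLp _) (t / 2) (half_pos ht)
  have w2 := L2_cheb (Lp.memLp (T (hf2.toLp _))) (half_pos ht)
  rw [← Lp_norm_sq] at w2
  have hsum : T f =ᵐ[muB d] fun y => T (hf1.toLp _) y + T (hf2.toLp _) y := by
    conv_lhs => rw [hdec, map_add]
    exact Lp.coeFn_add _ _
  have hnull : muB d {y | T f y = T (hf1.toLp _) y + T (hf2.toLp _) y}ᶜ = 0 := hsum
  have hsub : {x | t < |T f x|} ⊆ ({x | t / 2 < |T (hf1.toLp _) x|} ∪ {x | t / 2 < |T (hf2.toLp _) x|}) ∪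
      {y | T f y = T (hf1.toLp _) y + T (hf2.toLp _) y}ᶜ := by
    intro y hy
    by_contra hcon
    simp only [Set.mem_union, Set.mem_compl_iff, Set.mem_setOf_eq, not_or, not_not, not_lt] at hcon
    obtain ⟨⟨h1, h2⟩, h4⟩ := hcon
    have hy : t < |T f y| := hy
    rw [h4] at hy
    have := abs_add_le (T (hf1.toLp _) y) (T (hf2.toLp _) y)
    linarith
  have p1 : t ^ (1 - q) = t * t ^ (-q) := by
    rw [sub_eq_add_neg, Real.rpow_add ht, Real.rpow_one]
  have p2 : t ^ (2 - q) = t ^ 2 * t ^ (-q) := by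
    rw [sub_eq_add_neg, Real.rpow_add ht, Real.rpow_two]
  have hp : 0 < t ^ (-q) := by positivity
  calc muB d {x | t < |T f x|} ≤ _ := measure_mono hsub
    _ ≤ _ := measure_union_le _ _
    _ ≤ _ := add_le_add (measure_union_le _ _) le_rfl
    _ ≤ ENNReal.ofReal (2 * C * t ^ (-q)) + ENNReal.ofReal (4 * A ^ 2 * t ^ (-q)) + 0 := by
        refine add_le_add (add_le_add (w1.trans (ENNReal.ofReal_le_ofReal ?_))
          (w2.trans (ENNReal.ofReal_le_ofReal ?_))) hnull.le
        · calc C / (t / 2) * ∫ x, |hf1.toLp _ x| ∂muB d ≤ C / (t / 2) * t ^ (1 - q) := by gcongr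
            _ = _ := by rw [p1]; field_simp
        · calc ‖T (hf2.toLp _)‖ ^ 2 / (t / 2) ^ 2 ≤ (A * ‖hf2.toLp _‖) ^ 2 / (t / 2) ^ 2 := by
                gcongr; exact hT _
            _ = A ^ 2 * ‖hf2.toLp _‖ ^ 2 / (t / 2) ^ 2 := by ring
            _ ≤ A ^ 2 * t ^ (2 - q) / (t / 2) ^ 2 := by gcongr
            _ = _ := by rw [p2]; field_simp; ring
    _ = _ := by
        rw [add_zero, ← ENNReal.ofReal_add (by positivity) (by positivity)]
        congr 1; ring

lemma strong_q {A C q : ℝ} (hC : 0 ≤ C) (hq1 : 1 < q) (hq2 : q < 2)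
    (T : Lp ℝ 2 (muB d) →L[ℝ] Lp ℝ 2 (muB d)) (hT : ∀ f, ‖T f‖ ≤ A * ‖f‖)
    (hW : ∀ (f : Lp ℝ 2 (muB d)) (t : ℝ), 0 < t →
      muB d {x | t < |T f x|} ≤ ENNReal.ofReal (C / t * ∫ x, |f x| ∂muB d)) :
    ∃ K : ℝ≥0∞, K ≠ ⊤ ∧ ∀ f : Lp ℝ 2 (muB d),
      eLpNorm (T f) 1 (muB d) ≤ K * eLpNorm f (ENNReal.ofReal q) (muB d) := by
  set M := 2 * C + 4 * A ^ 2
  have hq0 : 0 < q := by linarith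
  set K : ℝ≥0∞ := muB d Set.univ + ∫⁻ t in Set.Ioi (1 : ℝ), ENNReal.ofReal (M * t ^ (-q)) with hK
  have hKt : K ≠ ⊤ := by
    refine ENNReal.add_ne_top.2 ⟨measure_ne_top _ _, ?_⟩
    have : IntegrableOn (fun t : ℝ => M * t ^ (-q)) (Set.Ioi 1) :=
      (integrableOn_Ioi_rpow_of_lt (by linarith) one_pos).const_mul M
    exact (this.lintegral_lt_top).ne
  have key : ∀ f : Lp ℝ 2 (muB d), Integrable (fun x => |f x| ^ q) (muB d) →
      ∫ x, |f x| ^ q ∂muB d ≤ 1 → eLpNorm (T f) 1 (muB d) ≤ K := by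
    intro f hi h1
    have hmeas : AEMeasurable (fun x => |T f x|) (muB d) :=
      (Lp.stronglyMeasurable (T f)).measurable.abs.aemeasurable
    have e : eLpNorm (T f) 1 (muB d) = ∫⁻ t in Set.Ioi 0, muB d {x | t < |T f x|} := by
      rw [eLpNorm_one_eq_lintegral_enorm,
        ← lintegral_eq_lintegral_meas_lt (muB d) (Eventually.of_forall fun _ => abs_nonneg _) hmeas]
      simp only [Real.enorm_eq_ofReal_abs]
    rw [e, ← Set.Ioc_union_Ioi_eq_Ioi (zero_le_one (α := ℝ))]
    refine (lintegral_union_le _ _ _).trans (add_le_add ?_ ?_)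
    · calc ∫⁻ t in Set.Ioc (0 : ℝ) 1, muB d {x | t < |T f x|}
          ≤ ∫⁻ _ in Set.Ioc (0 : ℝ) 1, muB d Set.univ :=
            lintegral_mono fun t => measure_mono (Set.subset_univ _)
        _ = _ := by simp
    · refine setLIntegral_mono_ae' measurableSet_Ioi (Eventually.of_forall fun t ht => ?_)
      exact weak_q hC hq1 hq2 T hT hW f hi h1 (one_pos.trans ht)
  refine ⟨K, hKt, fun f => ?_⟩
  have hfq : MemLp f (ENNReal.ofReal q) (muB d) := (Lp.memLp f).mono_exponent (by
    rw [show (2 : ℝ≥0∞) = ENNReal.ofReal 2 by simp]; exact ENNReal.ofReal_le_ofReal hq2.le)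
  have hqr : (ENNReal.ofReal q).toReal = q := ENNReal.toReal_ofReal hq0.le
  have hi : Integrable (fun x => |f x| ^ q) (muB d) := by
    have := hfq.integrable_norm_rpow (by simpa using hq0) ENNReal.ofReal_ne_top
    rw [hqr] at this; exact this
  have hN := hfq.eLpNorm_eq_integral_rpow_norm (by simpa using hq0) ENNReal.ofReal_ne_top
  rw [hqr] at hN
  simp only [Real.norm_eq_abs] at hN
  set I := ∫ x, |f x| ^ q ∂muB d with hI
  have hI0 : 0 ≤ I := integral_nonneg fun _ => by positivity
  rcases hI0.eq_or_lt with h0 | hpos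
  · have hf0 : f = 0 := by
      have h := (integral_eq_zero_iff_of_nonneg (fun x => by positivity) hi).1 h0.symm
      rw [Lp.eq_zero_iff_ae_eq_zero]
      filter_upwards [h] with x hx
      simp only [Pi.zero_apply] at hx ⊢
      rw [Real.rpow_eq_zero (abs_nonneg _) hq0.ne'] at hx
      exact abs_eq_zero.1 hx
    have : eLpNorm (T f) 1 (muB d) = 0 := by
      rw [hf0, map_zero, eLpNorm_congr_ae (Lp.coeFn_zero _ _ _)]; simp
    rw [this]; exact zero_le
  set N := I ^ q⁻¹ with hNdef
  have hNpos : 0 < N := by positivity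
  have hNq : N ^ q = I := by rw [hNdef, ← Real.rpow_mul hI0, inv_mul_cancel₀ hq0.ne', Real.rpow_one]
  have hae : (fun x => |(N⁻¹ • f) x| ^ q) =ᵐ[muB d] fun x => I⁻¹ * |f x| ^ q := by
    filter_upwards [Lp.coeFn_smul N⁻¹ f] with x hx
    rw [hx, Pi.smul_apply, smul_eq_mul, abs_mul, Real.mul_rpow (abs_nonneg _) (abs_nonneg _),
      abs_of_pos (by positivity), Real.inv_rpow hNpos.le, hNq]
  have h := key (N⁻¹ • f) ((hi.const_mul I⁻¹).congr hae.symm) (by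
    rw [integral_congr_ae hae, integral_const_mul, ← hI, inv_mul_cancel₀ hpos.ne'])
  rw [map_smul, eLpNorm_congr_ae (Lp.coeFn_smul _ _), eLpNorm_const_smul, Real.enorm_eq_ofReal_abs,
    abs_of_pos (inv_pos.2 hNpos), ENNReal.ofReal_inv_of_pos hNpos] at h
  rw [hN]
  have hNe : ENNReal.ofReal N ≠ 0 := by simpa using hNpos
  rwa [mul_comm, ← div_eq_mul_inv, ENNReal.div_le_iff hNe ENNReal.ofReal_ne_top] at h

end interp


section weak
variable {d : ℕ}

lemma int_mul_cont {w g : Euc d → ℝ} (hw : Integrable w (muB d)) (hg : Continuous g) :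
    Integrable (fun x => w x * g x) (muB d) := by
  obtain ⟨C, -, hC⟩ := cont_bdd hg
  exact hw.mul_bdd hg.aestronglyMeasurable (ae_ball fun x hx => hC x (ball_subset_closedBall hx))

lemma int_mul_bound {w g : Euc d → ℝ} (hw : Integrable w (muB d)) {C : ℝ}
    (hC : ∀ x ∈ ball (0 : Euc d) 1, |g x| ≤ C) :
    |∫ x, w x * g x ∂muB d| ≤ C * ∫ x, |w x| ∂muB d := by
  rw [← integral_const_mul]
  have key : ∀ᵐ x ∂muB d, ‖w x * g x‖ ≤ C * |w x| := by
    refine ae_ball fun x hx => ?_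
    rw [norm_mul, Real.norm_eq_abs, Real.norm_eq_abs, mul_comm]
    exact mul_le_mul_of_nonneg_right (hC x hx) (abs_nonneg _)
  exact norm_integral_le_of_norm_le (hw.abs.const_mul C) key

lemma int_abs_eq {w : Euc d → ℝ} (hw : Integrable w (muB d)) :
    ∫ x, |w x| ∂muB d = (eLpNorm w 1 (muB d)).toReal := by
  rw [eLpNorm_one_eq_lintegral_enorm, ← integral_norm_eq_lintegral_enorm hw.1]
  rfl

lemma L1_tend {F : ℕ → Euc d → ℝ} {f : Euc d → ℝ}
    (hF : ∀ n, Integrable (F n) (muB d)) (hf : Integrable f (muB d))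
    (h : Tendsto (fun n => eLpNorm (F n - f) 1 (muB d)) atTop (𝓝 0)) :
    Tendsto (fun n => ∫ x, |F n x - f x| ∂muB d) atTop (𝓝 0) := by
  have h1 : ∀ n, ∫ x, |F n x - f x| ∂muB d = (eLpNorm (F n - f) 1 (muB d)).toReal := fun n =>
    int_abs_eq ((hF n).sub hf)
  simp only [h1]
  have h2 := (ENNReal.tendsto_toReal ENNReal.zero_ne_top).comp h
  rw [ENNReal.toReal_zero] at h2
  exact h2

lemma int_mul_tendsto {F : ℕ → Euc d → ℝ} {f : Euc d → ℝ}
    (hF : ∀ n, Integrable (F n) (muB d)) (hf : Integrable f (muB d))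
    (h : Tendsto (fun n => eLpNorm (F n - f) 1 (muB d)) atTop (𝓝 0))
    {g : Euc d → ℝ} (hg : Continuous g) :
    Tendsto (fun n => ∫ x, F n x * g x ∂muB d) atTop (𝓝 (∫ x, f x * g x ∂muB d)) := by
  obtain ⟨C, hC0, hC⟩ := cont_bdd hg
  rw [tendsto_iff_norm_sub_tendsto_zero]
  have h2 := (L1_tend hF hf h).const_mul C
  rw [mul_zero] at h2
  refine squeeze_zero (fun _ => norm_nonneg _) (fun n => ?_) h2
  rw [← integral_sub (int_mul_cont (hF n) hg) (int_mul_cont hf hg)]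
  have e : (fun x => F n x * g x - f x * g x) = fun x => (F n x - f x) * g x := by
    funext x; ring
  rw [e]
  exact int_mul_bound ((hF n).sub hf) fun x hx => hC x (ball_subset_closedBall hx)

lemma L1_of_Lp {p : ℝ} (hp : 1 < p) {E : Type*} [NormedAddCommGroup E] {F : ℕ → Euc d → E}
    (hF : ∀ n, AEStronglyMeasurable (F n) (muB d))
    (h : Tendsto (fun n => eLpNorm (F n) (ENNReal.ofReal p) (muB d)) atTop (𝓝 0)) :
    Tendsto (fun n => eLpNorm (F n) 1 (muB d)) atTop (𝓝 0) := by
  have hp1 : (1 : ℝ≥0∞) ≤ ENNReal.ofReal p := by simpa using hp.le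
  have hb := fun n => eLpNorm_le_eLpNorm_mul_rpow_measure_univ hp1 (hF n)
  refine tendsto_of_tendsto_of_tendsto_of_le_of_le tendsto_const_nhds ?_ (fun _ => zero_le) hb
  have hne : (muB d) Set.univ ^ (1 / (1 : ℝ≥0∞).toReal - 1 / (ENNReal.ofReal p).toReal) ≠ ⊤ := by
    refine ENNReal.rpow_ne_top_of_nonneg ?_ (measure_ne_top _ _)
    rw [ENNReal.toReal_one, ENNReal.toReal_ofReal (by linarith), sub_nonneg,
      div_le_div_iff₀ (by linarith) one_pos]
    linarith
  have := ENNReal.Tendsto.mul_const h (Or.inr hne)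
  simpa using this

lemma grad_inner (φ : Euc d → ℝ) (x z : Euc d) : ⟪gradient φ x, z⟫ = DD z φ x := by
  rw [gradient, InnerProductSpace.toDual_symm_apply, DD]

lemma grad_cont {φ : Euc d → ℝ} (hφ : ContDiff ℝ ∞ φ) : Continuous (gradient φ) := by
  unfold gradient
  exact (LinearIsometryEquiv.continuous _).comp ((sm_one hφ).continuous_fderiv (by simp))

lemma sphere_zero {φ : Euc d → ℝ} (h : tsupport φ ⊆ ball (0 : Euc d) 1) :
    ∀ x ∈ sphere (0 : Euc d) 1, φ x = 0 := by
  intro x hx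
  refine image_eq_zero_of_notMem_tsupport fun hx' => ?_
  have h1 := h hx'
  rw [mem_ball] at h1
  rw [mem_sphere] at hx
  linarith

lemma w_ibp1 {p : ℝ} (hp : 1 < p) {u : Euc d → ℝ} {Du : Euc d → Euc d}
    (h : MemW1p0 p (ball (0 : Euc d) 1) u Du) {g : Euc d → ℝ} (hg : ContDiff ℝ ∞ g) (z : Euc d) :
    ∫ x, u x * DD z g x ∂muB d = - ∫ x, ⟪Du x, z⟫ * g x ∂muB d := by
  obtain ⟨-, h1, h2, h3⟩ := h
  have hp1 : (1 : ℝ≥0∞) ≤ ENNReal.ofReal p := by simpa using hp.le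
  have hui : Integrable u (muB d) := h1.integrable hp1
  have hDi : Integrable Du (muB d) := h2.integrable hp1
  have hDz : Integrable (fun x => ⟪Du x, z⟫) (muB d) := hDi.inner_const z
  choose φ k1 k2 k3 k4 k5 using fun n : ℕ => h3 (1 / ((n : ℝ) + 1)) (by positivity)
  have hε : Tendsto (fun n : ℕ => ENNReal.ofReal (1 / ((n : ℝ) + 1))) atTop (𝓝 0) := by
    have := ENNReal.tendsto_ofReal (tendsto_one_div_add_atTop_nhds_zero_nat (𝕜 := ℝ))
    simpa using this
  have hφi : ∀ n, Integrable (φ n) (muB d) := fun n =>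
    memLp_one_iff_integrable.1 (cont_memLp (k1 n).continuous 1)
  have hφz : ∀ n, Integrable (DD z (φ n)) (muB d) := fun n =>
    memLp_one_iff_integrable.1 (cont_memLp (DD_smooth (k1 n) z).continuous 1)
  have t1 : Tendsto (fun n => eLpNorm (fun x => u x - φ n x) 1 (muB d)) atTop (𝓝 0) :=
    L1_of_Lp hp (fun n => hui.1.sub (hφi n).1)
      (tendsto_of_tendsto_of_tendsto_of_le_of_le tendsto_const_nhds hε (fun _ => zero_le)
        fun n => (k4 n).le)
  have t2 : Tendsto (fun n => eLpNorm (fun x => Du x - gradient (φ n) x) 1 (muB d)) atTop (𝓝 0) :=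
    L1_of_Lp hp (fun n => hDi.1.sub (grad_cont (k1 n)).aestronglyMeasurable)
      (tendsto_of_tendsto_of_tendsto_of_le_of_le tendsto_const_nhds hε (fun _ => zero_le)
        fun n => (k5 n).le)
  have t1' : Tendsto (fun n => eLpNorm (φ n - u) 1 (muB d)) atTop (𝓝 0) := by
    refine t1.congr fun n => ?_
    rw [eLpNorm_sub_comm]; rfl
  have t2' : Tendsto (fun n => eLpNorm (DD z (φ n) - fun x => ⟪Du x, z⟫) 1 (muB d)) atTop (𝓝 0) := by
    have t3 := ENNReal.Tendsto.const_mul t2 (Or.inr (ENNReal.ofReal_ne_top (r := ‖z‖)))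
    rw [mul_zero] at t3
    refine tendsto_of_tendsto_of_tendsto_of_le_of_le tendsto_const_nhds t3 (fun _ => zero_le) fun n => ?_
    refine eLpNorm_le_mul_eLpNorm_of_ae_le_mul (Eventually.of_forall fun x => ?_) 1
    rw [Pi.sub_apply, ← grad_inner, ← inner_sub_left, norm_sub_rev (Du x), mul_comm]
    exact norm_inner_le_norm _ _
  have l1 := int_mul_tendsto hφi hui t1' (DD_smooth hg z).continuous
  have l2 := (int_mul_tendsto hφz hDz t2' hg.continuous).neg
  refine tendsto_nhds_unique l1 (l2.congr fun n => ?_)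
  exact (ibp (sm_one (k1 n)) (sm_one hg) (fun x hx => by rw [sphere_zero (k3 n) x hx, zero_mul]) z).symm

lemma wg_test {w : Euc d → ℝ} {g : Euc d → Euc d} (h : IsWeakGrad (ball (0 : Euc d) 1) w g)
    (hw : Integrable w (muB d)) (hg : Integrable g (muB d)) {φ : Euc d → ℝ} (hφ : ContDiff ℝ ∞ φ)
    (h1 : HasCompactSupport φ) (h2 : tsupport φ ⊆ ball (0 : Euc d) 1) (z : Euc d) :
    ∫ x, w x * DD z φ x ∂muB d = - ∫ x, ⟪g x, z⟫ * φ x ∂muB d := by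
  have hh := h φ hφ h1 h2
  obtain ⟨C, hC⟩ := (isCompact_closedBall (0 : Euc d) 1).exists_bound_of_continuousOn
    (grad_cont hφ).continuousOn
  obtain ⟨C', -, hC'⟩ := cont_bdd hφ.continuous
  have i1 : Integrable (fun x => w x • gradient φ x) (muB d) :=
    hw.smul_bdd C (grad_cont hφ).aestronglyMeasurable
      (ae_ball fun x hx => hC x (ball_subset_closedBall hx))
  have i2 : Integrable (fun x => φ x • g x) (muB d) :=
    hg.bdd_smul C' hφ.continuous.aestronglyMeasurable
      (ae_ball fun x hx => hC' x (ball_subset_closedBall hx))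
  have hL := congrArg (innerSL ℝ z) hh
  rw [map_neg, ← ContinuousLinearMap.integral_comp_comm _ i1,
    ← ContinuousLinearMap.integral_comp_comm _ i2] at hL
  simp only [innerSL_apply_apply, inner_smul_right] at hL
  calc ∫ x, w x * DD z φ x ∂muB d = ∫ x, w x * ⟪z, gradient φ x⟫ ∂muB d := by
        refine integral_congr_ae (Eventually.of_forall fun x => ?_)
        show w x * DD z φ x = w x * ⟪z, gradient φ x⟫
        rw [← real_inner_comm, grad_inner]
    _ = _ := hL
    _ = _ := by
        congr 1
        refine integral_congr_ae (Eventually.of_forall fun x => ?_)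
        show φ x * ⟪z, g x⟫ = ⟪g x, z⟫ * φ x
        rw [real_inner_comm, mul_comm]

/-- cut-off bound -/
lemma theta_bound : ∃ M : ℝ, 0 ≤ M ∧ ∀ s : ℝ, |(s + 1) * deriv Real.smoothTransition s| ≤ M := by
  have hc : Continuous (fun s : ℝ => (s + 1) * deriv Real.smoothTransition s) :=
    (continuous_id.add continuous_const).mul
      ((Real.smoothTransition.contDiff (n := 1)).continuous_deriv (by simp))
  obtain ⟨M, hM⟩ := (isCompact_Icc (a := (0 : ℝ)) (b := 1)).exists_bound_of_continuousOn hc.continuousOn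
  refine ⟨max M 0, le_max_right _ _, fun s => ?_⟩
  by_cases hs : s ∈ Set.Icc (0 : ℝ) 1
  · exact (hM s hs).trans (le_max_left _ _)
  · have : deriv Real.smoothTransition s = 0 := by
      rw [Set.mem_Icc, not_and_or, not_le, not_le] at hs
      rcases hs with hs | hs
      · have : Real.smoothTransition =ᶠ[𝓝 s] fun _ => 0 := by
          filter_upwards [gt_mem_nhds hs] with y hy using Real.smoothTransition.zero_of_nonpos hy.le
        rw [this.deriv_eq, deriv_const]
      · have : Real.smoothTransition =ᶠ[𝓝 s] fun _ => 1 := by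
          filter_upwards [lt_mem_nhds hs] with y hy using Real.smoothTransition.one_of_one_le hy.le
        rw [this.deriv_eq, deriv_const]
    rw [this]; simp

/-- cut-off -/
noncomputable def kap (n : ℕ) (x : Euc d) : ℝ := Real.smoothTransition (n * rho x - 1)

lemma kap_smooth (n : ℕ) : ContDiff ℝ ∞ (kap n : Euc d → ℝ) := by
  unfold kap
  exact (Real.smoothTransition.contDiff (n := ⊤)).comp ((contDiff_const.mul rho_contDiff).sub contDiff_const)

lemma DD_kap (n : ℕ) (z x : Euc d) :
    DD z (kap n) x = deriv Real.smoothTransition (n * rho x - 1) * (n * DD z rho x) := by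
  unfold DD kap
  have h1 : HasFDerivAt (fun x : Euc d => (n : ℝ) * rho x - 1) ((n : ℝ) • fderiv ℝ rho x) x :=
    (((rho_contDiff (n := 1)).differentiable (by simp) x).hasFDerivAt.const_mul (n : ℝ)).sub_const 1
  have h2 : HasDerivAt Real.smoothTransition (deriv Real.smoothTransition (n * rho x - 1)) (n * rho x - 1) :=
    ((Real.smoothTransition.contDiff (n := 1)).differentiable (by simp) _).hasDerivAt
  have h3 := h2.comp_hasFDerivAt x h1
  have e : (fun x : Euc d => Real.smoothTransition (n * rho x - 1)) =
    Real.smoothTransition ∘ fun x => (n : ℝ) * rho x - 1 := rfl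
  rw [e, h3.fderiv]
  simp

lemma kap_ev {x : Euc d} (hx : x ∈ ball (0 : Euc d) 1) :
    ∀ᶠ n : ℕ in atTop, 1 < n * rho x - 1 := by
  have hr := rho_pos hx
  have := (tendsto_natCast_atTop_atTop (R := ℝ)).atTop_mul_const hr
  filter_upwards [this.eventually_gt_atTop 2] with n hn
  linarith

lemma w_ibp2 {w : Euc d → ℝ} {g : Euc d → Euc d} (h : IsWeakGrad (ball (0 : Euc d) 1) w g)
    (hw : Integrable w (muB d)) (hg : Integrable g (muB d)) {v : Euc d → ℝ} (hv : ContDiff ℝ ∞ v)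
    (hv0 : ∀ x ∈ sphere (0 : Euc d) 1, v x = 0) (z : Euc d) :
    ∫ x, w x * DD z v x ∂muB d = - ∫ x, ⟪g x, z⟫ * v x ∂muB d := by
  obtain ⟨M, hM0, hM⟩ := theta_bound
  obtain ⟨C, hC0, hC⟩ := bdd_of_sphere (sm_one hv) hv0
  obtain ⟨C1, hC10, hC1⟩ := cont_bdd (DD_smooth hv z).continuous
  obtain ⟨C2, hC20, hC2⟩ := cont_bdd hv.continuous
  obtain ⟨C3, hC30, hC3⟩ := cont_bdd (DD_smooth (rho_contDiff (n := ∞)) z).continuous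
  have hgz : Integrable (fun x => ⟪g x, z⟫) (muB d) := hg.inner_const z
  have hφ : ∀ n, ContDiff ℝ ∞ (fun x => kap n x * v x) := fun n => (kap_smooth n).mul hv
  have hDφ : ∀ n x, DD z (fun x => kap n x * v x) x = kap n x * DD z v x + DD z (kap n) x * v x :=
    fun n x => DD_mul (sm_diff (kap_smooth n) x) (sm_diff hv x) z
  have hk0 : ∀ n (x : Euc d), 0 ≤ kap n x := fun n x => Real.smoothTransition.nonneg _
  have hk1 : ∀ n (x : Euc d), kap n x ≤ 1 := fun n x => Real.smoothTransition.le_one _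
  have hts : ∀ n, tsupport (fun x => kap n x * v x) ⊆ ball (0 : Euc d) 1 := by
    intro n
    have hcl : IsClosed {x : Euc d | (1 : ℝ) ≤ n * rho x} :=
      isClosed_le continuous_const (continuous_const.mul (rho_contDiff (n := 0)).continuous)
    have hsub : {x : Euc d | (1 : ℝ) ≤ n * rho x} ⊆ ball (0 : Euc d) 1 := by
      intro x hx
      have hx : (1 : ℝ) ≤ n * rho x := hx
      have : 0 < rho x := by
        by_contra! hr
        have : (n : ℝ) * rho x ≤ 0 := mul_nonpos_of_nonneg_of_nonpos (by positivity) hr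
        linarith
      rw [mem_ball_zero_iff]
      unfold rho at this
      nlinarith [norm_nonneg x]
    refine (closure_minimal ?_ hcl).trans hsub
    intro x hx
    by_contra! hcon
    have hcon : (n : ℝ) * rho x < 1 := not_le.1 hcon
    apply hx
    show kap n x * v x = 0
    rw [kap, Real.smoothTransition.zero_of_nonpos (by linarith), zero_mul]
  have hcs : ∀ n, HasCompactSupport (fun x => kap n x * v x) := fun n =>
    (isCompact_closedBall (0 : Euc d) 1).of_isClosed_subset (isClosed_tsupport _)
      ((hts n).trans ball_subset_closedBall)
  have l1 : Tendsto (fun n => ∫ x, w x * DD z (fun x => kap n x * v x) x ∂muB d) atTop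
      (𝓝 (∫ x, w x * DD z v x ∂muB d)) := by
    refine tendsto_integral_of_dominated_convergence (fun x => |w x| * (C1 + M * C3 * C))
      (fun n => (int_mul_cont hw (DD_smooth (hφ n) z).continuous).1) (hw.abs.mul_const _)
      (fun n => ae_ball fun x hx => ?_) (ae_ball fun x hx => ?_)
    · rw [norm_mul]
      refine mul_le_mul_of_nonneg_left ?_ (norm_nonneg _)
      rw [hDφ, DD_kap]
      have hxc := ball_subset_closedBall hx
      have hr := rho_pos hx
      refine (norm_add_le _ _).trans (add_le_add ?_ ?_)
      · rw [norm_mul, Real.norm_of_nonneg (hk0 n x)]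
        calc kap n x * ‖DD z v x‖ ≤ 1 * C1 := by
              gcongr
              · exact hk1 n x
              · exact hC1 x hxc
          _ = C1 := one_mul _
      · have e1 : ‖deriv Real.smoothTransition (n * rho x - 1) * (n * DD z rho x) * v x‖
            = |deriv Real.smoothTransition (n * rho x - 1)| * n * (|DD z rho x| * |v x|) := by
          rw [norm_mul, norm_mul, norm_mul, Real.norm_natCast]
          simp only [Real.norm_eq_abs]; ring
        rw [e1]
        have h2 := hM (n * rho x - 1)
        rw [abs_mul, sub_add_cancel, abs_mul, Nat.abs_cast, abs_of_pos hr] at h2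
        calc |deriv Real.smoothTransition (n * rho x - 1)| * n * (|DD z rho x| * |v x|)
            ≤ |deriv Real.smoothTransition (n * rho x - 1)| * n * (C3 * (C * rho x)) := by
              gcongr
              · exact hC3 x hxc
              · exact hC x hx
          _ = (n * rho x * |deriv Real.smoothTransition (n * rho x - 1)|) * C3 * C := by ring
          _ ≤ M * C3 * C := by gcongr
    · refine tendsto_const_nhds.congr' ?_
      filter_upwards [kap_ev hx] with n hn
      rw [hDφ, DD_kap]
      have : Real.smoothTransition =ᶠ[𝓝 (n * rho x - 1)] fun _ => 1 := by
        filter_upwards [lt_mem_nhds hn] with y hy using Real.smoothTransition.one_of_one_le hy.le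
      rw [this.deriv_eq, deriv_const, kap, Real.smoothTransition.one_of_one_le hn.le]
      ring
  have l2 : Tendsto (fun n => ∫ x, ⟪g x, z⟫ * (kap n x * v x) ∂muB d) atTop
      (𝓝 (∫ x, ⟪g x, z⟫ * v x ∂muB d)) := by
    refine tendsto_integral_of_dominated_convergence (fun x => |⟪g x, z⟫| * C2)
      (fun n => (int_mul_cont hgz (hφ n).continuous).1) (hgz.abs.mul_const _)
      (fun n => ae_ball fun x hx => ?_) (ae_ball fun x hx => ?_)
    · rw [norm_mul]
      refine mul_le_mul_of_nonneg_left ?_ (norm_nonneg _)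
      rw [norm_mul, Real.norm_of_nonneg (hk0 n x)]
      calc kap n x * ‖v x‖ ≤ 1 * C2 := by
            gcongr
            · exact hk1 n x
            · exact hC2 x (ball_subset_closedBall hx)
        _ = C2 := one_mul _
    · refine tendsto_const_nhds.congr' ?_
      filter_upwards [kap_ev hx] with n hn
      rw [kap, Real.smoothTransition.one_of_one_le hn.le, one_mul]
  refine tendsto_nhds_unique l1 (l2.neg.congr fun n => ?_)
  exact (wg_test h hw hg (hφ n) (hcs n) (hts n) z).symm

end weak


section repr
variable {d : ℕ}

lemma integrable_cont {g : Euc d → ℝ} (hg : Continuous g) : Integrable g (muB d) :=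
  memLp_one_iff_integrable.1 (cont_memLp hg 1)

lemma euc_sum (w : Euc d) : w = ∑ i, w i • (EuclideanSpace.single i (1 : ℝ) : Euc d) := by
  ext k
  simp [Finset.sum_apply, Pi.single_apply]

lemma gH_inner (B : Euc d →L[ℝ] Euc d →L[ℝ] ℝ) (i : Fin d) (z : Euc d) :
    ⟪((EuclideanSpace.equiv (Fin d) ℝ).symm
            fun j => B (EuclideanSpace.single j 1) (EuclideanSpace.single i 1) : Euc d), z⟫
      = B z (EuclideanSpace.single i 1) := by
  conv_rhs => rw [euc_sum z]
  rw [map_sum, ContinuousLinearMap.sum_apply, PiLp.inner_apply]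
  refine Finset.sum_congr rfl fun j _ => ?_
  rw [map_smul, ContinuousLinearMap.smul_apply]
  simp

lemma H_int {p : ℝ} (hp : 1 < p) {H : Euc d → Euc d →L[ℝ] Euc d →L[ℝ] ℝ}
    (hH : MemLp H (ENNReal.ofReal p) (volume.restrict (ball (0 : Euc d) 1))) (z w : Euc d) :
    Integrable (fun x => H x z w) (muB d) := by
  have hp1 : (1 : ℝ≥0∞) ≤ ENNReal.ofReal p := by simpa using hp.le
  have hc : Continuous (fun B : Euc d →L[ℝ] Euc d →L[ℝ] ℝ => B z w) := by fun_prop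
  have hm : AEStronglyMeasurable (fun x => H x z w) (muB d) := hc.comp_aestronglyMeasurable hH.1
  have hcn : Continuous (fun B : Euc d →L[ℝ] Euc d →L[ℝ] ℝ => ‖B‖) :=
    continuous_norm (E := Euc d →L[ℝ] Euc d →L[ℝ] ℝ)
  have hN : MemLp (fun x => ‖H x‖) (ENNReal.ofReal p) (muB d) :=
    ⟨hcn.comp_aestronglyMeasurable hH.1, (eLpNorm_norm H).trans_lt hH.2⟩
  refine MemLp.integrable hp1 (MemLp.of_le_mul (c := ‖z‖ * ‖w‖) hN hm (Eventually.of_forall fun x => ?_))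
  refine ((H x).le_opNorm₂ z w).trans (le_of_eq ?_)
  rw [Real.norm_of_nonneg (ContinuousLinearMap.opNorm_nonneg (H x))]
  ring

lemma gH_int {H : Euc d → Euc d →L[ℝ] Euc d →L[ℝ] ℝ} (hH : ∀ z w, Integrable (fun x => H x z w) (muB d)) (i : Fin d) :
    Integrable (fun x => ((EuclideanSpace.equiv (Fin d) ℝ).symm
            fun j => H x (EuclideanSpace.single j 1) (EuclideanSpace.single i 1) : Euc d)) (muB d) := by
  refine ContinuousLinearMap.integrable_comp
    ((EuclideanSpace.equiv (Fin d) ℝ).symm : (Fin d → ℝ) →L[ℝ] Euc d) ?_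
  exact Integrable.of_eval fun j => hH _ _

lemma hess_ibp {Du : Euc d → Euc d} {H : Euc d → Euc d →L[ℝ] Euc d →L[ℝ] ℝ}
    (hDu : Integrable Du (muB d)) (hH : ∀ z w, Integrable (fun x => H x z w) (muB d))
    (hW : ∀ i : Fin d, IsWeakGrad (ball (0 : Euc d) 1)
          (fun x => ⟪Du x, EuclideanSpace.single i 1⟫)
          (fun x => (EuclideanSpace.equiv (Fin d) ℝ).symm
            fun j => H x (EuclideanSpace.single j 1) (EuclideanSpace.single i 1)))
    {v : Euc d → ℝ} (hv : ContDiff ℝ ∞ v)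
    (hv0 : ∀ x ∈ sphere (0 : Euc d) 1, v x = 0) (z w : Euc d) :
    ∫ x, ⟪Du x, w⟫ * DD z v x ∂muB d = - ∫ x, H x z w * v x ∂muB d := by
  have h1 : ∀ i : Fin d, ∫ x, ⟪Du x, EuclideanSpace.single i 1⟫ * DD z v x ∂muB d
      = - ∫ x, H x z (EuclideanSpace.single i 1) * v x ∂muB d := by
    intro i
    rw [w_ibp2 (hW i) (hDu.inner_const _) (gH_int hH i) hv hv0 z]
    simp only [gH_inner]
  have e1 : ∀ x, ⟪Du x, w⟫ * DD z v x
      = ∑ i, w i * (⟪Du x, (EuclideanSpace.single i 1 : Euc d)⟫ * DD z v x) := by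
    intro x
    conv_lhs => rw [euc_sum w]
    rw [inner_sum, Finset.sum_mul]
    refine Finset.sum_congr rfl fun i _ => ?_
    rw [real_inner_smul_right, mul_assoc]
  have e2 : ∀ x, H x z w * v x
      = ∑ i, w i * (H x z (EuclideanSpace.single i 1 : Euc d) * v x) := by
    intro x
    conv_lhs => rw [euc_sum w]
    rw [map_sum, Finset.sum_mul]
    refine Finset.sum_congr rfl fun i _ => ?_
    rw [map_smul, smul_eq_mul, mul_assoc]
  simp only [e1, e2]
  rw [integral_finsetSum _ fun i _ =>
      (int_mul_cont (hDu.inner_const _) (DD_smooth hv z).continuous).const_mul _,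
    integral_finsetSum _ fun i _ => (int_mul_cont (hH _ _) hv.continuous).const_mul _,
    ← Finset.sum_neg_distrib]
  refine Finset.sum_congr rfl fun i _ => ?_
  rw [integral_const_mul, integral_const_mul, h1 i, mul_neg]

variable {p : ℝ} {u f : Euc d → ℝ} {Du : Euc d → Euc d} {H : Euc d → Euc d →L[ℝ] Euc d →L[ℝ] ℝ}

lemma weak_dd (hp : 1 < p) (h : MemW1p0 p (ball (0 : Euc d) 1) u Du) (hH : ∀ z w, Integrable (fun x => H x z w) (muB d))
    (hW : ∀ i : Fin d, IsWeakGrad (ball (0 : Euc d) 1)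
          (fun x => ⟪Du x, EuclideanSpace.single i 1⟫)
          (fun x => (EuclideanSpace.equiv (Fin d) ℝ).symm
            fun j => H x (EuclideanSpace.single j 1) (EuclideanSpace.single i 1)))
    {v : Euc d → ℝ} (hv : ContDiff ℝ ∞ v)
    (hv0 : ∀ x ∈ sphere (0 : Euc d) 1, v x = 0) (z w : Euc d) :
    ∫ x, u x * DD z (DD w v) x ∂muB d = ∫ x, H x w z * v x ∂muB d := by
  have hp1 : (1 : ℝ≥0∞) ≤ ENNReal.ofReal p := by simpa using hp.le
  rw [w_ibp1 hp h (DD_smooth hv w) z, hess_ibp (h.2.2.1.integrable hp1) hH hW hv hv0, neg_neg]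

lemma weak_pde (e : OrthonormalBasis (Fin d) ℝ (Euc d)) (a : Fin d → ℝ)
    (hp : 1 < p) (h : MemW1p0 p (ball (0 : Euc d) 1) u Du) (hH : ∀ z w, Integrable (fun x => H x z w) (muB d))
    (hW : ∀ i : Fin d, IsWeakGrad (ball (0 : Euc d) 1)
          (fun x => ⟪Du x, EuclideanSpace.single i 1⟫)
          (fun x => (EuclideanSpace.equiv (Fin d) ℝ).symm
            fun j => H x (EuclideanSpace.single j 1) (EuclideanSpace.single i 1)))
    (htr : ∀ᵐ x ∂muB d, ∑ k, a k * H x (e k) (e k) = f x)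
    {v : Euc d → ℝ} (hv : ContDiff ℝ ∞ v)
    (hv0 : ∀ x ∈ sphere (0 : Euc d) 1, v x = 0) :
    ∫ x, u x * Lop e a v x ∂muB d = ∫ x, f x * v x ∂muB d := by
  have hp1 : (1 : ℝ≥0∞) ≤ ENNReal.ofReal p := by simpa using hp.le
  have hu : Integrable u (muB d) := h.2.1.integrable hp1
  have e1 : ∀ x, u x * Lop e a v x = ∑ k, a k * (u x * DD (e k) (DD (e k) v) x) := by
    intro x
    rw [Lop, Finset.mul_sum]
    exact Finset.sum_congr rfl fun k _ => by ring
  have e2 : ∫ x, f x * v x ∂muB d = ∫ x, ∑ k, a k * (H x (e k) (e k) * v x) ∂muB d := by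
    refine integral_congr_ae ?_
    filter_upwards [htr] with x hx
    rw [← hx, Finset.sum_mul]
    exact Finset.sum_congr rfl fun k _ => by ring
  simp only [e1]
  rw [e2, integral_finsetSum _ fun k _ =>
      (int_mul_cont hu (DD_smooth (DD_smooth hv _) _).continuous).const_mul _,
    integral_finsetSum _ fun k _ => (int_mul_cont (hH _ _) hv.continuous).const_mul _]
  refine Finset.sum_congr rfl fun k _ => ?_
  rw [integral_const_mul, integral_const_mul, weak_dd hp h hH hW hv hv0]

lemma stab (e : OrthonormalBasis (Fin d) ℝ (Euc d)) {a : Fin d → ℝ} {lam : ℝ} (hd : 0 < d)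
    (hlam : 0 < lam) (ha : ∀ k, lam ≤ a k)
    (hu : Integrable u (muB d)) (hf : Integrable f (muB d))
    (hpde : ∀ v : Euc d → ℝ, ContDiff ℝ ∞ v → (∀ x ∈ sphere (0 : Euc d) 1, v x = 0) →
      ∫ x, u x * Lop e a v x ∂muB d = ∫ x, f x * v x ∂muB d)
    (P : MvPolynomial (Fin d) ℝ) {ψ : Euc d → ℝ} (hψ : Continuous ψ) {M : ℝ} (hM0 : 0 ≤ M)
    (hM : ∀ x ∈ closedBall (0 : Euc d) 1, |ψ x| ≤ M) :
    |∫ x, (u x - pf e (uP a hd hlam ha P) x) * ψ x ∂muB d|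
      ≤ M / lam * ∫ x, |f x - pf e P x| ∂muB d := by
  set uu := pf e (uP a hd hlam ha P) with huu
  have hus : ContDiff ℝ ∞ uu := pf_smooth e _
  have hui : Integrable uu (muB d) := integrable_cont hus.continuous
  have hPi : Integrable (pf e P) (muB d) := integrable_cont (pf_smooth e _).continuous
  set F := ∫ x, |f x - pf e P x| ∂muB d with hF
  set U := ∫ x, |u x - uu x| ∂muB d with hU
  have hF0 : 0 ≤ F := integral_nonneg fun x => abs_nonneg _
  have hU0 : 0 ≤ U := integral_nonneg fun x => abs_nonneg _
  refine le_of_forall_pos_le_add fun δ hδ => ?_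
  have hden : 0 < F / lam + U + 1 := by positivity
  set ε := δ / (F / lam + U + 1) with hε
  have hε0 : 0 < ε := div_pos hδ hden
  obtain ⟨Q, hQ⟩ := pf_dense e hψ hε0
  set v := pf e (uP a hd hlam ha Q) with hv
  have hvs : ContDiff ℝ ∞ v := pf_smooth e _
  have hv0 : ∀ x ∈ sphere (0 : Euc d) 1, v x = 0 := fun x hx => uP_sphere e hd hlam ha Q hx
  have hu0 : ∀ x ∈ sphere (0 : Euc d) 1, uu x = 0 := fun x hx => uP_sphere e hd hlam ha P hx
  have hLv : Lop e a v = pf e Q := Lop_uP e hd hlam ha Q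
  have hQc : Continuous (pf e Q) := (pf_smooth e Q).continuous
  have hvb := sup_bound e a hd hlam ha hvs hv0 (ε := M + ε) (by linarith) (fun x hx => by
    rw [hLv]
    have h1 := hQ x (ball_subset_closedBall hx)
    have h2 := hM x (ball_subset_closedBall hx)
    have h3 := abs_add_le (pf e Q x - ψ x) (ψ x)
    rw [sub_add_cancel] at h3
    linarith)
  have k1 : ∫ x, (u x - uu x) * pf e Q x ∂muB d = ∫ x, (f x - pf e P x) * v x ∂muB d := by
    have s1 : ∫ x, uu x * pf e Q x ∂muB d = ∫ x, pf e P x * v x ∂muB d := by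
      have := Lop_symm e (a := a) hus hvs hu0 hv0
      rw [hLv, huu, Lop_uP] at this
      exact this
    have s2 := hpde v hvs hv0
    rw [hLv] at s2
    simp only [sub_mul]
    rw [integral_sub (int_mul_cont hu hQc) (int_mul_cont hui hQc),
      integral_sub (int_mul_cont hf hvs.continuous) (int_mul_cont hPi hvs.continuous), s1, s2]
  have k2 : ∫ x, (u x - uu x) * ψ x ∂muB d = ∫ x, (f x - pf e P x) * v x ∂muB d
      + ∫ x, (u x - uu x) * (ψ x - pf e Q x) ∂muB d := by
    have i1 : Integrable (fun x => (u x - uu x) * pf e Q x) (muB d) :=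
      int_mul_cont (hu.sub hui) hQc
    have i2 : Integrable (fun x => (u x - uu x) * (ψ x - pf e Q x)) (muB d) :=
      int_mul_cont (hu.sub hui) (hψ.sub hQc)
    rw [← k1, ← integral_add i1 i2]
    refine integral_congr_ae (Eventually.of_forall fun x => ?_)
    ring
  rw [k2]
  have b1 := int_mul_bound (hf.sub hPi) (g := v) (C := (M + ε) / lam)
    fun x hx => hvb x (ball_subset_closedBall hx)
  have b2 := int_mul_bound (hu.sub hui) (g := fun x => ψ x - pf e Q x) (C := ε)
    fun x hx => by rw [abs_sub_comm]; exact (hQ x (ball_subset_closedBall hx)).le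
  simp only [Pi.sub_apply] at b1 b2
  refine (abs_add_le _ _).trans ((add_le_add b1 b2).trans ?_)
  rw [← hF, ← hU]
  have : ε * (F / lam + U + 1) = δ := div_mul_cancel₀ _ hden.ne'
  have e3 : (M + ε) / lam * F + ε * U = M / lam * F + ε * (F / lam + U + 1) - ε := by
    field_simp; ring
  rw [e3, this]
  linarith

lemma ident (e : OrthonormalBasis (Fin d) ℝ (Euc d)) {a : Fin d → ℝ} {lam : ℝ} (hd : 0 < d)
    (hlam : 0 < lam) (ha : ∀ k, lam ≤ a k)
    (hp : 1 < p) (h : MemW1p0 p (ball (0 : Euc d) 1) u Du) (hH : ∀ z w, Integrable (fun x => H x z w) (muB d))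
    (hW : ∀ i : Fin d, IsWeakGrad (ball (0 : Euc d) 1)
          (fun x => ⟪Du x, EuclideanSpace.single i 1⟫)
          (fun x => (EuclideanSpace.equiv (Fin d) ℝ).symm
            fun j => H x (EuclideanSpace.single j 1) (EuclideanSpace.single i 1)))
    (hf : Integrable f (muB d))
    (htr : ∀ᵐ x ∂muB d, ∑ k, a k * H x (e k) (e k) = f x)
    (P : ℕ → MvPolynomial (Fin d) ℝ)
    (hP : Tendsto (fun n => ∫ x, |f x - pf e (P n) x| ∂muB d) atTop (𝓝 0))
    (j k : Fin d) {G : Euc d → ℝ} (hG : Integrable G (muB d))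
    (hD : Tendsto (fun n => eLpNorm (pf e (MvPolynomial.pderiv j (MvPolynomial.pderiv k
      (uP a hd hlam ha (P n)))) - G) 1 (muB d)) atTop (𝓝 0)) :
    (fun x => H x (e j) (e k)) =ᵐ[muB d] G := by
  have hp1 : (1 : ℝ≥0∞) ≤ ENNReal.ofReal p := by simpa using hp.le
  have hu : Integrable u (muB d) := h.2.1.integrable hp1
  have hHi := hH (e j) (e k)
  have key : ∀ g : Euc d → ℝ, ContDiff ℝ ∞ g → HasCompactSupport g → tsupport g ⊆ ball (0 : Euc d) 1 →
      ∫ x, g x • (H x (e j) (e k) - G x) ∂muB d = 0 := by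
    intro g hg _ hgs
    have hg0 := sphere_zero hgs
    set ψ := DD (e k) (DD (e j) g) with hψ
    have hψs : ContDiff ℝ ∞ ψ := DD_smooth (DD_smooth hg _) _
    obtain ⟨M, hM0, hM⟩ := cont_bdd hψs.continuous
    have a1 : ∫ x, u x * ψ x ∂muB d = ∫ x, H x (e j) (e k) * g x ∂muB d :=
      weak_dd hp h hH hW hg hg0 (e k) (e j)
    have a2 : ∀ n, ∫ x, pf e (uP a hd hlam ha (P n)) x * ψ x ∂muB d
        = ∫ x, pf e (MvPolynomial.pderiv j (MvPolynomial.pderiv k (uP a hd hlam ha (P n)))) x * g x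
          ∂muB d := by
      intro n
      have := ibp2 hg (pf_smooth e (uP a hd hlam ha (P n))) hg0
        (fun x hx => uP_sphere e hd hlam ha (P n) hx) (e j) (e k)
      rw [DD_pf, DD_pf] at this
      calc _ = ∫ x, DD (e k) (DD (e j) g) x * pf e (uP a hd hlam ha (P n)) x ∂muB d := by
            simp only [hψ, mul_comm]
        _ = _ := this.symm
        _ = _ := by simp only [mul_comm]
    have t1 : Tendsto (fun n => ∫ x, pf e (uP a hd hlam ha (P n)) x * ψ x ∂muB d) atTop
        (𝓝 (∫ x, u x * ψ x ∂muB d)) := by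
      rw [tendsto_iff_norm_sub_tendsto_zero]
      have h2 := hP.const_mul (M / lam)
      rw [mul_zero] at h2
      refine squeeze_zero (fun _ => norm_nonneg _) (fun n => ?_) h2
      rw [norm_sub_rev, ← integral_sub (int_mul_cont hu hψs.continuous)
        (int_mul_cont (integrable_cont (pf_smooth e _).continuous) hψs.continuous)]
      have := stab e hd hlam ha hu hf (fun v hv hv0 => weak_pde e a hp h hH hW htr hv hv0) (P n)
        hψs.continuous hM0 hM
      simp only [sub_mul] at this
      exact this
    have t2 := int_mul_tendsto (fun n => integrable_cont (pf_smooth e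
      (MvPolynomial.pderiv j (MvPolynomial.pderiv k (uP a hd hlam ha (P n))))).continuous) hG hD hg.continuous
    have t3 := tendsto_nhds_unique (t1.congr a2) t2
    rw [a1] at t3
    calc _ = ∫ x, (H x (e j) (e k) * g x - G x * g x) ∂muB d := by
          refine integral_congr_ae (Eventually.of_forall fun x => ?_)
          simp only [smul_eq_mul]; ring
      _ = 0 := by
          rw [integral_sub (int_mul_cont hHi hg.continuous) (int_mul_cont hG hg.continuous), t3, sub_self]
  have := isOpen_ball.ae_eq_zero_of_integral_contDiff_smul_eq_zero (μ := muB d)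
    (U := ball (0 : Euc d) 1) (f := fun x => H x (e j) (e k) - G x)
    ((hHi.sub hG).locallyIntegrable.locallyIntegrableOn _) key
  have hb : ∀ᵐ x ∂muB d, x ∈ ball (0 : Euc d) 1 := ae_ball fun x hx => hx
  filter_upwards [this, hb] with x h1 h2
  exact sub_eq_zero.1 (h1 h2)

end repr


section final
variable {d : ℕ}

variable {p : ℝ} {u f : Euc d → ℝ} {Du : Euc d → Euc d} {H : Euc d → Euc d →L[ℝ] Euc d →L[ℝ] ℝ}

lemma weak_jk (e : OrthonormalBasis (Fin d) ℝ (Euc d)) {a : Fin d → ℝ} {lam Lam : ℝ} (hd : 0 < d)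
    (hlam : 0 < lam) (ha : ∀ k, lam ≤ a k) (ha' : ∀ k, a k ≤ Lam) (hL : 0 < Lam)
    (hp : 1 < p) (h : MemW1p0 p (ball (0 : Euc d) 1) u Du)
    (hH : ∀ z w, Integrable (fun x => H x z w) (muB d))
    (hW : ∀ i : Fin d, IsWeakGrad (ball (0 : Euc d) 1)
          (fun x => ⟪Du x, EuclideanSpace.single i 1⟫)
          (fun x => (EuclideanSpace.equiv (Fin d) ℝ).symm
            fun j => H x (EuclideanSpace.single j 1) (EuclideanSpace.single i 1)))
    (hfp : MemLp f (ENNReal.ofReal p) (muB d))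
    (htr : ∀ᵐ x ∂muB d, ∑ k, a k * H x (e k) (e k) = f x)
    (j k : Fin d) {t : ℝ} (ht : 0 < t) :
    muB d {x | t < |H x (e j) (e k)|}
      ≤ ENNReal.ofReal (CCZ d lam⁻¹ (Chor d lam Lam) / (t / 2) * ∫ x, |f x| ∂muB d) := by
  set C1 := CCZ d lam⁻¹ (Chor d lam Lam) with hC1
  have hA' : 0 ≤ Chor d lam Lam := Chor_nonneg hlam hL
  have hC1p : 0 < C1 := CCZ_pos d hA'
  set T := Tjk e hd hlam ha j k with hTdef
  have hT : ∀ g, ‖T g‖ ≤ lam⁻¹ * ‖g‖ := Tjk_norm e hd hlam ha j k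
  have hHor : Hor (Chor d lam Lam) T := fun y hy ρ hρ b hb hb0 =>
    hormander e hd hlam ha ha' hL j k hy hρ b hb hb0
  have hWk : ∀ (g : Lp ℝ 2 (muB d)) (s : ℝ), 0 < s →
      muB d {x | s < |T g x|} ≤ ENNReal.ofReal (C1 / s * ∫ x, |g x| ∂muB d) :=
    fun g s hs => cz_weak hd hA' T hT hHor g hs
  set q := min p (3 / 2) with hq
  have hq1 : 1 < q := lt_min hp (by norm_num)
  have hq2 : q < 2 := (min_le_right _ _).trans_lt (by norm_num)
  have hqE : (1 : ℝ≥0∞) ≤ ENNReal.ofReal q := by simpa using hq1.le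
  obtain ⟨K, hK, hKb⟩ := strong_q hC1p.le hq1 hq2 T hT hWk
  have hfq : MemLp f (ENNReal.ofReal q) (muB d) :=
    hfp.mono_exponent (ENNReal.ofReal_le_ofReal (min_le_left _ _))
  have hfi : Integrable f (muB d) := hfq.integrable hqE
  choose P hP using fun n : ℕ => pf_dense_Lp e ENNReal.ofReal_ne_top hqE hfq
    (ε := (1 / 2 : ℝ) ^ n) (by positivity)
  have hpow : ∀ n : ℕ, ENNReal.ofReal ((1 / 2 : ℝ) ^ n) = (2⁻¹ : ℝ≥0∞) ^ n := by
    intro n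
    rw [ENNReal.ofReal_pow (by norm_num), one_div, ENNReal.ofReal_inv_of_pos (by norm_num)]
    norm_num
  simp only [hpow] at hP
  set D : ℕ → Euc d → ℝ := fun n => pf e (MvPolynomial.pderiv j (MvPolynomial.pderiv k
      (uP a hd hlam ha (P n)))) with hDdef
  have hDi : ∀ n, Integrable (D n) (muB d) := fun n => integrable_cont (pf_smooth e _).continuous
  have hPi : ∀ n, Integrable (pf e (P n)) (muB d) := fun n => integrable_cont (pf_smooth e _).continuous
  have hDT : ∀ n, T (iota e (P n)) =ᵐ[muB d] D n := by
    intro n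
    rw [hTdef, Tjk_iota]
    exact iota_coe e _
  have hcau : ∀ n m, eLpNorm (D n - D m) 1 (muB d) ≤ K * (2⁻¹ ^ n + 2⁻¹ ^ m) := by
    intro n m
    have e1 : D n - D m =ᵐ[muB d] T (iota e (P n) - iota e (P m)) := by
      rw [map_sub]
      exact (((hDT n).symm.sub (hDT m).symm)).trans (Lp.coeFn_sub _ _).symm
    have e2 : (iota e (P n) - iota e (P m) : Lp ℝ 2 (muB d)) =ᵐ[muB d]
        (f - pf e (P m)) - (f - pf e (P n)) := by
      refine (Lp.coeFn_sub _ _).trans (((iota_coe e _).sub (iota_coe e _)).trans ?_)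
      refine Eventually.of_forall fun x => ?_
      simp only [Pi.sub_apply]; ring
    rw [eLpNorm_congr_ae e1]
    refine (hKb _).trans (mul_le_mul_right ?_ K)
    rw [eLpNorm_congr_ae e2, add_comm]
    refine (eLpNorm_sub_le (hfi.1.sub (hPi m).1) (hfi.1.sub (hPi n).1) hqE).trans ?_
    exact add_le_add (hP m) (hP n)
  obtain ⟨G, hG, hGt⟩ := Lp.cauchy_complete_eLpNorm (le_refl (1 : ℝ≥0∞)) (f := D)
    (fun n => memLp_one_iff_integrable.2 (hDi n)) (B := fun n => (K * 2 + 1) * 2⁻¹ ^ n)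
    (by
      rw [ENNReal.tsum_mul_left, ENNReal.tsum_geometric, ENNReal.one_sub_inv_two, inv_inv]
      exact ENNReal.mul_ne_top (ENNReal.add_ne_top.2 ⟨ENNReal.mul_ne_top hK (by norm_num), by norm_num⟩)
        (by norm_num))
    (by
      intro N n m hn hm
      have hle : ∀ i, N ≤ i → (2⁻¹ : ℝ≥0∞) ^ i ≤ 2⁻¹ ^ N := fun i hi =>
        pow_le_pow_right_of_le_one' (by simp) hi
      have hne : (2⁻¹ : ℝ≥0∞) ^ N ≠ ⊤ := ENNReal.pow_ne_top (by simp)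
      have hn0 : (2⁻¹ : ℝ≥0∞) ^ N ≠ 0 := pow_ne_zero _ (by simp)
      calc eLpNorm (D n - D m) 1 (muB d) ≤ K * (2⁻¹ ^ n + 2⁻¹ ^ m) := hcau n m
        _ ≤ K * (2⁻¹ ^ N + 2⁻¹ ^ N) := by gcongr K * (?_ + ?_); exacts [hle n hn, hle m hm]
        _ = K * 2 * 2⁻¹ ^ N := by rw [← two_mul, mul_assoc]
        _ < K * 2 * 2⁻¹ ^ N + 2⁻¹ ^ N :=
          ENNReal.lt_add_right (ENNReal.mul_ne_top (ENNReal.mul_ne_top hK (by norm_num)) hne) hn0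
        _ = (K * 2 + 1) * 2⁻¹ ^ N := by rw [add_mul, one_mul])
  have hGi : Integrable G (muB d) := memLp_one_iff_integrable.1 hG
  have hp0 : Tendsto (fun n : ℕ => (2⁻¹ : ℝ≥0∞) ^ n) atTop (𝓝 0) :=
    ENNReal.tendsto_pow_atTop_nhds_zero_of_lt_one (by simp)
  have hL1 : Tendsto (fun n => eLpNorm (f - pf e (P n)) 1 (muB d)) atTop (𝓝 0) :=
    L1_of_Lp hq1 (fun n => hfi.1.sub (hPi n).1)
      (tendsto_of_tendsto_of_tendsto_of_le_of_le tendsto_const_nhds hp0 (fun _ => zero_le) hP)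
  have hL1' : Tendsto (fun n => ∫ x, |f x - pf e (P n) x| ∂muB d) atTop (𝓝 0) := by
    have := L1_tend hPi hfi (hL1.congr fun n => eLpNorm_sub_comm _ _ _ _)
    exact this.congr fun n => by simp only [abs_sub_comm]
  have hHG := ident e hd hlam ha hp h hH hW hfi htr P hL1' j k hGi hGt
  have hb := L1_tend hDi hGi hGt
  -- the bound for each n
  have hn : ∀ n, muB d {x | t < |H x (e j) (e k)|} ≤ ENNReal.ofReal
      (C1 / (t / 2) * (∫ x, |f x| ∂muB d + ∫ x, |f x - pf e (P n) x| ∂muB d)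
        + (∫ x, |D n x - G x| ∂muB d) / (t / 2)) := by
    intro n
    have s1 : muB d {x | t < |H x (e j) (e k)|} ≤
        muB d ({x | t / 2 < |T (iota e (P n)) x|} ∪ {x | t / 2 < |D n x - G x|}) := by
      refine measure_mono_ae ?_
      filter_upwards [hHG, hDT n] with x h1 h2 h3
      have h3 : t < |H x (e j) (e k)| := h3
      by_contra hcon
      have hcon' : ¬ (t / 2 < |T (iota e (P n)) x| ∨ t / 2 < |D n x - G x|) := hcon
      rw [not_or, not_lt, not_lt, h2] at hcon'
      rw [h1] at h3
      have h4 := abs_sub_abs_le_abs_sub (G x) (D n x)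
      rw [abs_sub_comm] at h4
      linarith [hcon'.1, hcon'.2]
    have s2 : muB d {x | t / 2 < |D n x - G x|} ≤ ENNReal.ofReal ((∫ x, |D n x - G x| ∂muB d) / (t / 2)) := by
      have := L1_cheb (G := D n - G) (((hDi n).sub hGi).1) Set.univ (s := t / 2)
        (K := ∫ x, |D n x - G x| ∂muB d) (by positivity) (by
          rw [Measure.restrict_univ, ← ofReal_integral_norm_eq_lintegral_enorm ((hDi n).sub hGi)]
          exact le_rfl)
      rw [Measure.restrict_univ] at this
      exact this
    have s3 : ∫ x, |iota e (P n) x| ∂muB d ≤ ∫ x, |f x| ∂muB d + ∫ x, |f x - pf e (P n) x| ∂muB d := by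
      have e3 : ∫ x, |iota e (P n) x| ∂muB d = ∫ x, |pf e (P n) x| ∂muB d := by
        refine integral_congr_ae ?_
        filter_upwards [iota_coe e (P n)] with x hx
        rw [hx]
      have i2 : Integrable (fun x => |f x - pf e (P n) x|) (muB d) := (hfi.sub (hPi n)).abs
      rw [e3, ← integral_add hfi.abs i2]
      refine integral_mono (hPi n).abs (hfi.abs.add i2) fun x => ?_
      have := abs_sub_abs_le_abs_sub (pf e (P n) x) (f x)
      rw [abs_sub_comm] at this
      linarith
    have hI : 0 ≤ ∫ x, |D n x - G x| ∂muB d := integral_nonneg fun x => abs_nonneg _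
    refine s1.trans ((measure_union_le _ _).trans ?_)
    rw [ENNReal.ofReal_add (mul_nonneg (by positivity) (add_nonneg
      (integral_nonneg fun x => abs_nonneg _) (integral_nonneg fun x => abs_nonneg _))) (by positivity)]
    refine add_le_add ((hWk _ _ (by positivity)).trans (ENNReal.ofReal_le_ofReal ?_)) s2
    gcongr
  refine ge_of_tendsto' (x := atTop) (ENNReal.tendsto_ofReal ?_) hn
  have := ((hL1'.const_add (∫ x, |f x| ∂muB d)).const_mul (C1 / (t / 2))).add (hb.div_const (t / 2))
  simpa using this

lemma trace_eq (e : OrthonormalBasis (Fin d) ℝ (Euc d)) {a : Fin d → ℝ} (A : Euc d →L[ℝ] Euc d)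
    (hA : ∀ k, A (e k) = a k • e k) (B : Euc d →L[ℝ] Euc d →L[ℝ] ℝ) :
    ∑ i : Fin d, B (A (EuclideanSpace.single i 1)) (EuclideanSpace.single i 1)
      = ∑ k, a k * B (e k) (e k) := by
  have h1 : ∀ i : Fin d, A (EuclideanSpace.single i 1) = ∑ k, (e k i * a k) • e k := by
    intro i
    conv_lhs => rw [← e.sum_repr' (EuclideanSpace.single i 1)]
    rw [map_sum]
    refine Finset.sum_congr rfl fun k _ => ?_
    rw [map_smul, hA, smul_smul]
    congr 2
    simp [EuclideanSpace.inner_single_right]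
  have h2 : ∀ k, B (e k) (e k) = ∑ i, e k i * B (e k) (EuclideanSpace.single i 1) := by
    intro k
    conv_lhs => enter [2]; rw [euc_sum (e k)]
    rw [map_sum]
    exact Finset.sum_congr rfl fun i _ => by rw [map_smul, smul_eq_mul]
  simp only [h1, h2, map_sum, ContinuousLinearMap.sum_apply, Finset.mul_sum]
  rw [Finset.sum_comm]
  refine Finset.sum_congr rfl fun k _ => Finset.sum_congr rfl fun i _ => ?_
  rw [map_smul, ContinuousLinearMap.smul_apply, smul_eq_mul]
  ring

lemma opnorm_le_sum (e : OrthonormalBasis (Fin d) ℝ (Euc d)) (B : Euc d →L[ℝ] Euc d →L[ℝ] ℝ) :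
    ‖B‖ ≤ ∑ jk : Fin d × Fin d, |B (e jk.1) (e jk.2)| := by
  refine ContinuousLinearMap.opNorm_le_bound₂ B (Finset.sum_nonneg fun _ _ => abs_nonneg _) fun z w => ?_
  have h1 : B z w = ∑ jk : Fin d × Fin d, ⟪e jk.1, z⟫ * (⟪e jk.2, w⟫ * B (e jk.1) (e jk.2)) := by
    rw [Fintype.sum_prod_type]
    have e1 : B z w = ∑ j, ⟪e j, z⟫ * B (e j) w := by
      conv_lhs => rw [← e.sum_repr' z]
      rw [map_sum, ContinuousLinearMap.sum_apply]
      exact Finset.sum_congr rfl fun j _ => by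
        rw [map_smul, ContinuousLinearMap.smul_apply, smul_eq_mul]
    rw [e1]
    refine Finset.sum_congr rfl fun j _ => ?_
    conv_lhs => rw [← e.sum_repr' w]
    rw [map_sum, Finset.mul_sum]
    exact Finset.sum_congr rfl fun k _ => by rw [map_smul, smul_eq_mul]
  have hb : ∀ (k : Fin d) (y : Euc d), |⟪e k, y⟫| ≤ ‖y‖ := by
    intro k y
    have := abs_real_inner_le_norm (e k) y
    rwa [e.norm_eq_one, one_mul] at this
  rw [h1, Finset.sum_mul, Finset.sum_mul]
  refine (Finset.abs_sum_le_sum_abs _ _).trans (Finset.sum_le_sum fun jk _ => ?_)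
  rw [abs_mul, abs_mul]
  calc _ ≤ ‖z‖ * (‖w‖ * |B (e jk.1) (e jk.2)|) := by gcongr <;> apply hb
    _ = _ := by ring

end final


/-- weak type-(1,1) estimate for the Hessian of strong solutions of
constant-coefficient non-divergence form equations in the unit ball. -/
theorem stmt5 (d : ℕ) (lam Lam : ℝ) (hlam : 0 < lam) (hLamlam : lam ≤ Lam) :
    ∃ C : ℝ, 0 < C ∧
      ∀ A₀ : Euc d →L[ℝ] Euc d,
        (∀ ξ η : Euc d, ⟪A₀ ξ, η⟫ = ⟪ξ, A₀ η⟫) →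
        (∀ ξ : Euc d, lam * ‖ξ‖ ^ 2 ≤ ⟪A₀ ξ, ξ⟫ ∧ ⟪A₀ ξ, ξ⟫ ≤ Lam * ‖ξ‖ ^ 2) →
      ∀ p : ℝ, 1 < p →
      ∀ f : Euc d → ℝ, MemLp f (ENNReal.ofReal p) (volume.restrict (ball (0 : Euc d) 1)) →
      ∀ (u : Euc d → ℝ) (Du : Euc d → Euc d) (H : Euc d → Euc d →L[ℝ] Euc d →L[ℝ] ℝ),
        -- u ∈ W^{1,p}₀(B) with weak gradient Du
        MemW1p0 p (ball (0 : Euc d) 1) u Du →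
        -- H is the weak Hessian of u, i.e. each component of Du has weak gradient given by H
        (∀ i : Fin d, IsWeakGrad (ball (0 : Euc d) 1)
          (fun x => ⟪Du x, EuclideanSpace.single i 1⟫)
          (fun x => (EuclideanSpace.equiv (Fin d) ℝ).symm
            fun j => H x (EuclideanSpace.single j 1) (EuclideanSpace.single i 1))) →
        -- u ∈ W^{2,p}(B)
        MemLp H (ENNReal.ofReal p) (volume.restrict (ball (0 : Euc d) 1)) →
        -- tr(A₀ D²u) = f a.e. in B
        (∀ᵐ x ∂(volume.restrict (ball (0 : Euc d) 1)),
          (∑ i : Fin d, H x (A₀ (EuclideanSpace.single i 1)) (EuclideanSpace.single i 1))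
            = f x) →
      ∀ t : ℝ, 0 < t →
        volume {x ∈ ball (0 : Euc d) 1 | t < ‖H x‖}
          ≤ ENNReal.ofReal ((C / t) * ∫ x in ball (0 : Euc d) 1, |f x|) := by
  rcases Nat.eq_zero_or_pos d with rfl | hd
  · refine ⟨1, one_pos, fun A₀ _ _ p _ f _ u Du H _ _ _ _ t ht => ?_⟩
    have hz : {x ∈ ball (0 : Euc 0) 1 | t < ‖H x‖} = ∅ := by
      refine Set.eq_empty_of_forall_notMem fun x hx => ?_
      have h2 : H x = 0 := by
        ext z w
        rw [Subsingleton.elim z 0, map_zero]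
        rfl
      have h1 : t < ‖H x‖ := hx.2
      rw [h2] at h1
      have h3 : ‖(0 : Euc 0 →L[ℝ] Euc 0 →L[ℝ] ℝ)‖ ≤ 0 := by
        refine ContinuousLinearMap.opNorm_le_bound _ le_rfl fun y => ?_
        simp
      exact absurd (ht.trans h1) (not_lt.2 h3)
    rw [hz, measure_empty]
    exact zero_le
  have hL : 0 < Lam := hlam.trans_le hLamlam
  have hC1 : 0 < CCZ d lam⁻¹ (Chor d lam Lam) := CCZ_pos d (Chor_nonneg hlam hL)
  have hdR : (0 : ℝ) < d := by exact_mod_cast hd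
  refine ⟨2 * CCZ d lam⁻¹ (Chor d lam Lam) * (d : ℝ) ^ 4, by positivity, ?_⟩
  intro A₀ hsym hell p hp f hf u Du H hu hW hH htr t ht
  have hS : (A₀ : Euc d →ₗ[ℝ] Euc d).IsSymmetric := fun x y => hsym x y
  have hfin : Module.finrank ℝ (Euc d) = d := finrank_euclideanSpace_fin
  set e := hS.eigenvectorBasis hfin with he
  set a := hS.eigenvalues hfin with hadef
  have hA : ∀ k, A₀ (e k) = a k • e k := fun k => hS.apply_eigenvectorBasis hfin k
  have hval : ∀ k, ⟪A₀ (e k), e k⟫ = a k := by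
    intro k
    rw [hA, real_inner_smul_left, real_inner_self_eq_norm_sq, e.norm_eq_one]
    ring
  have ha : ∀ k, lam ≤ a k := by
    intro k
    have := (hell (e k)).1
    rw [hval, e.norm_eq_one] at this
    linarith
  have ha' : ∀ k, a k ≤ Lam := by
    intro k
    have := (hell (e k)).2
    rw [hval, e.norm_eq_one] at this
    linarith
  have hHi := fun z w => H_int hp hH z w
  have htr' : ∀ᵐ x ∂muB d, ∑ k, a k * H x (e k) (e k) = f x := by
    filter_upwards [htr] with x hx
    rw [← hx, trace_eq e A₀ hA]
  have hs : 0 < t / (d : ℝ) ^ 2 := by positivity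
  have hsub : {x ∈ ball (0 : Euc d) 1 | t < ‖H x‖} ⊆
      (⋃ jk : Fin d × Fin d, {x | t / (d : ℝ) ^ 2 < |H x (e jk.1) (e jk.2)|}) ∩ ball (0 : Euc d) 1 := by
    rintro x ⟨hxb, hx⟩
    refine ⟨?_, hxb⟩
    by_contra hcon
    simp only [Set.mem_iUnion, Set.mem_setOf_eq, not_exists, not_lt] at hcon
    have h1 := opnorm_le_sum e (H x)
    have h2 : ∑ jk : Fin d × Fin d, |H x (e jk.1) (e jk.2)| ≤ t := by
      refine (Finset.sum_le_sum fun jk _ => hcon jk).trans (le_of_eq ?_)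
      rw [Finset.sum_const, Finset.card_univ, Fintype.card_prod, Fintype.card_fin, nsmul_eq_mul]
      push_cast
      field_simp
    have h3 : t < ‖H x‖ := hx
    exact absurd (h1.trans h2) (not_le.2 h3)
  have hIntg : 0 ≤ ∫ x in ball (0 : Euc d) 1, |f x| := integral_nonneg fun x => abs_nonneg _
  calc volume {x ∈ ball (0 : Euc d) 1 | t < ‖H x‖}
      ≤ volume ((⋃ jk : Fin d × Fin d, {x | t / (d : ℝ) ^ 2 < |H x (e jk.1) (e jk.2)|})
          ∩ ball (0 : Euc d) 1) := measure_mono hsub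
    _ = muB d (⋃ jk : Fin d × Fin d, {x | t / (d : ℝ) ^ 2 < |H x (e jk.1) (e jk.2)|}) :=
        (Measure.restrict_apply' measurableSet_ball).symm
    _ ≤ ∑ jk : Fin d × Fin d, muB d {x | t / (d : ℝ) ^ 2 < |H x (e jk.1) (e jk.2)|} :=
        measure_iUnion_fintype_le _ _
    _ ≤ ∑ jk : Fin d × Fin d, ENNReal.ofReal (CCZ d lam⁻¹ (Chor d lam Lam) / (t / (d : ℝ) ^ 2 / 2)
          * ∫ x, |f x| ∂muB d) :=
        Finset.sum_le_sum fun jk _ =>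
          weak_jk e hd hlam ha ha' hL hp hu hHi hW hf htr' jk.1 jk.2 hs
    _ = ENNReal.ofReal ((2 * CCZ d lam⁻¹ (Chor d lam Lam) * (d : ℝ) ^ 4 / t)
          * ∫ x in ball (0 : Euc d) 1, |f x|) := by
        rw [← ENNReal.ofReal_sum_of_nonneg fun jk _ => mul_nonneg (by positivity) hIntg]
        congr 1
        rw [Finset.sum_const, Finset.card_univ, Fintype.card_prod, Fintype.card_fin, nsmul_eq_mul]
        push_cast
        field_simp
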